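/- arXiv:1404.6920 — 3 statements merged into one kernel-verified Lean document; each statement's English description precedes it below -/
import Mathlib

section
/- The algorithm sequence (m̃_k)_{k≥1} converges to P^s(E) as k → ∞. Moreover, for any k such that μ_k(B'(x̃_k, d̃_k)) = μ(B(x̃_k, d̃_k)) (where (x̃_k, d̃_k) is a maximizing pair for m̃_k), one has the lower bound P^s(E) ≥ m̃_k. -/
open Metric Set MeasureTheory Filter Topology
open scoped ENNReal NNReal

noncomputable section

/-- `P^s_δ(A)`: the supremum of `∑ᵢ |Bᵢ|^s` over all `δ`-packings of `A`, i.e. countable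
collections of pairwise disjoint closed balls centered at points of `A` with diameters `≤ δ`.
(Finite packings are represented by padding with empty balls of negative radius, which
contribute `0` to the sum.) -/
def packPre {X : Type*} [PseudoMetricSpace X] (s δ : ℝ) (A : Set X) : ℝ≥0∞ :=
  ⨆ (cen : ℕ → X) (rad : ℕ → ℝ) (_ : ∀ i, cen i ∈ A)
    (_ : ∀ i, Metric.diam (Metric.closedBall (cen i) (rad i)) ≤ δ)
    (_ : Pairwise fun i j =>
      Disjoint (Metric.closedBall (cen i) (rad i)) (Metric.closedBall (cen j) (rad j))),
    ∑' i, ENNReal.ofReal (Metric.diam (Metric.closedBall (cen i) (rad i)) ^ s)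

/-- The packing premeasure `P₀^s(A) = lim_{δ→0} P^s_δ(A)`; since `δ ↦ P^s_δ(A)` is
nondecreasing, the limit is the infimum over `δ > 0`. -/
def packPre0 {X : Type*} [PseudoMetricSpace X] (s : ℝ) (A : Set X) : ℝ≥0∞ :=
  ⨅ (δ : ℝ) (_ : 0 < δ), packPre s δ A

/-- The packing measure `P^s(A) = inf { ∑ᵢ P₀^s(Uᵢ) : A ⊆ ⋃ᵢ Uᵢ }`. -/
def packM {X : Type*} [PseudoMetricSpace X] (s : ℝ) (A : Set X) : ℝ≥0∞ :=
  ⨅ (U : ℕ → Set X) (_ : A ⊆ ⋃ i, U i), ∑' i, packPre0 s (U i)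

/-- The density function `h(x,d) = (2d)^s / μ(B(x,d))` (closed ball). -/
def densityh {X : Type*} [PseudoMetricSpace X] [MeasurableSpace X]
    (μ : MeasureTheory.Measure X) (s : ℝ) (x : X) (d : ℝ) : ℝ≥0∞ :=
  ENNReal.ofReal ((2 * d) ^ s) / μ (Metric.closedBall x d)

/-- The discrete density function `h_k(x,d) = (2d)^s / μ_k(B'(x,d))` (open ball). -/
def densityhk {X : Type*} [PseudoMetricSpace X] [MeasurableSpace X]
    (μ : MeasureTheory.Measure X) (s : ℝ) (x : X) (d : ℝ) : ℝ≥0∞ :=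
  ENNReal.ofReal ((2 * d) ^ s) / μ (Metric.ball x d)

/-- `fWord f σ k = f_{σ 0} ∘ ⋯ ∘ f_{σ (k-1)}`: the composition of the maps along the
first `k` letters of the code `σ` (so `fWord f σ k '' E` is the cylinder set `E_{σ(k)}`). -/
def fWord {X : Type*} {N : ℕ} (f : Fin N → X → X) (σ : ℕ → Fin N) : ℕ → X → X
  | 0 => id
  | (k+1) => fWord f σ k ∘ f (σ k)

/-- `rWord rr σ k = r_{σ 0} ⋯ r_{σ (k-1)}`: the contraction ratio of `fWord f σ k`. -/
def rWord {N : ℕ} (rr : Fin N → ℝ) (σ : ℕ → Fin N) (k : ℕ) : ℝ :=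
  ∏ j ∈ Finset.range k, rr (σ j)

/-- The algorithm's point sets: `algA f 1` is the set of fixed points of the maps `fᵢ`,
and `algA f (k+1) = ⋃ i, fᵢ(algA f k)`; `algA f 0` is unused (empty). -/
def algA {X : Type*} {N : ℕ} (f : Fin N → X → X) : ℕ → Set X
  | 0 => ∅
  | 1 => {x | ∃ i, f i x = x}
  | (k+2) => ⋃ i, f i '' algA f (k+1)

/-- Composition of the maps `fᵢ` along a finite word `w`. -/
def wordComp {X : Type*} {N : ℕ} (f : Fin N → X → X) : ∀ k, (Fin k → Fin N) → X → X
  | 0, _ => id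
  | (k+1), w => f (w 0) ∘ wordComp f k (w ∘ Fin.succ)

/-- The discrete measures `μ_k = ∑_{x ∈ A_k} r_{i_k(x)}^s · δ_x`: the sum runs over all
words `w` of length `k`, with weight `r_w^s` and Dirac mass at the point of `A_k` with
address `w`, namely `f_w(fix(last letter of w))`; `algMu … 0` is unused (zero measure). -/
def algMu {X : Type*} [MeasurableSpace X] {N : ℕ} (f : Fin N → X → X)
    (rr : Fin N → ℝ) (fix : Fin N → X) (s : ℝ) : ℕ → MeasureTheory.Measure X
  | 0 => 0
  | (k+1) => ∑ w : Fin (k+1) → Fin N,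
      ENNReal.ofReal ((∏ j, rr (w j)) ^ s) •
        MeasureTheory.Measure.dirac (wordComp f (k+1) w (fix (w (Fin.last k))))

/-- The algorithm's admissible set of radii
`D_k = {dist(x,y) : x, y ∈ A_k} ∩ [c̃, c̃/r_min]`. -/
def algD {X : Type*} [PseudoMetricSpace X] {N : ℕ} (f : Fin N → X → X)
    (ct rmin : ℝ) (k : ℕ) : Set ℝ :=
  {d | (∃ x ∈ algA f k, ∃ y ∈ algA f k, d = dist x y) ∧ ct ≤ d ∧ d ≤ ct / rmin}

end


/-- Working package of the standing hypotheses. -/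
structure SSHyp {n N : ℕ}
    (f : Fin N → EuclideanSpace ℝ (Fin n) → EuclideanSpace ℝ (Fin n))
    (rr : Fin N → ℝ) (E : Set (EuclideanSpace ℝ (Fin n))) (rmin ρ c s : ℝ)
    (μ : MeasureTheory.Measure (EuclideanSpace ℝ (Fin n)))
    (fix : Fin N → EuclideanSpace ℝ (Fin n)) : Prop where
  hN : 2 ≤ N
  hr : ∀ i, 0 < rr i ∧ rr i < 1
  hsim : ∀ i x y, dist (f i x) (f i y) = rr i * dist x y
  ne : E.Nonempty
  cp : IsCompact E
  inv : E = ⋃ i, f i '' E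
  dm : Metric.diam E = 1
  rmin_mem : ∃ i, rr i = rmin
  rmin_le : ∀ i, rmin ≤ rr i
  ρ0 : 0 < ρ
  ρ1 : ρ < 1
  hρ : ∀ i, rr i ≤ ρ
  c0 : 0 < c
  gap : ∀ i j, i ≠ j → ∀ a ∈ E, ∀ b ∈ E, c ≤ dist (f i a) (f j b)
  s0 : 0 < s
  hsum : ∑ i, rr i ^ s = 1
  prob : IsProbabilityMeasure μ
  ss : ∀ A : Set (EuclideanSpace ℝ (Fin n)), MeasurableSet A →
      μ A = ∑ i, ENNReal.ofReal (rr i ^ s) * μ (f i ⁻¹' A)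
  hfix : ∀ i, f i (fix i) = fix i

namespace SSHyp

variable {n N : ℕ}
    {f : Fin N → EuclideanSpace ℝ (Fin n) → EuclideanSpace ℝ (Fin n)}
    {rr : Fin N → ℝ} {E : Set (EuclideanSpace ℝ (Fin n))} {rmin ρ c s : ℝ}
    {μ : MeasureTheory.Measure (EuclideanSpace ℝ (Fin n))}
    {fix : Fin N → EuclideanSpace ℝ (Fin n)}

theorem cont (H : SSHyp f rr E rmin ρ c s μ fix) (i : Fin N) : Continuous (f i) := by
  have : LipschitzWith ⟨rr i, (H.hr i).1.le⟩ (f i) :=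
    LipschitzWith.of_dist_le_mul fun x y => by rw [H.hsim]; rfl
  exact this.continuous

theorem anti (H : SSHyp f rr E rmin ρ c s μ fix) (i : Fin N) :
    AntilipschitzWith ⟨(rr i)⁻¹, (inv_pos.2 (H.hr i).1).le⟩ (f i) := by
  refine AntilipschitzWith.of_le_mul_dist fun x y => ?_
  rw [H.hsim]
  have := (H.hr i).1
  change dist x y ≤ (rr i)⁻¹ * (rr i * dist x y)
  rw [← mul_assoc, inv_mul_cancel₀ this.ne', one_mul]

theorem lip (H : SSHyp f rr E rmin ρ c s μ fix) (i : Fin N) :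
    LipschitzWith ⟨rr i, (H.hr i).1.le⟩ (f i) :=
  LipschitzWith.of_dist_le_mul fun x y => by rw [H.hsim]; rfl

theorem memb (H : SSHyp f rr E rmin ρ c s μ fix) (i : Fin N) : MeasurableEmbedding (f i) :=
  ((H.anti i).isClosedEmbedding (H.lip i).uniformContinuous).measurableEmbedding

theorem rsp (H : SSHyp f rr E rmin ρ c s μ fix) (i : Fin N) : 0 < rr i ^ s :=
  Real.rpow_pos_of_pos (H.hr i).1 s

/-- self-similarity for all sets -/
theorem ssAll (H : SSHyp f rr E rmin ρ c s μ fix) (A : Set (EuclideanSpace ℝ (Fin n))) :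
    μ A = ∑ i, ENNReal.ofReal (rr i ^ s) * μ (f i ⁻¹' A) := by
  have : μ = ∑ i, ENNReal.ofReal (rr i ^ s) • Measure.map (f i) μ := by
    ext B hB
    rw [H.ss B hB]
    simp only [Measure.finsetSum_apply, Measure.smul_apply, smul_eq_mul]
    refine Finset.sum_congr rfl fun i _ => ?_
    rw [(H.memb i).map_apply]
  conv_lhs => rw [this]
  simp only [Measure.finsetSum_apply, Measure.smul_apply, smul_eq_mul]
  refine Finset.sum_congr rfl fun i _ => ?_
  rw [(H.memb i).map_apply]

theorem mapE (H : SSHyp f rr E rmin ρ c s μ fix) (i : Fin N) {x} (hx : x ∈ E) : f i x ∈ E := by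
  rw [H.inv]; exact mem_iUnion.2 ⟨i, x, hx, rfl⟩

theorem exE (H : SSHyp f rr E rmin ρ c s μ fix) {x} (hx : x ∈ E) : ∃ i, ∃ y ∈ E, f i y = x := by
  rw [H.inv] at hx
  obtain ⟨i, y, hy, h⟩ := mem_iUnion.1 hx
  exact ⟨i, y, hy, h⟩

theorem dist_le_one (H : SSHyp f rr E rmin ρ c s μ fix) {x y} (hx : x ∈ E) (hy : y ∈ E) :
    dist x y ≤ 1 := by
  rw [← H.dm]; exact Metric.dist_le_diam_of_mem H.cp.isBounded hx hy

theorem sumA (H : SSHyp f rr E rmin ρ c s μ fix) : ∑ i, ENNReal.ofReal (rr i ^ s) = 1 := by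
  rw [← ENNReal.ofReal_sum_of_nonneg fun i _ => (H.rsp i).le, H.hsum, ENNReal.ofReal_one]

/-- the measure is carried by the attractor -/
theorem null (H : SSHyp f rr E rmin ρ c s μ fix) : μ Eᶜ = 0 := by
  have := H.prob
  have hcl : IsClosed E := H.cp.isClosed
  have hρ0 := H.ρ0
  have step : ∀ t : ℝ, 0 ≤ t → μ {x | t < infDist x E} ≤ μ {x | t / ρ < infDist x E} := by
    intro t ht
    rw [H.ssAll {x | t < infDist x E}]
    calc _ ≤ ∑ i, ENNReal.ofReal (rr i ^ s) * μ {x | t / ρ < infDist x E} := by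
            refine Finset.sum_le_sum fun i _ => ?_
            gcongr
            intro x hx
            simp only [mem_preimage, mem_ofPred_eq] at hx ⊢
            obtain ⟨y, hy, hxy⟩ := H.cp.exists_infDist_eq_dist H.ne x
            have h1 : infDist (f i x) E ≤ dist (f i x) (f i y) := infDist_le_dist_of_mem (H.mapE i hy)
            rw [H.hsim, ← hxy] at h1
            rw [div_lt_iff₀ hρ0]
            have h2 : rr i * infDist x E ≤ ρ * infDist x E :=
              mul_le_mul_of_nonneg_right (H.hρ i) infDist_nonneg
            linarith
      _ = _ := by rw [← Finset.sum_mul, H.sumA, one_mul]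
  have iter : ∀ t : ℝ, 0 ≤ t → ∀ k : ℕ,
      μ {x | t < infDist x E} ≤ μ {x | t / ρ ^ k < infDist x E} := by
    intro t ht k
    induction k with
    | zero => simp
    | succ k ih =>
      refine ih.trans ((step _ (by positivity)).trans (le_of_eq ?_))
      rw [div_div, ← pow_succ]
  have lim : ∀ t : ℝ, 0 < t → μ {x | t < infDist x E} = 0 := by
    intro t ht
    have hanti : Antitone fun k : ℕ => {x : EuclideanSpace ℝ (Fin n) | t / ρ ^ k < infDist x E} := by
      intro a b hab x hx
      simp only [mem_ofPred_eq] at hx ⊢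
      refine lt_of_le_of_lt ?_ hx
      apply div_le_div_of_nonneg_left ht.le (by positivity)
      exact pow_le_pow_of_le_one hρ0.le H.ρ1.le hab
    have hT := tendsto_measure_iInter_atTop (μ := μ) (fun k =>
      (measurableSet_lt measurable_const (continuous_infDist_pt E).measurable :
        MeasurableSet {x : EuclideanSpace ℝ (Fin n) | t / ρ ^ k < infDist x E}).nullMeasurableSet)
      hanti ⟨0, measure_ne_top _ _⟩
    have hemp : (⋂ k : ℕ, {x : EuclideanSpace ℝ (Fin n) | t / ρ ^ k < infDist x E}) = ∅ := by
      ext x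
      simp only [mem_iInter, mem_ofPred_eq, mem_empty_iff_false, iff_false, not_forall, not_lt]
      have h0 : Tendsto (fun k : ℕ => ρ ^ k * infDist x E) atTop (𝓝 (0 * infDist x E)) :=
        (tendsto_pow_atTop_nhds_zero_of_lt_one hρ0.le H.ρ1).mul_const _
      rw [zero_mul] at h0
      obtain ⟨k, hk⟩ := (h0.eventually (gt_mem_nhds ht)).exists
      refine ⟨k, ?_⟩
      rw [le_div_iff₀ (by positivity)]
      linarith
    rw [hemp, measure_empty] at hT
    exact le_antisymm (ge_of_tendsto' hT fun k => iter t ht.le k) bot_le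
  have hsub : Eᶜ ⊆ ⋃ k : ℕ, {x | 1 / ((k : ℝ) + 1) < infDist x E} := by
    intro x hx
    have : 0 < infDist x E := (hcl.notMem_iff_infDist_pos H.ne).1 hx
    obtain ⟨k, hk⟩ := exists_nat_one_div_lt this
    exact mem_iUnion.2 ⟨k, hk⟩
  exact measure_mono_null hsub (measure_iUnion_null fun k => lim _ (by positivity))

theorem fullE (H : SSHyp f rr E rmin ρ c s μ fix) : μ E = 1 := by
  have := H.prob
  exact (prob_compl_eq_zero_iff H.cp.isClosed.measurableSet).1 H.null

/-- scaling of the measure of small balls -/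
theorem scale (H : SSHyp f rr E rmin ρ c s μ fix) (i : Fin N) {y} (hy : y ∈ E) {d : ℝ}
    (hd : rr i * d < c) :
    μ (closedBall (f i y) (rr i * d)) = ENNReal.ofReal (rr i ^ s) * μ (closedBall y d) := by
  rw [H.ssAll, Finset.sum_eq_single i]
  · congr 2
    ext z
    simp only [mem_preimage, mem_closedBall, H.hsim]
    exact mul_le_mul_iff_right₀ (H.hr i).1
  · intro j _ hji
    have : μ (f j ⁻¹' closedBall (f i y) (rr i * d)) = 0 := by
      refine measure_mono_null ?_ H.null
      intro z hz hzE
      have := H.gap j i hji z hzE y hy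
      simp only [mem_preimage, mem_closedBall] at hz
      linarith
    rw [this, mul_zero]
  · simp

theorem ofReal_scale (H : SSHyp f rr E rmin ρ c s μ fix) (i : Fin N) {d : ℝ} (hd : 0 ≤ d) :
    ENNReal.ofReal ((2 * (rr i * d)) ^ s) =
      ENNReal.ofReal (rr i ^ s) * ENNReal.ofReal ((2 * d) ^ s) := by
  rw [← ENNReal.ofReal_mul (H.rsp i).le, ← Real.mul_rpow (H.hr i).1.le (by positivity)]
  ring_nf

theorem dens_scale_lt (H : SSHyp f rr E rmin ρ c s μ fix) (i : Fin N) {y} (hy : y ∈ E) {d : ℝ}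
    (hd0 : 0 ≤ d) (hd : rr i * d < c) (L : ℝ≥0∞) :
    L * μ (closedBall (f i y) (rr i * d)) < ENNReal.ofReal ((2 * (rr i * d)) ^ s) ↔
    L * μ (closedBall y d) < ENNReal.ofReal ((2 * d) ^ s) := by
  rw [H.scale i hy hd, H.ofReal_scale i hd0, mul_left_comm]
  exact ENNReal.mul_lt_mul_iff_right (by simpa using H.rsp i) ENNReal.ofReal_ne_top

theorem dens_scale_le (H : SSHyp f rr E rmin ρ c s μ fix) (i : Fin N) {y} (hy : y ∈ E) {d : ℝ}
    (hd0 : 0 ≤ d) (hd : rr i * d < c) (L : ℝ≥0∞) :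
    L * μ (closedBall (f i y) (rr i * d)) ≤ ENNReal.ofReal ((2 * (rr i * d)) ^ s) ↔
    L * μ (closedBall y d) ≤ ENNReal.ofReal ((2 * d) ^ s) := by
  rw [H.scale i hy hd, H.ofReal_scale i hd0, mul_left_comm]
  exact ENNReal.mul_le_mul_iff_right (by simpa using H.rsp i) ENNReal.ofReal_ne_top

/-! ### words -/

theorem wdist (H : SSHyp f rr E rmin ρ c s μ fix) (k : ℕ) (w : Fin k → Fin N) (x y) :
    dist (wordComp f k w x) (wordComp f k w y) = (∏ j, rr (w j)) * dist x y := by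
  induction k with
  | zero => simp [wordComp]
  | succ k ih =>
    simp only [wordComp, Function.comp_apply, H.hsim]
    rw [ih, Fin.prod_univ_succ, mul_assoc]
    rfl

theorem wprod_pos (H : SSHyp f rr E rmin ρ c s μ fix) (k : ℕ) (w : Fin k → Fin N) :
    0 < ∏ j, rr (w j) := Finset.prod_pos fun _ _ => (H.hr _).1

theorem wprod_le (H : SSHyp f rr E rmin ρ c s μ fix) (k : ℕ) (w : Fin k → Fin N) :
    ∏ j, rr (w j) ≤ ρ ^ k := by
  calc _ ≤ ∏ _j : Fin k, ρ := Finset.prod_le_prod (fun _ _ => (H.hr _).1.le) fun _ _ => H.hρ _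
    _ = _ := by simp

theorem wmapE (H : SSHyp f rr E rmin ρ c s μ fix) (k : ℕ) (w : Fin k → Fin N) {x} (hx : x ∈ E) :
    wordComp f k w x ∈ E := by
  induction k with
  | zero => simpa [wordComp]
  | succ k ih => exact H.mapE _ (ih _)

theorem wdist_le (H : SSHyp f rr E rmin ρ c s μ fix) (k : ℕ) (w : Fin k → Fin N) {x y}
    (hx : x ∈ E) (hy : y ∈ E) :
    dist (wordComp f k w x) (wordComp f k w y) ≤ ρ ^ k := by
  rw [H.wdist]
  calc _ ≤ ρ ^ k * 1 := mul_le_mul (H.wprod_le k w) (H.dist_le_one hx hy) dist_nonneg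
        (pow_nonneg H.ρ0.le k)
    _ = _ := mul_one _

theorem wexE (H : SSHyp f rr E rmin ρ c s μ fix) (k : ℕ) {x} (hx : x ∈ E) :
    ∃ w : Fin k → Fin N, ∃ y ∈ E, wordComp f k w y = x := by
  induction k generalizing x with
  | zero => exact ⟨Fin.elim0, x, hx, rfl⟩
  | succ k ih =>
    obtain ⟨i, y, hy, rfl⟩ := H.exE hx
    obtain ⟨w, z, hz, rfl⟩ := ih hy
    refine ⟨Fin.cons i w, z, hz, ?_⟩
    simp only [wordComp, Function.comp_apply, Fin.cons_zero]
    rfl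

theorem wss (H : SSHyp f rr E rmin ρ c s μ fix) (k : ℕ) (A : Set (EuclideanSpace ℝ (Fin n))) :
    μ A = ∑ w : Fin k → Fin N, ENNReal.ofReal ((∏ j, rr (w j)) ^ s) * μ (wordComp f k w ⁻¹' A) := by
  induction k generalizing A with
  | zero => simp [wordComp]
  | succ k ih =>
    rw [H.ssAll A, ← (Fin.consEquiv fun _ => Fin N).sum_comp, Fintype.sum_prod_type]
    refine Finset.sum_congr rfl fun i _ => ?_
    rw [ih (f i ⁻¹' A), Finset.mul_sum]
    refine Finset.sum_congr rfl fun w _ => ?_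
    rw [← mul_assoc, ← ENNReal.ofReal_mul (H.rsp i).le,
      ← Real.mul_rpow (H.hr i).1.le (H.wprod_pos k w).le]
    simp only [Fin.consEquiv, Equiv.coe_fn_mk, Fin.prod_univ_succ, Fin.cons_zero, Fin.cons_succ]
    congr 2

theorem wsum (H : SSHyp f rr E rmin ρ c s μ fix) (k : ℕ) :
    ∑ w : Fin k → Fin N, ENNReal.ofReal ((∏ j, rr (w j)) ^ s) = 1 := by
  have := H.prob
  have h := H.wss k univ
  simpa using h.symm

theorem fixE (H : SSHyp f rr E rmin ρ c s μ fix) (i : Fin N) : fix i ∈ E := by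
  obtain ⟨x, hx⟩ := H.ne
  have hm : ∀ m : ℕ, (f i)^[m] x ∈ E ∧ dist ((f i)^[m] x) (fix i) = rr i ^ m * dist x (fix i) := by
    intro m
    induction m with
    | zero => simpa using hx
    | succ m ih =>
      rw [Function.iterate_succ_apply']
      refine ⟨H.mapE i ih.1, ?_⟩
      conv_lhs => rw [← H.hfix i]
      rw [H.hsim, ih.2]; ring
  have ht : Tendsto (fun m : ℕ => (f i)^[m] x) atTop (𝓝 (fix i)) := by
    rw [tendsto_iff_dist_tendsto_zero]
    simp only [(hm _).2]
    simpa using (tendsto_pow_atTop_nhds_zero_of_lt_one (H.hr i).1.le (H.hr i).2).mul_const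
      (dist x (fix i))
  exact H.cp.isClosed.mem_of_tendsto ht (Eventually.of_forall fun m => (hm m).1)

theorem fix_uniq (H : SSHyp f rr E rmin ρ c s μ fix) (i : Fin N) {x} (hx : f i x = x) :
    x = fix i := by
  have h := H.hsim i x (fix i)
  rw [hx, H.hfix] at h
  have h1 := (H.hr i).2
  have : dist x (fix i) = 0 := by
    have h0 : 0 ≤ dist x (fix i) := dist_nonneg
    nlinarith
  exact dist_eq_zero.1 this

theorem algA_sub (H : SSHyp f rr E rmin ρ c s μ fix) : ∀ k, algA f k ⊆ E
  | 0 => by simp [algA]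
  | 1 => by
    rintro x ⟨i, hi⟩
    rw [H.fix_uniq i hi]; exact H.fixE i
  | (k+2) => by
    intro x hx
    simp only [algA, mem_iUnion] at hx
    obtain ⟨i, y, hy, rfl⟩ := hx
    exact H.mapE i (algA_sub H (k+1) hy)

theorem algA_fin (H : SSHyp f rr E rmin ρ c s μ fix) : ∀ k, (algA f k).Finite
  | 0 => by simp [algA]
  | 1 => by
    refine (Set.finite_range fix).subset ?_
    rintro x ⟨i, hi⟩
    exact ⟨i, (H.fix_uniq i hi).symm⟩
  | (k+2) => Set.finite_iUnion fun i => (algA_fin H (k+1)).image _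

theorem algA_succ (f : Fin N → EuclideanSpace ℝ (Fin n) → EuclideanSpace ℝ (Fin n)) :
    ∀ k, algA f k ⊆ algA f (k+1)
  | 0 => by simp [algA]
  | 1 => by
    rintro x ⟨i, hi⟩
    exact mem_iUnion.2 ⟨i, x, ⟨i, hi⟩, hi⟩
  | (k+2) => by
    intro x hx
    simp only [algA, mem_iUnion] at hx ⊢
    obtain ⟨i, y, hy, rfl⟩ := hx
    exact ⟨i, y, algA_succ f (k+1) hy, rfl⟩

theorem algA_mono (f : Fin N → EuclideanSpace ℝ (Fin n) → EuclideanSpace ℝ (Fin n)) :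
    Monotone (algA f) := monotone_nat_of_le_succ (algA_succ f)

theorem algA_map {k : ℕ} {x} (hx : x ∈ algA f k) (i : Fin N) : f i x ∈ algA f (k+1) := by
  cases k with
  | zero => simp [algA] at hx
  | succ k => exact mem_iUnion.2 ⟨i, x, hx, rfl⟩

theorem algA_ex {k : ℕ} {x} (hx : x ∈ algA f k) : ∃ i, ∃ l, ∃ y ∈ algA f l, f i y = x := by
  match k, hx with
  | 1, hx =>
    obtain ⟨i, hi⟩ := hx
    exact ⟨i, 1, x, ⟨i, hi⟩, hi⟩
  | (k+2), hx =>
    obtain ⟨i, y, hy, h⟩ := mem_iUnion.1 hx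
    exact ⟨i, k+1, y, hy, h⟩

theorem pt_mem (H : SSHyp f rr E rmin ρ c s μ fix) (k : ℕ) (w : Fin (k+1) → Fin N) :
    wordComp f (k+1) w (fix (w (Fin.last k))) ∈ algA f (k+1) := by
  induction k with
  | zero =>
    refine ⟨w 0, ?_⟩
    simp [wordComp, H.hfix]
  | succ k ih => exact mem_iUnion.2 ⟨w 0, _, ih (w ∘ Fin.succ), rfl⟩

/-- density of the algorithm points -/
theorem algA_near (H : SSHyp f rr E rmin ρ c s μ fix) (k : ℕ) {x} (hx : x ∈ E) :
    ∃ p ∈ algA f (k+1), dist p x ≤ ρ ^ (k+1) := by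
  obtain ⟨w, y, hy, rfl⟩ := H.wexE (k+1) hx
  exact ⟨_, H.pt_mem k w, H.wdist_le _ _ (H.fixE _) hy⟩

theorem algMu_le (H : SSHyp f rr E rmin ρ c s μ fix) (k : ℕ)
    {S T : Set (EuclideanSpace ℝ (Fin n))} (hS : MeasurableSet S)
    (h : ∀ w : Fin (k+1) → Fin N, wordComp f (k+1) w (fix (w (Fin.last k))) ∈ S →
      ∀ y ∈ E, wordComp f (k+1) w y ∈ T) :
    algMu f rr fix s (k+1) S ≤ μ T := by
  rw [H.wss (k+1) T]
  simp only [algMu, Measure.finsetSum_apply, Measure.smul_apply, smul_eq_mul,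
    Measure.dirac_apply' _ hS]
  refine Finset.sum_le_sum fun w _ => ?_
  gcongr
  by_cases hw : wordComp f (k+1) w (fix (w (Fin.last k))) ∈ S
  · rw [indicator_of_mem hw, Pi.one_apply, ← H.fullE]
    exact measure_mono fun y hy => h w hw y hy
  · rw [indicator_of_notMem hw]; exact zero_le

theorem le_algMu (H : SSHyp f rr E rmin ρ c s μ fix) (k : ℕ)
    {S T : Set (EuclideanSpace ℝ (Fin n))} (hS : MeasurableSet S)
    (h : ∀ w : Fin (k+1) → Fin N, ∀ y ∈ E, wordComp f (k+1) w y ∈ T →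
      wordComp f (k+1) w (fix (w (Fin.last k))) ∈ S) :
    μ T ≤ algMu f rr fix s (k+1) S := by
  have := H.prob
  rw [H.wss (k+1) T]
  simp only [algMu, Measure.finsetSum_apply, Measure.smul_apply, smul_eq_mul,
    Measure.dirac_apply' _ hS]
  refine Finset.sum_le_sum fun w _ => ?_
  gcongr
  by_cases hw : wordComp f (k+1) w (fix (w (Fin.last k))) ∈ S
  · rw [indicator_of_mem hw, Pi.one_apply]
    exact prob_le_one
  · have h0 : μ (wordComp f (k+1) w ⁻¹' T) = 0 :=
      measure_mono_null (fun y hy hyE => hw (h w y hyE hy)) H.null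
    rw [h0]
    exact zero_le

/-! ### good balls -/

theorem good_map (H : SSHyp f rr E rmin ρ c s μ fix) {L : ℝ≥0∞} {δ : ℝ} (hδ : δ ≤ c) (i : Fin N)
    {y} (hy : y ∈ E) (h : ∃ t, 0 < t ∧ t < δ ∧ L * μ (closedBall y t) ≤ ENNReal.ofReal ((2 * t) ^ s)) :
    f i y ∈ E ∧ ∃ t, 0 < t ∧ t < ρ * δ ∧
      L * μ (closedBall (f i y) t) ≤ ENNReal.ofReal ((2 * t) ^ s) := by
  obtain ⟨t, h0, h1, h2⟩ := h
  have hr := H.hr i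
  refine ⟨H.mapE i hy, rr i * t, mul_pos hr.1 h0, ?_, ?_⟩
  · calc rr i * t < rr i * δ := by gcongr; exact hr.1
      _ ≤ ρ * δ := mul_le_mul_of_nonneg_right (H.hρ i) (h0.trans h1).le
  · refine (H.dens_scale_le i hy h0.le ?_ L).2 h2
    nlinarith

/-- shrinking the radius slightly keeps a strict inequality -/
theorem shrink (H : SSHyp f rr E rmin ρ c s μ fix) {M : ℝ≥0∞} {d : ℝ} (hd : 0 < d)
    (h : M < ENNReal.ofReal ((2 * d) ^ s)) :
    ∃ η, 0 < η ∧ η < d ∧ M < ENNReal.ofReal ((2 * (d - η)) ^ s) := by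
  have hc : Tendsto (fun η : ℝ => ENNReal.ofReal ((2 * (d - η)) ^ s)) (𝓝[>] 0)
      (𝓝 (ENNReal.ofReal ((2 * d) ^ s))) := by
    refine (ENNReal.continuous_ofReal.tendsto _).comp ?_
    have : Continuous fun η : ℝ => (2 * (d - η)) ^ s :=
      Continuous.rpow_const (by fun_prop) fun _ => Or.inr H.s0.le
    have h2 := this.tendsto 0
    simp only [sub_zero] at h2
    exact h2.mono_left nhdsWithin_le_nhds
  have e1 := hc.eventually (lt_mem_nhds h)
  have e2 : ∀ᶠ η in 𝓝[>] (0:ℝ), η ∈ Ioo 0 d := Ioo_mem_nhdsGT hd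
  obtain ⟨η, h1, h2⟩ := (e1.and e2).exists
  exact ⟨η, h2.1, h2.2, h1⟩

theorem near_lt (H : SSHyp f rr E rmin ρ c s μ fix) {L : ℝ≥0∞} {x} {d : ℝ} (hd : 0 < d)
    (h : L * μ (closedBall x d) < ENNReal.ofReal ((2 * d) ^ s)) :
    ∃ η, 0 < η ∧ η < d ∧ ∀ y, dist y x ≤ η →
      L * μ (closedBall y (d - η)) < ENNReal.ofReal ((2 * (d - η)) ^ s) := by
  obtain ⟨η, h0, h1, h2⟩ := H.shrink hd h
  refine ⟨η, h0, h1, fun y hy => lt_of_le_of_lt ?_ h2⟩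
  gcongr
  exact closedBall_subset_closedBall' (by linarith)

theorem exists_pow_le (H : SSHyp f rr E rmin ρ c s μ fix) {η : ℝ} (hη : 0 < η) :
    ∃ k : ℕ, ρ ^ k < η := exists_pow_lt_of_lt_one hη H.ρ1

/-- almost every point is the centre of arbitrarily small good balls -/
theorem good_ae (H : SSHyp f rr E rmin ρ c s μ fix) {L : ℝ≥0∞} {x} (hx : x ∈ E) {d : ℝ}
    (hd : 0 < d) (hdc : d < c)
    (h : L * μ (closedBall x d) < ENNReal.ofReal ((2 * d) ^ s)) (m : ℕ) :
    μ {y | y ∈ E ∧ ∃ t, 0 < t ∧ t < ρ ^ m * c ∧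
      L * μ (closedBall y t) ≤ ENNReal.ofReal ((2 * t) ^ s)}ᶜ = 0 := by
  have := H.prob
  have hρ0 := H.ρ0
  have hc0 := H.c0
  induction m with
  | zero =>
    set G : Set (EuclideanSpace ℝ (Fin n)) := {y | y ∈ E ∧ ∃ t, 0 < t ∧ t < ρ ^ 0 * c ∧
      L * μ (closedBall y t) ≤ ENNReal.ofReal ((2 * t) ^ s)} with hG
    have hmap : ∀ i, ∀ y ∈ G, f i y ∈ G := by
      rintro i y ⟨hy, t, ht⟩
      rw [pow_zero, one_mul] at ht
      obtain ⟨h1, t', h2, h3, h4⟩ := H.good_map le_rfl i hy ⟨t, ht⟩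
      refine ⟨h1, t', h2, ?_, h4⟩
      rw [pow_zero, one_mul]
      nlinarith [H.ρ1]
    have hw : ∀ k (w : Fin k → Fin N), ∀ y ∈ G, wordComp f k w y ∈ G := by
      intro k
      induction k with
      | zero => intro w y hy; exact hy
      | succ k ih => intro w y hy; exact hmap _ _ (ih _ _ hy)
    obtain ⟨η, h0, h1, h2⟩ := H.near_lt hd h
    obtain ⟨k, hk⟩ := H.exists_pow_le h0
    obtain ⟨u, y0, hy0, hu⟩ := H.wexE k hx
    have hsub : wordComp f k u ⁻¹' Gᶜ ⊆ Eᶜ := by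
      intro y hy hyE
      refine hy ⟨H.wmapE k u hyE, d - η, by linarith, ?_, (h2 _ ?_).le⟩
      · rw [pow_zero, one_mul]; linarith
      · rw [← hu]; exact (H.wdist_le k u hyE hy0).trans hk.le
    have hnull : μ (wordComp f k u ⁻¹' Gᶜ) = 0 := measure_mono_null hsub H.null
    have key : μ Gᶜ + ENNReal.ofReal ((∏ j, rr (u j)) ^ s) * μ Gᶜ ≤ μ Gᶜ := by
      calc μ Gᶜ + ENNReal.ofReal ((∏ j, rr (u j)) ^ s) * μ Gᶜ
          = ∑ w : Fin k → Fin N, (ENNReal.ofReal ((∏ j, rr (w j)) ^ s) *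
              μ (wordComp f k w ⁻¹' Gᶜ) +
              if w = u then ENNReal.ofReal ((∏ j, rr (u j)) ^ s) * μ Gᶜ else 0) := by
            rw [Finset.sum_add_distrib, ← H.wss k, Finset.sum_ite_eq' Finset.univ u]
            simp
        _ ≤ ∑ w : Fin k → Fin N, ENNReal.ofReal ((∏ j, rr (w j)) ^ s) * μ Gᶜ := by
            refine Finset.sum_le_sum fun w _ => ?_
            split_ifs with hwu
            · subst hwu
              rw [hnull, mul_zero, zero_add]
            · rw [add_zero]
              gcongr
              exact fun y hy hyG => hy (hw k w y hyG)
        _ = μ Gᶜ := by rw [← Finset.sum_mul, H.wsum, one_mul]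
    have hz : ENNReal.ofReal ((∏ j, rr (u j)) ^ s) * μ Gᶜ = 0 := by
      by_contra hne
      exact absurd key (not_le.2 (ENNReal.lt_add_right (measure_ne_top _ _) hne))
    rcases mul_eq_zero.1 hz with h3 | h3
    · exfalso
      have := Real.rpow_pos_of_pos (H.wprod_pos k u) s
      rw [ENNReal.ofReal_eq_zero] at h3
      linarith
    · exact h3
  | succ m ih =>
    rw [H.ssAll]
    refine Finset.sum_eq_zero fun i _ => ?_
    refine mul_eq_zero_of_right _ (measure_mono_null ?_ ih)
    rintro y hy ⟨hyE, hg⟩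
    refine hy ?_
    have := H.good_map (mul_le_of_le_one_left hc0.le (pow_le_one₀ hρ0.le H.ρ1.le)) i hyE hg
    rw [← mul_assoc, ← pow_succ'] at this
    exact this

theorem nontriv (H : SSHyp f rr E rmin ρ c s μ fix) : Nontrivial (EuclideanSpace ℝ (Fin n)) := by
  by_contra hn
  rw [not_nontrivial_iff_subsingleton] at hn
  have : Metric.diam E = 0 := Metric.diam_subsingleton (Set.subsingleton_of_subsingleton)
  rw [H.dm] at this
  exact one_ne_zero this

theorem diam_ball (H : SSHyp f rr E rmin ρ c s μ fix) (x : EuclideanSpace ℝ (Fin n)) {t : ℝ}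
    (ht : 0 ≤ t) : Metric.diam (closedBall x t) = 2 * t := by
  have := H.nontriv
  exact Metric.diam_closedBall_eq x ht

/-- lower bound for the packing premeasure of an arbitrary set -/
theorem pre0_lower (H : SSHyp f rr E rmin ρ c s μ fix) {L : ℝ≥0∞} {x} (hx : x ∈ E) {d : ℝ}
    (hd : 0 < d) (hdc : d < c)
    (h : L * μ (closedBall x d) < ENNReal.ofReal ((2 * d) ^ s)) (U : Set (EuclideanSpace ℝ (Fin n))) :
    L * μ U ≤ packPre0 s U := by
  have := H.prob
  refine le_iInf₂ fun δ hδ => ?_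
  set G : Set (EuclideanSpace ℝ (Fin n)) := ⋂ m : ℕ, {y | y ∈ E ∧ ∃ t, 0 < t ∧ t < ρ ^ m * c ∧
      L * μ (closedBall y t) ≤ ENNReal.ofReal ((2 * t) ^ s)} with hG
  have hGn : μ Gᶜ = 0 := by
    rw [hG, compl_iInter]
    exact measure_iUnion_null fun m => H.good_ae hx hd hdc h m
  obtain ⟨t, r, tc, tU, hr, hcov, hdisj⟩ := Besicovitch.exists_disjoint_closedBall_covering_ae μ
    (fun y => {q | L * μ (closedBall y q) ≤ ENNReal.ofReal ((2 * q) ^ s)}) (U ∩ G) (by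
      rintro y ⟨-, hy⟩ δ' hδ'
      obtain ⟨m, hm⟩ := H.exists_pow_le (div_pos hδ' H.c0)
      obtain ⟨-, q, q0, q1, q2⟩ := mem_iInter.1 hy m
      refine ⟨q, q2, q0, q1.trans ?_⟩
      rwa [lt_div_iff₀ H.c0] at hm) (fun _ => δ / 2) (fun _ _ => half_pos hδ)
  have hUm : μ U ≤ ∑' y : t, μ (closedBall (y : EuclideanSpace ℝ (Fin n)) (r y)) := by
    have hsub : U ⊆ ((U ∩ G) \ ⋃ y ∈ t, closedBall y (r y)) ∪ Gᶜ ∪ ⋃ y ∈ t, closedBall y (r y) := by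
      intro y hy
      by_cases h1 : y ∈ G <;> by_cases h2 : y ∈ ⋃ y ∈ t, closedBall y (r y)
      · exact Or.inr h2
      · exact Or.inl (Or.inl ⟨⟨hy, h1⟩, h2⟩)
      · exact Or.inr h2
      · exact Or.inl (Or.inr h1)
    calc μ U ≤ _ := measure_mono hsub
      _ ≤ _ := measure_union_le _ _
      _ ≤ 0 + μ (⋃ y ∈ t, closedBall y (r y)) := by
          gcongr
          exact (measure_union_le _ _).trans (by rw [hcov, hGn, add_zero])
      _ ≤ _ := by
          rw [zero_add]
          exact measure_biUnion_le μ tc _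
  have hsum : L * μ U ≤ ∑' y : t,
      ENNReal.ofReal (Metric.diam (closedBall (y : EuclideanSpace ℝ (Fin n)) (r y)) ^ s) := by
    calc L * μ U ≤ L * ∑' y : t, μ (closedBall (y : EuclideanSpace ℝ (Fin n)) (r y)) := by gcongr
      _ = ∑' y : t, L * μ (closedBall (y : EuclideanSpace ℝ (Fin n)) (r y)) :=
          ENNReal.tsum_mul_left.symm
      _ ≤ _ := by
          refine ENNReal.tsum_le_tsum fun y => ?_
          have hy := hr y y.2
          rw [H.diam_ball _ hy.2.1.le]
          exact hy.1
  rcases t.eq_empty_or_nonempty with rfl | ⟨u0, hu0⟩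
  · have : L * μ U = 0 := by simpa using hsum
    rw [this]; exact zero_le
  refine hsum.trans ?_
  have := tc.toEncodable
  let cen : ℕ → EuclideanSpace ℝ (Fin n) := fun i =>
    match Encodable.decode₂ t i with
    | some y => y
    | none => u0
  let rad : ℕ → ℝ := fun i =>
    match Encodable.decode₂ t i with
    | some y => r y
    | none => -1
  have hcase : ∀ i, (∃ y : t, Encodable.decode₂ t i = some y ∧ cen i = y ∧ rad i = r y) ∨
      (Encodable.decode₂ t i = none ∧ cen i = u0 ∧ rad i = -1) := by
    intro i
    rcases hdec : Encodable.decode₂ t i with _ | y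
    · right; simp [cen, rad, hdec]
    · left; exact ⟨y, by simp [cen, rad, hdec]⟩
  have henc : ∀ y : t, cen (Encodable.encode y) = y ∧ rad (Encodable.encode y) = r y := by
    intro y
    simp [cen, rad]
  have hempty : ∀ z : EuclideanSpace ℝ (Fin n), closedBall z (-1) = ∅ := fun z =>
    closedBall_eq_empty.2 (by norm_num)
  refine le_trans ?_ (le_iSup_of_le cen (le_iSup_of_le rad (le_iSup_of_le ?_ (le_iSup_of_le ?_
    (le_iSup_of_le ?_ le_rfl)))))
  · calc _ = ∑' y : t, (fun i => ENNReal.ofReal (Metric.diam (closedBall (cen i) (rad i)) ^ s))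
          (Encodable.encode y) := by
            refine tsum_congr fun y => ?_
            simp only [henc y]
      _ ≤ _ := ENNReal.tsum_comp_le_tsum_of_injective Encodable.encode_injective _
  · intro i
    rcases hcase i with ⟨y, -, h1, -⟩ | ⟨-, h1, -⟩
    · rw [h1]; exact (tU y.2).1
    · rw [h1]; exact (tU hu0).1
  · intro i
    rcases hcase i with ⟨y, -, h1, h2⟩ | ⟨-, h1, h2⟩
    · have hy := hr y y.2
      rw [h1, h2, H.diam_ball _ hy.2.1.le]
      have := hy.2.2
      linarith
    · rw [h2, hempty, Metric.diam_empty]; exact hδ.le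
  · intro i j hij
    rcases hcase i with ⟨y, e1, h1, h2⟩ | ⟨-, h1, h2⟩
    · rcases hcase j with ⟨z, e2, h3, h4⟩ | ⟨-, h3, h4⟩
      · simp only [h1, h2, h3, h4]
        refine hdisj y.2 z.2 fun hyz => hij ?_
        rw [Encodable.decode₂_eq_some] at e1 e2
        rw [← e1, ← e2, Subtype.ext hyz]
      · simp only [h4, hempty]; exact disjoint_bot_right
    · simp only [h2, hempty]; exact disjoint_bot_left

theorem packM_lower (H : SSHyp f rr E rmin ρ c s μ fix) {L : ℝ≥0∞} {x} (hx : x ∈ E) {d : ℝ}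
    (hd : 0 < d) (hdc : d < c)
    (h : L * μ (closedBall x d) < ENNReal.ofReal ((2 * d) ^ s)) : L ≤ packM s E := by
  refine le_iInf₂ fun U hU => ?_
  calc L = L * μ E := by rw [H.fullE, mul_one]
    _ ≤ L * ∑' i, μ (U i) := by
        gcongr
        exact (measure_mono hU).trans (measure_iUnion_le U)
    _ = ∑' i, L * μ (U i) := ENNReal.tsum_mul_left.symm
    _ ≤ _ := ENNReal.tsum_le_tsum fun i => H.pre0_lower hx hd hdc h (U i)

theorem rmin_pos (H : SSHyp f rr E rmin ρ c s μ fix) : 0 < rmin := by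
  obtain ⟨i, hi⟩ := H.rmin_mem
  rw [← hi]; exact (H.hr i).1

theorem le_of_forall_mul_lt {P M a : ℝ≥0∞} (hM : M ≠ ⊤) (hM0 : M ≠ 0)
    (h : ∀ L, L * M < a → L ≤ P) : a ≤ P * M := by
  by_contra hlt
  rw [not_le] at hlt
  have hPM : P < a / M := by
    rwa [ENNReal.lt_div_iff_mul_lt (Or.inl hM0) (Or.inl hM)]
  obtain ⟨L, h1, h2⟩ := exists_between hPM
  refine absurd (h L ?_) (not_le.2 h1)
  exact ENNReal.mul_lt_of_lt_div h2

theorem ball_pos (H : SSHyp f rr E rmin ρ c s μ fix) {x} (hx : x ∈ E) {d : ℝ} (hd : 0 < d) :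
    μ (closedBall x d) ≠ 0 := by
  obtain ⟨k, hk⟩ := H.exists_pow_le hd
  obtain ⟨w, y, hy, hwy⟩ := H.wexE k hx
  intro h0
  rw [H.wss k, Finset.sum_eq_zero_iff] at h0
  rcases mul_eq_zero.1 (h0 w (Finset.mem_univ _)) with h1 | h1
  · have := Real.rpow_pos_of_pos (H.wprod_pos k w) s
    rw [ENNReal.ofReal_eq_zero] at h1
    linarith
  · have hsub : E ⊆ wordComp f k w ⁻¹' closedBall x d := by
      intro z hz
      have h2 := H.wdist_le k w hz hy
      rw [hwy] at h2
      rw [mem_preimage, mem_closedBall]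
      exact h2.trans hk.le
    have : μ E = 0 := measure_mono_null hsub h1
    rw [H.fullE] at this
    exact one_ne_zero this

theorem dens_le_lt (H : SSHyp f rr E rmin ρ c s μ fix) {x} (hx : x ∈ E) {d : ℝ}
    (hd : 0 < d) (hdc : d < c / rmin) :
    ENNReal.ofReal ((2 * d) ^ s) ≤ packM s E * μ (closedBall x d) := by
  have := H.prob
  refine le_of_forall_mul_lt (measure_ne_top _ _) (H.ball_pos hx hd) fun L hL => ?_
  obtain ⟨i, hi⟩ := H.rmin_mem
  have hlt : rr i * d < c := by
    rw [hi]
    rw [lt_div_iff₀ H.rmin_pos] at hdc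
    linarith
  exact H.packM_lower (H.mapE i hx) (mul_pos (H.hr i).1 hd) hlt
    ((H.dens_scale_lt i hx hd.le hlt L).2 hL)

theorem dens_le (H : SSHyp f rr E rmin ρ c s μ fix) {x} (hx : x ∈ E) {d : ℝ}
    (hd : 0 < d) (hdc : d ≤ c / rmin) :
    ENNReal.ofReal ((2 * d) ^ s) ≤ packM s E * μ (closedBall x d) := by
  by_contra hlt
  rw [not_le] at hlt
  obtain ⟨η, h0, h1, h2⟩ := H.shrink hd hlt
  refine absurd (H.dens_le_lt hx (sub_pos.2 h1) (by linarith)) (not_le.2 (lt_of_le_of_lt ?_ h2))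
  gcongr
  linarith

theorem packM_upper (H : SSHyp f rr E rmin ρ c s μ fix) {L : ℝ≥0∞} {δ : ℝ} (hδ : 0 < δ)
    (h : ∀ x ∈ E, ∀ d, 0 < d → d < δ →
      ENNReal.ofReal ((2 * d) ^ s) ≤ L * μ (closedBall x d)) : packM s E ≤ L := by
  have := H.prob
  have hE : packPre0 s E ≤ L := by
    refine (iInf₂_le δ hδ).trans ?_
    refine iSup_le fun cen => iSup_le fun rad => iSup_le fun hcen => iSup_le fun hdm =>
      iSup_le fun hdisj => ?_
    calc _ ≤ ∑' i, L * μ (closedBall (cen i) (rad i)) := by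
          refine ENNReal.tsum_le_tsum fun i => ?_
          rcases lt_trichotomy (rad i) 0 with h0 | h0 | h0
          · rw [closedBall_eq_empty.2 h0, Metric.diam_empty, Real.zero_rpow H.s0.ne']
            simp
          · rw [h0, closedBall_zero, Metric.diam_singleton, Real.zero_rpow H.s0.ne']
            simp
          · have hd := hdm i
            rw [H.diam_ball _ h0.le] at hd ⊢
            exact h _ (hcen i) _ h0 (by linarith)
      _ = L * ∑' i, μ (closedBall (cen i) (rad i)) := ENNReal.tsum_mul_left
      _ = L * μ (⋃ i, closedBall (cen i) (rad i)) := by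
          rw [measure_iUnion hdisj fun i => measurableSet_closedBall]
      _ ≤ L * 1 := by gcongr; exact prob_le_one
      _ = L := mul_one L
  have hemp : packPre0 s (∅ : Set (EuclideanSpace ℝ (Fin n))) = 0 := by
    refine le_antisymm ((iInf₂_le 1 one_pos).trans ?_) bot_le
    refine iSup_le fun cen => iSup_le fun rad => iSup_le fun hcen => ?_
    exact absurd (hcen 0) (Set.notMem_empty _)
  refine (iInf₂_le (fun i : ℕ => if i = 0 then E else ∅) ?_).trans ?_
  · intro x hx
    exact mem_iUnion.2 ⟨0, by simpa using hx⟩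
  · rw [tsum_eq_single 0]
    · simpa using hE
    · intro i hi
      simp [hi, hemp]

/-! ### the lower limit -/

/-- `x` is an algorithm point whose ball of radius `d` has large density, and `D` is the
infimum of the distances from `x` to points of `E` outside of that ball. -/
structure GapQ (f : Fin N → EuclideanSpace ℝ (Fin n) → EuclideanSpace ℝ (Fin n))
    (E : Set (EuclideanSpace ℝ (Fin n))) (s : ℝ)
    (μ : MeasureTheory.Measure (EuclideanSpace ℝ (Fin n))) (L : ℝ≥0∞)
    (x : EuclideanSpace ℝ (Fin n)) (d D : ℝ) : Prop where
  mem : ∃ k, x ∈ algA f k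
  d0 : 0 < d
  dD : d ≤ D
  dens : L * μ (closedBall x d) < ENNReal.ofReal ((2 * d) ^ s)
  lb : ∀ z ∈ E, d < dist x z → D ≤ dist x z
  near : ∀ η, 0 < η → ∃ z ∈ E, d < dist x z ∧ dist x z < D + η

theorem gap_up (H : SSHyp f rr E rmin ρ c s μ fix) {L : ℝ≥0∞} {x} {d D : ℝ}
    (Q : GapQ f E s μ L x d D) (hD : D < c) :
    ∃ i x', GapQ f E s μ L x' (d / rr i) (D / rr i) := by
  obtain ⟨k, hk⟩ := Q.mem
  obtain ⟨i, l, y, hy, rfl⟩ := algA_ex hk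
  have hr := (H.hr i).1
  have hyE := H.algA_sub l hy
  have hd0 := Q.d0
  have hdD := Q.dD
  have e1 : rr i * (d / rr i) = d := by field_simp
  refine ⟨i, y, ⟨l, hy⟩, by positivity, by gcongr, ?_, ?_, ?_⟩
  · rw [← H.dens_scale_lt i hyE (by positivity) (by rw [e1]; linarith), e1]
    exact Q.dens
  · intro z hz hdz
    have h1 := Q.lb (f i z) (H.mapE i hz)
    rw [H.hsim] at h1
    rw [div_lt_iff₀ hr] at hdz
    rw [div_le_iff₀ hr, mul_comm]
    exact h1 (by linarith)
  · intro η hη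
    obtain ⟨z, hz, h1, h2⟩ := Q.near (min (rr i * η) (c - D)) (lt_min (by positivity) (by linarith))
    obtain ⟨j, z', hz', rfl⟩ := H.exE hz
    have h3 := min_le_left (rr i * η) (c - D)
    have h4 := min_le_right (rr i * η) (c - D)
    have hji : i = j := by
      by_contra hne
      have := H.gap i j hne y hyE z' hz'
      linarith
    subst hji
    rw [H.hsim] at h1 h2
    refine ⟨z', hz', ?_, ?_⟩
    · rw [div_lt_iff₀ hr]; linarith
    · have : D / rr i + η = (D + rr i * η) / rr i := by field_simp
      rw [this, lt_div_iff₀ hr]; linarith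

theorem gap_up_iter (H : SSHyp f rr E rmin ρ c s μ fix) {L : ℝ≥0∞} {ct : ℝ} (hct : 0 < ct)
    (hctc : ct ≤ c) (m : ℕ) {x} {d D : ℝ} (Q : GapQ f E s μ L x d D) (hD : D < ct / rmin)
    (hm : ct * ρ ^ m ≤ D) :
    ∃ x' d' D', GapQ f E s μ L x' d' D' ∧ ct ≤ D' ∧ D' < ct / rmin := by
  induction m generalizing x d D with
  | zero => exact ⟨x, d, D, Q, by simpa using hm, hD⟩
  | succ m ih =>
    rcases le_or_gt ct D with h | h
    · exact ⟨x, d, D, Q, h, hD⟩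
    · obtain ⟨i, x', Q'⟩ := H.gap_up Q (h.trans_le hctc)
      have hr := (H.hr i).1
      have hr0 := H.rmin_pos
      have hD0 : 0 < D := Q.d0.trans_le Q.dD
      refine ih Q' ?_ ?_
      · calc D / rr i ≤ D / rmin := div_le_div_of_nonneg_left hD0.le hr0 (H.rmin_le i)
          _ < ct / rmin := by gcongr
      · have hp : 0 < ct * ρ ^ m := mul_pos hct (pow_pos H.ρ0 m)
        rw [le_div_iff₀ hr]
        calc ct * ρ ^ m * rr i ≤ ct * ρ ^ m * ρ := by gcongr; exact H.hρ i
          _ = ct * ρ ^ (m+1) := by ring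
          _ ≤ D := hm

theorem exists_gap (H : SSHyp f rr E rmin ρ c s μ fix) {L : ℝ≥0∞} {ct : ℝ} (hct : 0 < ct)
    (hctc : ct ≤ c) (hL : L < packM s E) :
    ∃ x d D, GapQ f E s μ L x d D ∧ ct ≤ D ∧ D < ct / rmin := by
  obtain ⟨x, hx, d, d0, d1, hd⟩ : ∃ x ∈ E, ∃ d, 0 < d ∧ d < ct ∧
      L * μ (closedBall x d) < ENNReal.ofReal ((2 * d) ^ s) := by
    by_contra hcon
    push Not at hcon
    exact absurd (H.packM_upper hct hcon) (not_le.2 hL)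
  obtain ⟨x, d, ⟨k, hk⟩, d0, d1, hd⟩ : ∃ x d, (∃ k, x ∈ algA f k) ∧ 0 < d ∧ d < ct ∧
      L * μ (closedBall x d) < ENNReal.ofReal ((2 * d) ^ s) := by
    obtain ⟨η, h0, h1, h2⟩ := H.near_lt d0 hd
    obtain ⟨k, hk⟩ := H.exists_pow_le h0
    obtain ⟨p, hp, hpx⟩ := H.algA_near k hx
    refine ⟨p, d - η, ⟨k+1, hp⟩, by linarith, by linarith, h2 p (hpx.trans ?_)⟩
    exact (pow_le_pow_of_le_one H.ρ0.le H.ρ1.le (Nat.le_succ k)).trans hk.le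
  obtain ⟨y, hy, hxy⟩ : ∃ y ∈ E, d < dist x y := by
    obtain ⟨i, x', hx', rfl⟩ := H.exE (H.algA_sub k hk)
    have : Nontrivial (Fin N) := Fin.nontrivial_iff_two_le.2 H.hN
    obtain ⟨j, hj⟩ := exists_ne i
    exact ⟨f j x', H.mapE j hx', lt_of_lt_of_le (by linarith) (H.gap i j hj.symm x' hx' x' hx')⟩
  obtain ⟨i, -⟩ := H.rmin_mem
  have hr := H.hr i
  have down : ∀ m : ℕ, ∃ x d, (∃ k, x ∈ algA f k) ∧ 0 < d ∧ d < ct ∧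
      L * μ (closedBall x d) < ENNReal.ofReal ((2 * d) ^ s) ∧
      ∃ y ∈ E, d < dist x y ∧ dist x y ≤ ρ ^ m := by
    intro m
    induction m with
    | zero =>
      exact ⟨x, d, ⟨k, hk⟩, d0, d1, hd, y, hy, hxy, by
        simpa using H.dist_le_one (H.algA_sub k hk) hy⟩
    | succ m ih =>
      obtain ⟨x, d, ⟨k, hk⟩, d0, d1, hd, y, hy, hxy, hm⟩ := ih
      have hlt : rr i * d < d := by nlinarith
      refine ⟨f i x, rr i * d, ⟨k+1, algA_map hk i⟩, mul_pos hr.1 d0, by linarith,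
        (H.dens_scale_lt i (H.algA_sub k hk) d0.le (by linarith) L).2 hd, f i y, H.mapE i hy, ?_, ?_⟩
      · rw [H.hsim]; exact mul_lt_mul_of_pos_left hxy hr.1
      · rw [H.hsim, pow_succ']
        exact mul_le_mul (H.hρ i) hm dist_nonneg H.ρ0.le
  obtain ⟨m, hm⟩ := H.exists_pow_le hct
  obtain ⟨x, d, hk, d0, d1, hd, y, hy, hxy, hym⟩ := down m
  set S : Set ℝ := {q | ∃ z ∈ E, d < dist x z ∧ q = dist x z} with hS
  have hSne : S.Nonempty := ⟨_, y, hy, hxy, rfl⟩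
  have hSlb : ∀ q ∈ S, d ≤ q := by
    rintro q ⟨z, -, h1, rfl⟩; exact h1.le
  have hSb : BddBelow S := ⟨d, hSlb⟩
  have hD1 : sInf S < ct := (csInf_le hSb ⟨y, hy, hxy, rfl⟩).trans_lt (hym.trans_lt hm)
  have Q : GapQ f E s μ L x d (sInf S) :=
    { mem := hk
      d0 := d0
      dD := le_csInf hSne hSlb
      dens := hd
      lb := fun z hz h => csInf_le hSb ⟨z, hz, h, rfl⟩
      near := by
        intro η hη
        obtain ⟨q, ⟨z, hz, h1, rfl⟩, h2⟩ := exists_lt_of_csInf_lt hSne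
          (lt_add_of_pos_right (sInf S) hη)
        exact ⟨z, hz, h1, h2⟩ }
  have hD0 : 0 < sInf S := Q.d0.trans_le Q.dD
  obtain ⟨l, hl⟩ := H.exists_pow_le (div_pos hD0 hct)
  refine H.gap_up_iter hct hctc l Q ?_ ?_
  · refine hD1.trans ?_
    rw [lt_div_iff₀ H.rmin_pos]
    obtain ⟨j, hj⟩ := H.rmin_mem
    have := (H.hr j).2
    rw [hj] at this
    nlinarith
  · rw [lt_div_iff₀ hct] at hl
    linarith

theorem liminf_part (H : SSHyp f rr E rmin ρ c s μ fix) {L : ℝ≥0∞} {ct : ℝ} (hct : 0 < ct)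
    (hctc : ct ≤ c) (hL : L < packM s E) :
    ∀ᶠ k : ℕ in atTop, ∃ x ∈ algA f k, ∃ d ∈ algD f ct rmin k,
      L < densityhk (algMu f rr fix s k) s x d := by
  have := H.prob
  obtain ⟨x, d, D, Q, hD1, hD2⟩ := H.exists_gap hct hctc hL
  obtain ⟨K, hK⟩ := Q.mem
  obtain ⟨z, hz, hz1, hz2⟩ := Q.near (ct / rmin - D) (by linarith)
  have hpow := tendsto_pow_atTop_nhds_zero_of_lt_one H.ρ0.le H.ρ1
  have e1 : ∀ᶠ k : ℕ in atTop, ρ ^ k < min (dist x z - d) (ct / rmin - dist x z) :=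
    hpow.eventually (gt_mem_nhds (lt_min (by linarith) (by linarith)))
  have hmeas : Tendsto (fun k : ℕ => L * μ (closedBall x (d + ρ ^ k))) atTop
      (𝓝 (L * μ (closedBall x d))) := by
    refine ENNReal.Tendsto.const_mul ?_ (Or.inr (ne_top_of_lt hL))
    have h1 := (tendsto_measure_cthickening_of_isClosed (μ := μ)
      ⟨1, one_pos, measure_ne_top _ _⟩ (isClosed_closedBall (x := x) (ε := d))).comp hpow
    refine h1.congr fun k => ?_
    rw [Function.comp_apply, cthickening_closedBall (pow_nonneg H.ρ0.le k) Q.d0.le, add_comm]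
  have e2 := hmeas.eventually (gt_mem_nhds Q.dens)
  filter_upwards [e1, e2, eventually_ge_atTop K, eventually_ge_atTop 1] with k h1 h2 h3 h4
  obtain ⟨k, rfl⟩ : ∃ l, k = l + 1 := ⟨k - 1, by omega⟩
  obtain ⟨p, hp, hpz⟩ := H.algA_near k hz
  have hm1 := h1.trans_le (min_le_left _ _)
  have hm2 := h1.trans_le (min_le_right _ _)
  have t1 : dist x z ≤ dist x p + dist p z := dist_triangle _ _ _
  have t2 : dist x p ≤ dist x z + dist z p := dist_triangle _ _ _
  rw [dist_comm z p] at t2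
  have hfin : (algA f (k+1) ∩ {q | d < dist x q}).Finite := (H.algA_fin (k+1)).subset inter_subset_left
  obtain ⟨q, ⟨hqA, hqd⟩, hqmin⟩ := Set.exists_min_image _ (fun q => dist x q) hfin
    ⟨p, hp, by change d < dist x p; linarith⟩
  have hqd' : d < dist x q := hqd
  have hqp : dist x q ≤ dist x p := hqmin p ⟨hp, by change d < dist x p; linarith⟩
  have hqD : D ≤ dist x q := Q.lb q (H.algA_sub _ hqA) hqd'
  have hxA := algA_mono f h3 hK
  refine ⟨x, hxA, dist x q, ⟨⟨x, hxA, q, hqA, rfl⟩, by linarith, by linarith⟩, ?_⟩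
  have hmu : algMu f rr fix s (k+1) (ball x (dist x q)) ≤ μ (closedBall x (d + ρ ^ (k+1))) := by
    refine H.algMu_le k measurableSet_ball fun w hw y hy => ?_
    have hle : dist x (wordComp f (k+1) w (fix (w (Fin.last k)))) ≤ d := by
      by_contra hcon
      have := hqmin _ ⟨H.pt_mem k w, not_le.1 hcon⟩
      rw [mem_ball, dist_comm] at hw
      exact absurd this (not_le.2 hw)
    have h5 := H.wdist_le (k+1) w hy (H.fixE (w (Fin.last k)))
    have h6 := dist_triangle (wordComp f (k+1) w y) (wordComp f (k+1) w (fix (w (Fin.last k)))) x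
    rw [dist_comm x] at hle
    rw [mem_closedBall]
    linarith
  have hpos : 0 < dist x q := Q.d0.trans hqd'
  have hfinal : L * algMu f rr fix s (k+1) (ball x (dist x q)) <
      ENNReal.ofReal ((2 * dist x q) ^ s) := by
    calc _ ≤ L * μ (closedBall x (d + ρ ^ (k+1))) := by gcongr
      _ < ENNReal.ofReal ((2 * d) ^ s) := h2
      _ ≤ _ := by
        have := Q.d0
        exact ENNReal.ofReal_le_ofReal (Real.rpow_le_rpow (by positivity) (by linarith) H.s0.le)
  exact (ENNReal.lt_div_iff_mul_lt (Or.inr (ne_top_of_lt hL))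
    (Or.inl (ne_top_of_le_ne_top (measure_ne_top μ _) hmu))).2 hfinal

/-! ### the upper limit -/

theorem limsup_part (H : SSHyp f rr E rmin ρ c s μ fix) {ct : ℝ} (hct : 0 < ct)
    (hctc : ct ≤ c) (k : ℕ) (hk : 2 * ρ ^ (k+1) < ct) {x} (hx : x ∈ algA f (k+1)) {d : ℝ}
    (hd : d ∈ algD f ct rmin (k+1)) :
    densityhk (algMu f rr fix s (k+1)) s x d ≤
      ENNReal.ofReal ((ct / (ct - 2 * ρ ^ (k+1))) ^ s) * packM s E := by
  obtain ⟨-, h1, h2⟩ := hd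
  set ε := ρ ^ (k+1) with hε
  have hε0 : 0 < ε := pow_pos H.ρ0 _
  refine ENNReal.div_le_of_le_mul ?_
  have hd' : 0 < d - 2 * ε := by linarith
  have hdc : d - 2 * ε < c / rmin := by
    have : ct / rmin ≤ c / rmin := div_le_div_of_nonneg_right hctc H.rmin_pos.le
    linarith
  have hA := H.dens_le_lt (H.algA_sub _ hx) hd' hdc
  have hmu : μ (closedBall x (d - 2 * ε)) ≤ algMu f rr fix s (k+1) (ball x d) := by
    refine H.le_algMu k measurableSet_ball fun w y hy hyT => ?_
    have h5 := H.wdist_le (k+1) w (H.fixE (w (Fin.last k))) hy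
    have h6 := dist_triangle (wordComp f (k+1) w (fix (w (Fin.last k)))) (wordComp f (k+1) w y) x
    rw [mem_closedBall] at hyT
    rw [mem_ball]
    linarith
  have hct2 : 0 < ct - 2 * ε := by linarith
  calc ENNReal.ofReal ((2 * d) ^ s)
      ≤ ENNReal.ofReal ((ct / (ct - 2 * ε)) ^ s) * ENNReal.ofReal ((2 * (d - 2 * ε)) ^ s) := by
        rw [← ENNReal.ofReal_mul (by positivity), ← Real.mul_rpow (by positivity) (by positivity)]
        refine ENNReal.ofReal_le_ofReal (Real.rpow_le_rpow (by linarith) ?_ H.s0.le)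
        rw [div_mul_eq_mul_div, le_div_iff₀ hct2]
        nlinarith
    _ ≤ ENNReal.ofReal ((ct / (ct - 2 * ε)) ^ s) *
          (packM s E * algMu f rr fix s (k+1) (ball x d)) := by
        gcongr
        exact hA.trans (by gcongr)
    _ = _ := by rw [mul_assoc]

theorem limsup_tendsto (H : SSHyp f rr E rmin ρ c s μ fix) {ct : ℝ} (hct : 0 < ct) :
    Tendsto (fun k : ℕ => ENNReal.ofReal ((ct / (ct - 2 * ρ ^ k)) ^ s) * packM s E) atTop
      (𝓝 (packM s E)) := by
  have hpow := tendsto_pow_atTop_nhds_zero_of_lt_one H.ρ0.le H.ρ1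
  have h1 : Tendsto (fun k : ℕ => ct / (ct - 2 * ρ ^ k)) atTop (𝓝 (ct / (ct - 2 * 0))) :=
    tendsto_const_nhds.div (tendsto_const_nhds.sub (hpow.const_mul 2)) (by simpa using hct.ne')
  have h2 : Tendsto (fun k : ℕ => (ct / (ct - 2 * ρ ^ k)) ^ s) atTop
      (𝓝 ((ct / (ct - 2 * 0)) ^ s)) := h1.rpow_const (Or.inr H.s0.le)
  have h3 := (ENNReal.continuous_ofReal.tendsto _).comp h2
  rw [mul_zero, sub_zero, div_self hct.ne', Real.one_rpow, ENNReal.ofReal_one] at h3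
  have h4 := ENNReal.Tendsto.mul_const (b := packM s E) h3 (Or.inl one_ne_zero)
  rwa [one_mul] at h4

end SSHyp

theorem algorithm_sequence_tendsto_packing_measure
{n N : ℕ} (hN : 2 ≤ N)
    (f : Fin N → EuclideanSpace ℝ (Fin n) → EuclideanSpace ℝ (Fin n))
    (rr : Fin N → ℝ) (hr : ∀ i, 0 < rr i ∧ rr i < 1)
    (hsim : ∀ i x y, dist (f i x) (f i y) = rr i * dist x y)
    (E : Set (EuclideanSpace ℝ (Fin n))) (hEne : E.Nonempty) (hEcp : IsCompact E)
    (hEinv : E = ⋃ i, f i '' E)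
    (hssc : ∀ i j, i ≠ j → Disjoint (f i '' E) (f j '' E))
(hEdiam : Metric.diam E = 1)
(rmin : ℝ) (hrmin : IsLeast (Set.range rr) rmin)
(c : ℝ) (hc : 0 < c)
    (hcdef : c = sInf {d : ℝ | ∃ i j : Fin N, i ≠ j ∧
      ∃ u ∈ f i '' E, ∃ v ∈ f j '' E, d = dist u v})
(s : ℝ) (hs : 0 < s) (hsum : ∑ i, rr i ^ s = 1)
    (μ : MeasureTheory.Measure (EuclideanSpace ℝ (Fin n))) (hμ : IsProbabilityMeasure μ)
    (hμss : ∀ A : Set (EuclideanSpace ℝ (Fin n)), MeasurableSet A →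
      μ A = ∑ i, ENNReal.ofReal (rr i ^ s) * μ (f i ⁻¹' A))
(fix : Fin N → EuclideanSpace ℝ (Fin n)) (hfix : ∀ i, f i (fix i) = fix i)
    (ct : ℝ) (hct : 0 < ct) (hct' : ct ≤ c)
    (xt : ℕ → EuclideanSpace ℝ (Fin n)) (dt : ℕ → ℝ)
    (hmem : ∀ k, 1 ≤ k → xt k ∈ algA f k ∧ dt k ∈ algD f ct rmin k)
    (hmax : ∀ k, 1 ≤ k → ∀ x ∈ algA f k, ∀ d ∈ algD f ct rmin k,
      densityhk (algMu f rr fix s k) s x d ≤ densityhk (algMu f rr fix s k) s (xt k) (dt k)) :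
    Filter.Tendsto (fun k => densityhk (algMu f rr fix s k) s (xt k) (dt k))
      Filter.atTop (nhds (packM s E)) ∧
    ∀ k, 1 ≤ k →
      algMu f rr fix s k (Metric.ball (xt k) (dt k)) = μ (Metric.closedBall (xt k) (dt k)) →
      densityhk (algMu f rr fix s k) s (xt k) (dt k) ≤ packM s E := by
  have hNpos : 0 < N := by omega
  have : Nonempty (Fin N) := ⟨⟨0, hNpos⟩⟩
  obtain ⟨imax, himax⟩ := Finite.exists_max rr
  have H : SSHyp f rr E rmin (rr imax) c s μ fix :=
    { hN := hN
      hr := hr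
      hsim := hsim
      ne := hEne
      cp := hEcp
      inv := hEinv
      dm := hEdiam
      rmin_mem := hrmin.1
      rmin_le := fun i => hrmin.2 ⟨i, rfl⟩
      ρ0 := (hr imax).1
      ρ1 := (hr imax).2
      hρ := himax
      c0 := hc
      gap := by
        intro i j hij a ha b hb
        rw [hcdef]
        refine csInf_le ⟨0, ?_⟩ ⟨i, j, hij, f i a, ⟨a, ha, rfl⟩, f j b, ⟨b, hb, rfl⟩, rfl⟩
        rintro q ⟨_, _, _, u, _, v, _, rfl⟩
        exact dist_nonneg
      s0 := hs
      hsum := hsum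
      prob := hμ
      ss := hμss
      hfix := hfix }
  constructor
  · rw [tendsto_order]
    constructor
    · intro L hL
      filter_upwards [H.liminf_part hct hct' hL, eventually_ge_atTop 1] with k hk h1
      obtain ⟨x, hx, d, hd, hlt⟩ := hk
      exact hlt.trans_le (hmax k h1 x hx d hd)
    · intro U hU
      have e1 := (H.limsup_tendsto hct).eventually (gt_mem_nhds hU)
      have hpow := (tendsto_pow_atTop_nhds_zero_of_lt_one H.ρ0.le H.ρ1).eventually
        (gt_mem_nhds (half_pos hct))
      filter_upwards [e1, hpow, eventually_ge_atTop 1] with k h1 h2 h3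
      obtain ⟨l, rfl⟩ : ∃ l, k = l + 1 := ⟨k - 1, by omega⟩
      exact (H.limsup_part hct hct' l (by linarith) (hmem _ h3).1 (hmem _ h3).2).trans_lt h1
  · intro k hk heq
    obtain ⟨h1, -, h2, h3⟩ := hmem k hk
    unfold densityhk
    rw [heq]
    refine ENNReal.div_le_of_le_mul (H.dens_le (H.algA_sub k h1) (hct.trans_le h2) (h3.trans ?_))
    exact div_le_div_of_nonneg_right hct' H.rmin_pos.le
end

section
/- There exist k_0 ∈ ℕ and sequences (x_k), (y_k) with x_k, y_k ∈ A_k for all k, such that d_k := dist(x_k, y_k) ∈ [c̃, c̃/r_min] for all k ≥ k_0, and m_k := (2d_k)^s / μ_k(B'(x_k, d_k)) → P^s(E) as k → ∞. -/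
open Metric Set MeasureTheory Filter Topology
open scoped ENNReal NNReal

/-- Bundled hypotheses of the self-similar setting, for internal use. -/
structure SelfSimSetup {n N : ℕ}
    (f : Fin N → EuclideanSpace ℝ (Fin n) → EuclideanSpace ℝ (Fin n))
    (rr : Fin N → ℝ) (E : Set (EuclideanSpace ℝ (Fin n))) (rmin c s ρ : ℝ)
    (μ : MeasureTheory.Measure (EuclideanSpace ℝ (Fin n)))
    (fix : Fin N → EuclideanSpace ℝ (Fin n)) (ct : ℝ) : Prop where
  hN : 2 ≤ N
  r_pos : ∀ i, 0 < rr i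
  r_lt : ∀ i, rr i < 1
  hsim : ∀ i x y, dist (f i x) (f i y) = rr i * dist x y
  hEne : E.Nonempty
  hEcp : IsCompact E
  f_mem : ∀ i, ∀ x ∈ E, f i x ∈ E
  ex_pre : ∀ x ∈ E, ∃ i, ∃ y ∈ E, f i y = x
  dist_le : ∀ x ∈ E, ∀ y ∈ E, dist x y ≤ 1
  rmin_ex : ∃ i, rr i = rmin
  rmin_le : ∀ i, rmin ≤ rr i
  sep : ∀ i j, i ≠ j → ∀ x ∈ E, ∀ y ∈ E, c ≤ dist (f i x) (f j y)
  hs : 0 < s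
  hsum : ∑ i, rr i ^ s = 1
  prob : IsProbabilityMeasure μ
  hμss : ∀ A : Set (EuclideanSpace ℝ (Fin n)), MeasurableSet A →
      μ A = ∑ i, ENNReal.ofReal (rr i ^ s) * μ (f i ⁻¹' A)
  hfix : ∀ i, f i (fix i) = fix i
  hct : 0 < ct
  hct' : ct ≤ c
  ρ_pos : 0 < ρ
  ρ_lt : ρ < 1
  le_ρ : ∀ i, rr i ≤ ρ
  nt : Nontrivial (EuclideanSpace ℝ (Fin n))

namespace SelfSimSetup

variable {n N : ℕ} {f : Fin N → EuclideanSpace ℝ (Fin n) → EuclideanSpace ℝ (Fin n)}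
    {rr : Fin N → ℝ} {E : Set (EuclideanSpace ℝ (Fin n))} {rmin c s ρ : ℝ}
    {μ : MeasureTheory.Measure (EuclideanSpace ℝ (Fin n))}
    {fix : Fin N → EuclideanSpace ℝ (Fin n)} {ct : ℝ}

theorem rmin_pos (S : SelfSimSetup f rr E rmin c s ρ μ fix ct) : 0 < rmin := by
  obtain ⟨i, hi⟩ := S.rmin_ex
  exact hi ▸ S.r_pos i

theorem rmin_lt (S : SelfSimSetup f rr E rmin c s ρ μ fix ct) : rmin < 1 := by
  obtain ⟨i, hi⟩ := S.rmin_ex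
  exact hi ▸ S.r_lt i

theorem emb (S : SelfSimSetup f rr E rmin c s ρ μ fix ct) (i : Fin N) :
    MeasurableEmbedding (f i) := by
  have h1 : LipschitzWith (Real.toNNReal (rr i)) (f i) := by
    apply LipschitzWith.of_dist_le_mul
    intro x y
    rw [S.hsim, Real.coe_toNNReal _ (S.r_pos i).le]
  have h2 : AntilipschitzWith (Real.toNNReal (rr i)⁻¹) (f i) := by
    apply AntilipschitzWith.of_le_mul_dist
    intro x y
    rw [S.hsim, Real.coe_toNNReal _ (inv_nonneg.2 (S.r_pos i).le), ← mul_assoc,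
      inv_mul_cancel₀ (S.r_pos i).ne', one_mul]
  exact (h2.isClosedEmbedding h1.uniformContinuous).measurableEmbedding

theorem ss (S : SelfSimSetup f rr E rmin c s ρ μ fix ct) (A : Set (EuclideanSpace ℝ (Fin n))) :
    μ A = ∑ i, ENNReal.ofReal (rr i ^ s) * μ (f i ⁻¹' A) := by
  have h : μ = ∑ i, ENNReal.ofReal (rr i ^ s) • μ.map (f i) := by
    ext B hB
    rw [S.hμss B hB]
    simp only [Measure.coe_finsetSum, Finset.sum_apply, Measure.smul_apply, smul_eq_mul]
    refine Finset.sum_congr rfl fun i _ => ?_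
    rw [(S.emb i).map_apply]
  conv_lhs => rw [h]
  simp only [Measure.coe_finsetSum, Finset.sum_apply, Measure.smul_apply, smul_eq_mul]
  refine Finset.sum_congr rfl fun i _ => ?_
  rw [(S.emb i).map_apply]

theorem ssr (S : SelfSimSetup f rr E rmin c s ρ μ fix ct) (A : Set (EuclideanSpace ℝ (Fin n))) :
    μ.real A = ∑ i, rr i ^ s * μ.real (f i ⁻¹' A) := by
  have := S.prob
  rw [measureReal_def, S.ss A, ENNReal.toReal_sum]
  · refine Finset.sum_congr rfl fun i _ => ?_
    rw [ENNReal.toReal_mul, ENNReal.toReal_ofReal (Real.rpow_nonneg (S.r_pos i).le _),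
      measureReal_def]
  · intro i _
    exact ENNReal.mul_ne_top ENNReal.ofReal_ne_top (measure_ne_top _ _)

theorem infDist_f (S : SelfSimSetup f rr E rmin c s ρ μ fix ct) (i : Fin N)
    (x : EuclideanSpace ℝ (Fin n)) : infDist (f i x) E ≤ rr i * infDist x E := by
  obtain ⟨y, hy, h⟩ := S.hEcp.exists_infDist_eq_dist S.hEne x
  rw [h, ← S.hsim]
  exact infDist_le_dist_of_mem (S.f_mem i y hy)

theorem fixed_mem (S : SelfSimSetup f rr E rmin c s ρ μ fix ct) {i : Fin N}
    {x : EuclideanSpace ℝ (Fin n)} (hx : f i x = x) : x ∈ E := by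
  have h := S.infDist_f i x
  rw [hx] at h
  have h0 : infDist x E = 0 := by
    have := infDist_nonneg (x := x) (s := E)
    nlinarith [S.r_lt i]
  exact (S.hEcp.isClosed.mem_iff_infDist_zero S.hEne).2 h0

theorem null (S : SelfSimSetup f rr E rmin c s ρ μ fix ct) : μ.real E = 1 := by
  have := S.prob
  have key : ∀ R : ℝ, 0 ≤ R → μ.real {x | infDist x E ≤ R} ≤ μ.real {x | infDist x E ≤ ρ * R} := by
    intro R hR
    rw [S.ssr {x | infDist x E ≤ ρ * R}]
    calc μ.real {x | infDist x E ≤ R} = ∑ i, rr i ^ s * μ.real {x | infDist x E ≤ R} := by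
          rw [← Finset.sum_mul, S.hsum, one_mul]
      _ ≤ _ := by
          refine Finset.sum_le_sum fun i _ => ?_
          refine mul_le_mul_of_nonneg_left ?_ (Real.rpow_nonneg (S.r_pos i).le _)
          refine measureReal_mono ?_
          intro x hx
          simp only [mem_ofPred_eq, mem_preimage] at hx ⊢
          have h1 := S.infDist_f i x
          have h2 := infDist_nonneg (x := x) (s := E)
          have h3 := S.le_ρ i
          have h4 := S.r_pos i
          nlinarith
  have key2 : ∀ R : ℝ, 0 ≤ R → ∀ k : ℕ,
      μ.real {x | infDist x E ≤ R} ≤ μ.real {x | infDist x E ≤ ρ ^ k * R} := by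
    intro R hR k
    induction k with
    | zero => simp
    | succ k ih =>
      refine ih.trans ((key _ (mul_nonneg (pow_nonneg S.ρ_pos.le _) hR)).trans ?_)
      rw [pow_succ', mul_assoc]
  have key3 : ∀ R : ℝ, 0 ≤ R → μ {x | infDist x E ≤ R} ≤ μ E := by
    intro R hR
    have hE : E = ⋂ k : ℕ, {x | infDist x E ≤ ρ ^ k * R} := by
      ext x
      simp only [mem_iInter, mem_ofPred_eq]
      constructor
      · intro hx k
        rw [infDist_zero_of_mem hx]
        exact mul_nonneg (pow_nonneg S.ρ_pos.le _) hR
      · intro h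
        have ht : Tendsto (fun k : ℕ => ρ ^ k * R) atTop (𝓝 (0 * R)) :=
          (tendsto_pow_atTop_nhds_zero_of_lt_one S.ρ_pos.le S.ρ_lt).mul_const R
        have := ge_of_tendsto' ht h
        rw [zero_mul] at this
        exact (S.hEcp.isClosed.mem_iff_infDist_zero S.hEne).2 (le_antisymm this infDist_nonneg)
    have ht : Tendsto (fun k : ℕ => μ {x | infDist x E ≤ ρ ^ k * R}) atTop
        (𝓝 (μ (⋂ k : ℕ, {x | infDist x E ≤ ρ ^ k * R}))) := by
      apply tendsto_measure_iInter_atTop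
      · intro k
        exact (isClosed_le (continuous_infDist_pt E) continuous_const).measurableSet.nullMeasurableSet
      · intro k l hkl x hx
        simp only [mem_ofPred_eq] at hx ⊢
        refine hx.trans (mul_le_mul_of_nonneg_right ?_ hR)
        exact pow_le_pow_of_le_one S.ρ_pos.le S.ρ_lt.le hkl
      · exact ⟨0, measure_ne_top _ _⟩
    rw [← hE] at ht
    refine ge_of_tendsto' ht fun k => ?_
    have := key2 R hR k
    rwa [measureReal_def, measureReal_def, ENNReal.toReal_le_toReal (measure_ne_top _ _)
      (measure_ne_top _ _)] at this
  have ht : Tendsto (fun k : ℕ => μ {x | infDist x E ≤ k}) atTop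
      (𝓝 (μ (⋃ k : ℕ, {x | infDist x E ≤ k}))) := by
    apply tendsto_measure_iUnion_atTop
    intro k l hkl x hx
    simp only [mem_ofPred_eq] at hx ⊢
    exact hx.trans (by exact_mod_cast hkl)
  have hu : (⋃ k : ℕ, {x | infDist x E ≤ k}) = univ := by
    ext x
    simp only [mem_iUnion, mem_ofPred_eq, mem_univ, iff_true]
    exact exists_nat_ge _
  rw [hu, measure_univ] at ht
  have h1 : 1 ≤ μ E := le_of_tendsto' ht fun k => key3 k (by positivity)
  have h2 : μ E = 1 := le_antisymm prob_le_one h1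
  simp [measureReal_def, h2]

theorem null_compl (S : SelfSimSetup f rr E rmin c s ρ μ fix ct) {A : Set (EuclideanSpace ℝ (Fin n))}
    (hA : ∀ x ∈ E, x ∉ A) : μ.real A = 0 := by
  have := S.prob
  have h1 := measureReal_add_measureReal_compl (μ := μ) S.hEcp.measurableSet
  rw [S.null, probReal_univ] at h1
  have h2 : μ.real A ≤ μ.real Eᶜ := measureReal_mono fun x hx hxE => hA x hxE hx
  linarith [measureReal_nonneg (μ := μ) (s := A)]

theorem mono_E (S : SelfSimSetup f rr E rmin c s ρ μ fix ct) {A B : Set (EuclideanSpace ℝ (Fin n))}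
    (hA : ∀ x ∈ E, x ∈ A → x ∈ B) : μ.real A ≤ μ.real B := by
  have := S.prob
  have h1 : μ.real (A \ B) = 0 := S.null_compl fun x hx h => h.2 (hA x hx h.1)
  calc μ.real A ≤ μ.real ((A \ B) ∪ B) := measureReal_mono (by intro x hx; by_cases x ∈ B <;> simp [*])
    _ ≤ μ.real (A \ B) + μ.real B := measureReal_union_le _ _
    _ = μ.real B := by rw [h1, zero_add]

theorem scale (S : SelfSimSetup f rr E rmin c s ρ μ fix ct) (i : Fin N)
    {x : EuclideanSpace ℝ (Fin n)} (hx : x ∈ E) {d : ℝ} (hd : rr i * d < c) :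
    μ.real (closedBall (f i x) (rr i * d)) = rr i ^ s * μ.real (closedBall x d) := by
  rw [S.ssr, Finset.sum_eq_single i]
  · congr 2
    ext y
    simp only [mem_preimage, mem_closedBall, S.hsim]
    exact mul_le_mul_iff_right₀ (S.r_pos i)
  · intro j _ hj
    rw [S.null_compl, mul_zero]
    intro y hy h
    simp only [mem_preimage, mem_closedBall] at h
    linarith [S.sep j i hj y hy x hx]
  · simp

/-- weight of a word -/
noncomputable def wt (_ : SelfSimSetup f rr E rmin c s ρ μ fix ct) {k : ℕ} (w : Fin k → Fin N) : ℝ :=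
  (∏ j, rr (w j)) ^ s

theorem wt_pos (S : SelfSimSetup f rr E rmin c s ρ μ fix ct) {k : ℕ} (w : Fin k → Fin N) :
    0 < S.wt w := Real.rpow_pos_of_pos (Finset.prod_pos fun j _ => S.r_pos _) _

theorem wt_succ (S : SelfSimSetup f rr E rmin c s ρ μ fix ct) {k : ℕ} (w : Fin (k+1) → Fin N) :
    S.wt w = rr (w 0) ^ s * S.wt (w ∘ Fin.succ) := by
  unfold wt
  rw [Fin.prod_univ_succ, Real.mul_rpow (S.r_pos _).le (Finset.prod_nonneg fun j _ => (S.r_pos _).le)]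
  rfl

theorem sum_words {k : ℕ} (F : (Fin (k+1) → Fin N) → ℝ) :
    ∑ w, F w = ∑ i, ∑ w : Fin k → Fin N, F (Fin.cons i w : Fin (k+1) → Fin N) := by
  rw [← Fintype.sum_prod_type', ← (Fin.consEquiv (fun _ : Fin (k+1) => Fin N)).sum_comp]
  rfl

theorem ssw (S : SelfSimSetup f rr E rmin c s ρ μ fix ct) (k : ℕ) :
    ∀ (A : Set (EuclideanSpace ℝ (Fin n))),
    μ.real A = ∑ w : Fin k → Fin N, S.wt w * μ.real (wordComp f k w ⁻¹' A) := by
  induction k with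
  | zero =>
    intro A
    simp [wt, wordComp]
  | succ k ih =>
    intro A
    rw [sum_words, S.ssr A]
    refine Finset.sum_congr rfl fun i _ => ?_
    rw [ih, Finset.mul_sum]
    refine Finset.sum_congr rfl fun w _ => ?_
    rw [S.wt_succ, ← mul_assoc]
    rfl

theorem sum_wt (S : SelfSimSetup f rr E rmin c s ρ μ fix ct) (k : ℕ) :
    ∑ w : Fin k → Fin N, S.wt w = 1 := by
  have := S.prob
  have h := S.ssw k univ
  simpa using h.symm

theorem word_mem (S : SelfSimSetup f rr E rmin c s ρ μ fix ct) (k : ℕ) (w : Fin k → Fin N) :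
    ∀ x ∈ E, wordComp f k w x ∈ E := by
  induction k with
  | zero => intro x hx; exact hx
  | succ k ih => intro x hx; exact S.f_mem _ _ (ih _ _ hx)

theorem word_dist (S : SelfSimSetup f rr E rmin c s ρ μ fix ct) (k : ℕ) (w : Fin k → Fin N) :
    ∀ x ∈ E, ∀ y ∈ E, dist (wordComp f k w x) (wordComp f k w y) ≤ ρ ^ k := by
  induction k with
  | zero => intro x hx y hy; simpa [wordComp] using S.dist_le x hx y hy
  | succ k ih =>
    intro x hx y hy
    simp only [wordComp, Function.comp_apply, S.hsim]
    rw [pow_succ']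
    exact mul_le_mul (S.le_ρ _) (ih _ x hx y hy) dist_nonneg S.ρ_pos.le

theorem word_ex (S : SelfSimSetup f rr E rmin c s ρ μ fix ct) (k : ℕ) :
    ∀ x ∈ E, ∃ w : Fin k → Fin N, ∃ y ∈ E, wordComp f k w y = x := by
  induction k with
  | zero => intro x hx; exact ⟨Fin.elim0, x, hx, rfl⟩
  | succ k ih =>
    intro x hx
    obtain ⟨i, y, hy, rfl⟩ := S.ex_pre x hx
    obtain ⟨w, z, hz, rfl⟩ := ih y hy
    exact ⟨Fin.cons i w, z, hz, rfl⟩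

theorem fix_mem (S : SelfSimSetup f rr E rmin c s ρ μ fix ct) (i : Fin N) : fix i ∈ E :=
  S.fixed_mem (S.hfix i)

/-- the atom of the discrete measure with address w -/
noncomputable def pt (_ : SelfSimSetup f rr E rmin c s ρ μ fix ct) {k : ℕ} (w : Fin (k+1) → Fin N) :
    EuclideanSpace ℝ (Fin n) := wordComp f (k+1) w (fix (w (Fin.last k)))

open Classical in
theorem algMu_real (S : SelfSimSetup f rr E rmin c s ρ μ fix ct) (k : ℕ)
    (A : Set (EuclideanSpace ℝ (Fin n))) (hA : MeasurableSet A) :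
    (algMu f rr fix s (k+1)).real A =
      ∑ w : Fin (k+1) → Fin N, S.wt w * (if S.pt w ∈ A then 1 else 0) := by
  rw [measureReal_def, algMu]
  simp only [Measure.coe_finsetSum, Finset.sum_apply, Measure.smul_apply, smul_eq_mul]
  rw [ENNReal.toReal_sum]
  · refine Finset.sum_congr rfl fun w _ => ?_
    rw [ENNReal.toReal_mul,
      show (ENNReal.ofReal ((∏ j, rr (w j)) ^ s)).toReal = S.wt w from
        ENNReal.toReal_ofReal (S.wt_pos w).le, Measure.dirac_apply' _ hA]
    by_cases h : S.pt w ∈ A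
    · have h' := h
      unfold pt at h'
      rw [if_pos h, indicator_of_mem h']; simp [wt]
    · have h' := h
      unfold pt at h'
      rw [if_neg h, indicator_of_notMem h']; simp
  · intro w _
    rw [Measure.dirac_apply' _ hA]
    apply ENNReal.mul_ne_top ENNReal.ofReal_ne_top
    by_cases h : (wordComp f (k+1) w (fix (w (Fin.last k)))) ∈ A <;> simp [h]

theorem algMu_fin (_ : SelfSimSetup f rr E rmin c s ρ μ fix ct) (k : ℕ)
    (A : Set (EuclideanSpace ℝ (Fin n))) : algMu f rr fix s k A ≠ ⊤ := by
  cases k with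
  | zero => simp [algMu]
  | succ k =>
    rw [algMu]
    simp only [Measure.coe_finsetSum, Finset.sum_apply, Measure.smul_apply, smul_eq_mul]
    refine (ENNReal.sum_lt_top.2 fun w _ => ?_).ne
    exact ENNReal.mul_lt_top ENNReal.ofReal_lt_top (measure_lt_top _ _)

/-- comparison of the discrete measures with μ -/
theorem mu_le_algMu (S : SelfSimSetup f rr E rmin c s ρ μ fix ct) {k : ℕ} (hk : 1 ≤ k)
    {A B : Set (EuclideanSpace ℝ (Fin n))} (hB : MeasurableSet B)
    (h : ∀ u ∈ E, ∀ v ∈ E, dist u v ≤ ρ ^ k → u ∈ A → v ∈ B) :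
    μ.real A ≤ (algMu f rr fix s k).real B := by
  classical
  have := S.prob
  obtain ⟨k, rfl⟩ : ∃ l, k = l + 1 := ⟨k - 1, by omega⟩
  rw [S.algMu_real k B hB, S.ssw (k+1) A]
  refine Finset.sum_le_sum fun w _ => mul_le_mul_of_nonneg_left ?_ (S.wt_pos w).le
  split_ifs with hw
  · exact measureReal_le_one
  · refine (S.null_compl fun x hx hxA => hw ?_).le
    exact h _ (S.word_mem _ w x hx) _ (S.word_mem _ w _ (S.fix_mem _))
      (S.word_dist _ w _ hx _ (S.fix_mem _)) hxA

theorem algMu_le_mu (S : SelfSimSetup f rr E rmin c s ρ μ fix ct) {k : ℕ} (hk : 1 ≤ k)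
    {A B : Set (EuclideanSpace ℝ (Fin n))} (hB : MeasurableSet B)
    (h : ∀ u ∈ E, ∀ v ∈ E, dist u v ≤ ρ ^ k → u ∈ B → v ∈ A) :
    (algMu f rr fix s k).real B ≤ μ.real A := by
  classical
  have := S.prob
  obtain ⟨k, rfl⟩ : ∃ l, k = l + 1 := ⟨k - 1, by omega⟩
  rw [S.algMu_real k B hB, S.ssw (k+1) A]
  refine Finset.sum_le_sum fun w _ => mul_le_mul_of_nonneg_left ?_ (S.wt_pos w).le
  split_ifs with hw
  · rw [← S.null]
    refine S.mono_E fun x hx _ => ?_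
    exact h _ (S.word_mem _ w _ (S.fix_mem _)) _ (S.word_mem _ w x hx)
      (S.word_dist _ w _ (S.fix_mem _) _ hx) hw
  · exact measureReal_nonneg


theorem cont_above (S : SelfSimSetup f rr E rmin c s ρ μ fix ct)
    (x : EuclideanSpace ℝ (Fin n)) (d θ v : ℝ) (h : θ * μ.real (closedBall x d) < v) :
    ∃ t > 0, ∀ t' ≤ t, 0 ≤ t' → θ * μ.real (closedBall x (d + t')) < v := by
  have := S.prob
  rcases lt_or_ge θ 0 with hθ | hθ
  · refine ⟨1, one_pos, fun t' _ ht' => lt_of_le_of_lt ?_ h⟩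
    refine mul_le_mul_of_nonpos_left ?_ hθ.le
    exact measureReal_mono (closedBall_subset_closedBall (by linarith))
  have hI : closedBall x d = ⋂ k : ℕ, closedBall x (d + 1 / ((k : ℝ) + 1)) := by
    ext y
    simp only [mem_closedBall, mem_iInter]
    constructor
    · intro hy k
      have : 0 < 1 / ((k : ℝ) + 1) := by positivity
      linarith
    · intro hy
      have ht : Tendsto (fun k : ℕ => d + 1 / ((k : ℝ) + 1)) atTop (𝓝 (d + 0)) :=
        tendsto_const_nhds.add tendsto_one_div_add_atTop_nhds_zero_nat
      rw [add_zero] at ht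
      exact ge_of_tendsto' ht hy
  have ht : Tendsto (fun k : ℕ => μ (closedBall x (d + 1 / ((k : ℝ) + 1)))) atTop
      (𝓝 (μ (⋂ k : ℕ, closedBall x (d + 1 / ((k : ℝ) + 1))))) := by
    apply tendsto_measure_iInter_atTop
    · intro k
      exact isClosed_closedBall.measurableSet.nullMeasurableSet
    · intro k l hkl
      apply closedBall_subset_closedBall
      have : 1 / ((l : ℝ) + 1) ≤ 1 / ((k : ℝ) + 1) := by
        apply one_div_le_one_div_of_le (by positivity)
        have : (k : ℝ) ≤ l := by exact_mod_cast hkl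
        linarith
      linarith
    · exact ⟨0, measure_ne_top _ _⟩
  rw [← hI] at ht
  have ht2 := ((ENNReal.tendsto_toReal (measure_ne_top μ (closedBall x d))).comp ht).const_mul θ
  obtain ⟨k, hk⟩ := (ht2.eventually (gt_mem_nhds h)).exists
  refine ⟨1 / ((k : ℝ) + 1), by positivity, fun t' ht' _ => lt_of_le_of_lt ?_ hk⟩
  refine mul_le_mul_of_nonneg_left ?_ hθ
  exact measureReal_mono (closedBall_subset_closedBall (by linarith))

theorem packPre0_empty (s : ℝ) : packPre0 s (∅ : Set (EuclideanSpace ℝ (Fin n))) = 0 := by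
  apply le_antisymm _ bot_le
  refine (iInf₂_le 1 one_pos).trans ?_
  unfold packPre
  refine iSup_le fun cen => iSup_le fun rad => iSup_le fun h => ?_
  exact absurd (h 0) (by simp)

theorem pack_upper (S : SelfSimSetup f rr E rmin c s ρ μ fix ct) {θ δ : ℝ} (hδ : 0 < δ)
    (hθ : 0 ≤ θ)
    (h : ∀ x ∈ E, ∀ d, 0 < d → d < δ → (2 * d) ^ s ≤ θ * μ.real (closedBall x d)) :
    packM s E ≤ ENNReal.ofReal θ := by
  have := S.prob
  have := S.nt
  have h1 : packPre0 s E ≤ ENNReal.ofReal θ := by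
    refine (iInf₂_le δ hδ).trans ?_
    unfold packPre
    refine iSup_le fun cen => iSup_le fun rad => iSup_le fun hc => iSup_le fun hd =>
      iSup_le fun hp => ?_
    have h2 : ∀ i, ENNReal.ofReal (Metric.diam (Metric.closedBall (cen i) (rad i)) ^ s) ≤
        ENNReal.ofReal θ * μ (closedBall (cen i) (rad i)) := by
      intro i
      rcases le_or_gt (rad i) 0 with hr | hr
      · have : diam (closedBall (cen i) (rad i)) = 0 := by
          rcases hr.lt_or_eq with hr | hr
          · rw [closedBall_eq_empty.2 hr, diam_empty]
          · rw [hr, closedBall_zero, diam_singleton]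
        rw [this, Real.zero_rpow S.hs.ne']
        simp
      · have hd' := hd i
        rw [Metric.diam_closedBall_eq _ hr.le] at hd' ⊢
        rw [← ofReal_measureReal (measure_ne_top μ _), ← ENNReal.ofReal_mul hθ]
        exact ENNReal.ofReal_le_ofReal (h _ (hc i) _ hr (by linarith))
    calc _ ≤ ∑' i, ENNReal.ofReal θ * μ (closedBall (cen i) (rad i)) := ENNReal.tsum_le_tsum h2
      _ = ENNReal.ofReal θ * μ (⋃ i, closedBall (cen i) (rad i)) := by
          rw [ENNReal.tsum_mul_left, measure_iUnion hp fun i => isClosed_closedBall.measurableSet]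
      _ ≤ ENNReal.ofReal θ * 1 := by gcongr; exact prob_le_one
      _ = _ := mul_one _
  unfold packM
  refine (iInf₂_le (fun i : ℕ => if i = 0 then E else ∅) ?_).trans ?_
  · intro x hx
    exact mem_iUnion.2 ⟨0, by simpa using hx⟩
  · rw [tsum_eq_single 0]
    · simpa using h1
    · intro i hi
      simp [hi, packPre0_empty]

theorem packPre_ge (S : SelfSimSetup f rr E rmin c s ρ μ fix ct) {θ δ : ℝ} (hδ : 0 < δ)
    (U G : Set (EuclideanSpace ℝ (Fin n))) (hθ : 0 ≤ θ)
    (hG : ∀ x ∈ G, ∀ η > 0, ∃ d, 0 < d ∧ d < η ∧ θ * μ.real (closedBall x d) < (2 * d) ^ s) :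
    ENNReal.ofReal θ * μ (U ∩ G) ≤ packPre s δ U := by
  have := S.prob
  have := S.nt
  obtain ⟨t, r, htc, htU, hr, hnull, hdisj⟩ := Besicovitch.exists_disjoint_closedBall_covering_ae μ
    (fun x => {d | θ * μ.real (closedBall x d) < (2 * d) ^ s}) (U ∩ G)
    (by
      intro x hx η hη
      obtain ⟨d, h1, h2, h3⟩ := hG x hx.2 η hη
      exact ⟨d, h3, h1, h2⟩) (fun _ => δ / 2) (fun _ _ => by positivity)
  rcases t.eq_empty_or_nonempty with rfl | ⟨x0, hx0⟩
  · simp only [mem_empty_iff_false, iUnion_of_empty, iUnion_empty, sdiff_empty] at hnull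
    rw [hnull, mul_zero]; exact bot_le
  have hle : μ (U ∩ G) ≤ μ (⋃ x ∈ t, closedBall x (r x)) := by
    calc μ (U ∩ G) ≤ μ (((U ∩ G) \ ⋃ x ∈ t, closedBall x (r x)) ∪ ⋃ x ∈ t, closedBall x (r x)) :=
          measure_mono (by rw [sdiff_union_self]; exact subset_union_left)
      _ ≤ _ := measure_union_le _ _
      _ = _ := by rw [hnull, zero_add]
  have := htc.toEncodable
  let cen : ℕ → EuclideanSpace ℝ (Fin n) := fun i =>
    (Encodable.decode₂ t i).elim x0 (fun x => (x : EuclideanSpace ℝ (Fin n)))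
  let rad : ℕ → ℝ := fun i => (Encodable.decode₂ t i).elim (-1) (fun x => r x)
  have hcen : ∀ x : t, cen (Encodable.encode x) = x := fun x => by
    simp [cen]
  have hrad : ∀ x : t, rad (Encodable.encode x) = r x := fun x => by
    simp [rad]
  have hcase : ∀ i, (rad i = -1 ∧ cen i = x0) ∨ ∃ x : t, Encodable.encode x = i := by
    intro i
    rcases h : Encodable.decode₂ t i with _ | x
    · left; simp [rad, cen, h]
    · right; exact ⟨x, Encodable.mem_decode₂.1 h⟩
  have hpack : (∑' i, ENNReal.ofReal (Metric.diam (Metric.closedBall (cen i) (rad i)) ^ s))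
      ≤ packPre s δ U := by
    unfold packPre
    refine le_iSup_of_le cen <| le_iSup_of_le rad <| le_iSup_of_le ?_ <| le_iSup_of_le ?_ <|
      le_iSup_of_le ?_ le_rfl
    · intro i
      rcases hcase i with ⟨_, h⟩ | ⟨x, rfl⟩
      · rw [h]; exact (htU hx0).1
      · rw [hcen]; exact (htU x.2).1
    · intro i
      rcases hcase i with ⟨h, _⟩ | ⟨x, rfl⟩
      · rw [h, closedBall_eq_empty.2 (by norm_num), diam_empty]; exact hδ.le
      · rw [hcen, hrad]
        have := (hr x x.2).2
        rw [Metric.diam_closedBall_eq _ this.1.le]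
        linarith [this.2]
    · intro i j hij
      rcases hcase i with ⟨h, _⟩ | ⟨x, rfl⟩
      · rw [h, closedBall_eq_empty.2 (by norm_num : (-1 : ℝ) < 0)]; exact empty_disjoint _
      rcases hcase j with ⟨h, _⟩ | ⟨y, rfl⟩
      · rw [h, closedBall_eq_empty.2 (by norm_num : (-1 : ℝ) < 0)]; exact disjoint_empty _
      rw [hcen, hrad, hcen, hrad]
      refine hdisj x.2 y.2 fun hxy => hij ?_
      rw [Subtype.ext hxy]
  refine le_trans ?_ hpack
  refine le_trans ?_ (ENNReal.tsum_comp_le_tsum_of_injective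
    (Encodable.encode_injective (α := t)) _)
  calc ENNReal.ofReal θ * μ (U ∩ G) ≤ ENNReal.ofReal θ * μ (⋃ x ∈ t, closedBall x (r x)) := by gcongr
    _ ≤ ENNReal.ofReal θ * ∑' x : t, μ (closedBall x (r x)) := by
        gcongr; exact measure_biUnion_le _ htc _
    _ = ∑' x : t, ENNReal.ofReal θ * μ (closedBall x (r x)) := ENNReal.tsum_mul_left.symm
    _ ≤ _ := by
      refine ENNReal.tsum_le_tsum fun x => ?_
      rw [hcen, hrad, Metric.diam_closedBall_eq _ (hr x x.2).2.1.le,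
        ← ofReal_measureReal (measure_ne_top μ _), ← ENNReal.ofReal_mul hθ]
      exact ENNReal.ofReal_le_ofReal (hr x x.2).1.le

/-- points of E that see a low density at some scale below δ -/
def lowSet (_ : SelfSimSetup f rr E rmin c s ρ μ fix ct) (θ δ : ℝ) :
    Set (EuclideanSpace ℝ (Fin n)) :=
  {x | x ∈ E ∧ ∃ d, 0 < d ∧ d < δ ∧ θ * μ.real (closedBall x d) < (2 * d) ^ s}

theorem lowSet_f (S : SelfSimSetup f rr E rmin c s ρ μ fix ct) {θ δ : ℝ} (hδ : δ ≤ c)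
    (i : Fin N) (x : EuclideanSpace ℝ (Fin n)) (hx : x ∈ S.lowSet θ δ) :
    f i x ∈ S.lowSet θ (ρ * δ) := by
  obtain ⟨hxE, d, hd, hdδ, h⟩ := hx
  have hr := S.r_pos i
  have hr1 := S.r_lt i
  have hrρ := S.le_ρ i
  refine ⟨S.f_mem i x hxE, rr i * d, by positivity, by nlinarith, ?_⟩
  rw [S.scale i hxE (by nlinarith), show 2 * (rr i * d) = rr i * (2 * d) by ring,
    Real.mul_rpow hr.le (by positivity)]
  have := Real.rpow_pos_of_pos hr s
  nlinarith

theorem lowSet_mono (S : SelfSimSetup f rr E rmin c s ρ μ fix ct) {θ δ δ' : ℝ} (hδ : δ ≤ δ') :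
    S.lowSet θ δ ⊆ S.lowSet θ δ' := by
  rintro x ⟨hxE, d, hd, hdδ, h⟩
  exact ⟨hxE, d, hd, hdδ.trans_le hδ, h⟩

theorem c_pos (S : SelfSimSetup f rr E rmin c s ρ μ fix ct) : 0 < c := S.hct.trans_le S.hct'

theorem lowSet_null (S : SelfSimSetup f rr E rmin c s ρ μ fix ct) {θ : ℝ} (hθ : 0 ≤ θ)
    {x0 : EuclideanSpace ℝ (Fin n)} (hx0 : x0 ∈ E) {d0 : ℝ} (hd0 : 0 < d0) (hd0c : d0 < c)
    (h : θ * μ.real (closedBall x0 d0) < (2 * d0) ^ s) :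
    μ.real (S.lowSet θ c)ᶜ = 0 := by
  have := S.prob
  obtain ⟨t, ht, htt⟩ := S.cont_above x0 d0 θ _ h
  have ht2 := htt t le_rfl ht.le
  obtain ⟨k, hk⟩ := exists_pow_lt_of_lt_one ht S.ρ_lt
  obtain ⟨v, y0, hy0, hv⟩ := S.word_ex k x0 hx0
  have hword : ∀ (l : ℕ) (w : Fin l → Fin N) x, x ∈ S.lowSet θ c →
      wordComp f l w x ∈ S.lowSet θ c := by
    intro l
    induction l with
    | zero => intro w x hx; exact hx
    | succ l ih =>
      intro w x hx
      refine S.lowSet_mono ?_ (S.lowSet_f le_rfl _ _ (ih (w ∘ Fin.succ) x hx))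
      nlinarith [S.ρ_lt, S.c_pos]
  have hv0 : μ.real (wordComp f k v ⁻¹' (S.lowSet θ c)ᶜ) = 0 := by
    apply S.null_compl
    intro x hx hxn
    apply hxn
    refine ⟨S.word_mem _ _ x hx, d0, hd0, hd0c, lt_of_le_of_lt ?_ ht2⟩
    refine mul_le_mul_of_nonneg_left (measureReal_mono ?_) hθ
    apply closedBall_subset_closedBall'
    have := S.word_dist k v x hx y0 hy0
    rw [hv] at this
    linarith
  have hsum := S.ssw k (S.lowSet θ c)ᶜ
  set b := μ.real (S.lowSet θ c)ᶜ with hb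
  have hle : ∑ w : Fin k → Fin N, S.wt w * μ.real (wordComp f k w ⁻¹' (S.lowSet θ c)ᶜ) ≤
      ∑ w : Fin k → Fin N, (S.wt w * b - if w = v then S.wt w * b else 0) := by
    refine Finset.sum_le_sum fun w _ => ?_
    split_ifs with hw
    · rw [hw, hv0]; simp
    · rw [sub_zero]
      refine mul_le_mul_of_nonneg_left (measureReal_mono ?_) (S.wt_pos w).le
      intro x hx hxl
      exact hx (hword k w x hxl)
  rw [← hsum, Finset.sum_sub_distrib, ← Finset.sum_mul, S.sum_wt, one_mul] at hle
  simp only [Finset.sum_ite_eq', Finset.mem_univ, if_true] at hle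
  have := S.wt_pos v
  have hb0 : 0 ≤ b := measureReal_nonneg
  nlinarith

theorem pack_core (S : SelfSimSetup f rr E rmin c s ρ μ fix ct) {θ : ℝ} (hθ : 0 ≤ θ)
    {x0 : EuclideanSpace ℝ (Fin n)} (hx0 : x0 ∈ E) {d0 : ℝ} (hd0 : 0 < d0) (hd0c : d0 < c)
    (h : θ * μ.real (closedBall x0 d0) < (2 * d0) ^ s) :
    ENNReal.ofReal θ ≤ packM s E := by
  have := S.prob
  have h0 := S.lowSet_null hθ hx0 hd0 hd0c h
  have hm : ∀ m : ℕ, μ.real (S.lowSet θ (ρ ^ m * c))ᶜ = 0 := by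
    intro m
    induction m with
    | zero => simpa using h0
    | succ m ih =>
      rw [S.ssr]
      refine Finset.sum_eq_zero fun i _ => ?_
      rw [measureReal_mono_null _ ih, mul_zero]
      intro x hx hxl
      apply hx
      rw [pow_succ', mul_assoc]
      refine S.lowSet_f ?_ i x hxl
      have := pow_le_one₀ S.ρ_pos.le S.ρ_lt.le (n := m)
      nlinarith [S.c_pos]
  set G := ⋂ m : ℕ, S.lowSet θ (ρ ^ m * c) with hG
  have hGn : μ Gᶜ = 0 := by
    rw [hG, compl_iInter, measure_iUnion_null_iff]
    intro m
    exact (measureReal_eq_zero_iff (measure_ne_top _ _)).1 (hm m)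
  have hGs : ∀ x ∈ G, ∀ η > 0, ∃ d, 0 < d ∧ d < η ∧ θ * μ.real (closedBall x d) < (2 * d) ^ s := by
    intro x hx η hη
    obtain ⟨m, hm⟩ := exists_pow_lt_of_lt_one (div_pos hη S.c_pos) S.ρ_lt
    rw [lt_div_iff₀ S.c_pos] at hm
    obtain ⟨_, d, hd, hdδ, h⟩ := mem_iInter.1 hx m
    exact ⟨d, hd, hdδ.trans hm, h⟩
  unfold packM
  refine le_iInf₂ fun U hU => ?_
  have hstep : ∀ i, ENNReal.ofReal θ * μ (U i ∩ G) ≤ packPre0 s (U i) := fun i =>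
    le_iInf₂ fun δ hδ => S.packPre_ge hδ (U i) G hθ hGs
  have hone : 1 ≤ μ (⋃ i, U i ∩ G) := by
    have hE : μ E = 1 := by
      have := S.null
      rw [measureReal_def] at this
      exact (ENNReal.toReal_eq_one_iff _).1 this
    rw [← hE]
    calc μ E ≤ μ ((⋃ i, U i ∩ G) ∪ Gᶜ) := by
          apply measure_mono
          intro x hx
          by_cases hxG : x ∈ G
          · left
            obtain ⟨i, hi⟩ := mem_iUnion.1 (hU hx)
            exact mem_iUnion.2 ⟨i, hi, hxG⟩
          · right; exact hxG
      _ ≤ _ := measure_union_le _ _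
      _ = _ := by rw [hGn, add_zero]
  calc ENNReal.ofReal θ = ENNReal.ofReal θ * 1 := (mul_one _).symm
    _ ≤ ENNReal.ofReal θ * μ (⋃ i, U i ∩ G) := by gcongr
    _ ≤ ENNReal.ofReal θ * ∑' i, μ (U i ∩ G) := by gcongr; exact measure_iUnion_le _
    _ = ∑' i, ENNReal.ofReal θ * μ (U i ∩ G) := ENNReal.tsum_mul_left.symm
    _ ≤ _ := ENNReal.tsum_le_tsum hstep


theorem ct_lt (S : SelfSimSetup f rr E rmin c s ρ μ fix ct) : ct < ct / rmin := by
  rw [lt_div_iff₀ S.rmin_pos]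
  nlinarith [S.rmin_lt, S.hct]

theorem up_scale (S : SelfSimSetup f rr E rmin c s ρ μ fix ct) {θ : ℝ}
    (h : ∀ x ∈ E, ∀ d, ct ≤ d → d < ct / rmin → (2 * d) ^ s ≤ θ * μ.real (closedBall x d)) :
    ∀ k : ℕ, ∀ x ∈ E, ∀ d, ρ ^ k * ct ≤ d → d < ct / rmin →
      (2 * d) ^ s ≤ θ * μ.real (closedBall x d) := by
  intro k
  induction k with
  | zero => intro x hx d h1 h2; exact h x hx d (by simpa using h1) h2
  | succ k ih =>
    intro x hx d h1 h2
    rcases le_or_gt ct d with h3 | h3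
    · exact h x hx d h3 h2
    obtain ⟨i, y, hy, rfl⟩ := S.ex_pre x hx
    have hr := S.r_pos i
    have hd0 : 0 < d := lt_of_lt_of_le (mul_pos (pow_pos S.ρ_pos _) S.hct) h1
    obtain ⟨e, rfl⟩ : ∃ e, d = rr i * e := ⟨d / rr i, by field_simp⟩
    have he : 0 < e := pos_of_mul_pos_right hd0 hr.le
    have h4 : ρ ^ k * ct ≤ e := by
      rw [pow_succ', mul_assoc] at h1
      have := S.le_ρ i
      have h5 : ρ * (ρ ^ k * ct) ≤ ρ * e := h1.trans (by nlinarith)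
      exact le_of_mul_le_mul_left h5 S.ρ_pos
    have h5 : e < ct / rmin := by
      rw [lt_div_iff₀ S.rmin_pos]
      have := S.rmin_le i
      nlinarith
    have := ih y hy e h4 h5
    rw [S.scale i hy (h3.trans_le S.hct'), show 2 * (rr i * e) = rr i * (2 * e) by ring,
      Real.mul_rpow hr.le (by positivity)]
    have := Real.rpow_pos_of_pos hr s
    nlinarith

theorem ball_lower (S : SelfSimSetup f rr E rmin c s ρ μ fix ct) {t : ℝ} (ht : 0 < t) :
    ∃ β > 0, ∀ x ∈ E, β ≤ μ.real (closedBall x t) := by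
  have := S.prob
  obtain ⟨k, hk⟩ := exists_pow_lt_of_lt_one ht S.ρ_lt
  have : Nonempty (Fin k → Fin N) := ⟨fun _ => ⟨0, by have := S.hN; omega⟩⟩
  obtain ⟨w0, -, hw0⟩ := Finset.exists_min_image (Finset.univ : Finset (Fin k → Fin N))
    (fun w => S.wt w) Finset.univ_nonempty
  refine ⟨S.wt w0, S.wt_pos _, fun x hx => ?_⟩
  obtain ⟨w, y, hy, rfl⟩ := S.word_ex k x hx
  refine (hw0 w (Finset.mem_univ _)).trans ?_
  rw [S.ssw k]
  have h1 : S.wt w ≤ S.wt w * μ.real (wordComp f k w ⁻¹' (closedBall (wordComp f k w y) t)) := by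
    refine le_mul_of_one_le_right (S.wt_pos w).le ?_
    rw [← S.null]
    refine S.mono_E fun z hz _ => ?_
    exact (S.word_dist k w z hz y hy).trans hk.le
  refine h1.trans ?_
  exact Finset.single_le_sum (f := fun w' => S.wt w' *
    μ.real (wordComp f k w' ⁻¹' (closedBall (wordComp f k w y) t)))
    (fun w' _ => mul_nonneg (S.wt_pos w').le measureReal_nonneg) (Finset.mem_univ w)

theorem pack_ne_top (S : SelfSimSetup f rr E rmin c s ρ μ fix ct) : packM s E ≠ ⊤ := by
  have := S.prob
  obtain ⟨β, hβ, h⟩ := S.ball_lower S.hct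
  have hD : 0 < ct / rmin := div_pos S.hct S.rmin_pos
  have h0 : (0 : ℝ) ≤ (2 * (ct / rmin)) ^ s / β := by positivity
  have h1 := S.up_scale (θ := (2 * (ct / rmin)) ^ s / β) (by
    intro x hx d h1 h2
    have h3 : β ≤ μ.real (closedBall x d) :=
      (h x hx).trans (measureReal_mono (closedBall_subset_closedBall h1))
    have h4 : (2 * d) ^ s ≤ (2 * (ct / rmin)) ^ s :=
      Real.rpow_le_rpow (by linarith [S.hct]) (by linarith) S.hs.le
    calc (2 * d) ^ s ≤ (2 * (ct / rmin)) ^ s / β * β := by rwa [div_mul_cancel₀ _ hβ.ne']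
      _ ≤ _ := by gcongr)
  have h2 := S.pack_upper S.hct h0 (by
    intro x hx d hd hdc
    obtain ⟨k, hk⟩ := exists_pow_lt_of_lt_one (div_pos hd S.hct) S.ρ_lt
    rw [lt_div_iff₀ S.hct] at hk
    exact h1 k x hx d hk.le (hdc.trans S.ct_lt))
  exact (h2.trans_lt ENNReal.ofReal_lt_top).ne

theorem exists_p (S : SelfSimSetup f rr E rmin c s ρ μ fix ct) :
    ∃ p > 0, packM s E = ENNReal.ofReal p ∧
      (∀ x ∈ E, ∀ d, 0 < d → d ≤ ct / rmin → (2 * d) ^ s ≤ p * μ.real (ball x d)) ∧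
      (∀ ε > 0, ∃ x ∈ E, ∃ d, ct ≤ d ∧ d < ct / rmin ∧
        (p - ε) * μ.real (closedBall x d) < (2 * d) ^ s) := by
  have := S.prob
  have hP : packM s E = ENNReal.ofReal (packM s E).toReal :=
    (ENNReal.ofReal_toReal S.pack_ne_top).symm
  set p := (packM s E).toReal with hp
  have hp0 : 0 ≤ p := ENNReal.toReal_nonneg
  have core : ∀ x ∈ E, ∀ d, 0 < d → d < c → (2 * d) ^ s ≤ p * μ.real (closedBall x d) := by
    intro x hx d hd hdc
    by_contra! hcon
    set η := ((2 * d) ^ s - p * μ.real (closedBall x d)) / 2 with hη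
    have hη0 : 0 < η := by linarith
    have hm1 : μ.real (closedBall x d) ≤ 1 := measureReal_le_one
    have h1 := S.pack_core (θ := p + η) (by linarith) hx hd hdc (by nlinarith)
    rw [hP, ENNReal.ofReal_le_ofReal_iff hp0] at h1
    linarith
  obtain ⟨i, hi⟩ := S.rmin_ex
  have hr := S.rmin_pos
  have core2 : ∀ x ∈ E, ∀ d, 0 < d → d < ct / rmin →
      (2 * d) ^ s ≤ p * μ.real (closedBall x d) := by
    intro x hx d hd hdc
    rw [lt_div_iff₀ hr] at hdc
    have h1 : rr i * d < c := by rw [hi]; linarith [S.hct']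
    have h2 := core (f i x) (S.f_mem i x hx) (rr i * d) (by rw [hi]; positivity) h1
    rw [S.scale i hx h1, show 2 * (rr i * d) = rr i * (2 * d) by ring,
      Real.mul_rpow (S.r_pos i).le (by positivity), mul_left_comm] at h2
    exact le_of_mul_le_mul_left h2 (Real.rpow_pos_of_pos (S.r_pos i) s)
  have core3 : ∀ x ∈ E, ∀ d, 0 < d → d ≤ ct / rmin → (2 * d) ^ s ≤ p * μ.real (ball x d) := by
    intro x hx d hd hdc
    have ht : Tendsto (fun e : ℝ => (2 * e) ^ s) (𝓝[<] d) (𝓝 ((2 * d) ^ s)) := by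
      have : ContinuousAt (fun e : ℝ => (2 * e) ^ s) d := by
        apply ContinuousAt.rpow_const (by fun_prop)
        right; exact S.hs.le
      exact this.tendsto.mono_left nhdsWithin_le_nhds
    refine le_of_tendsto ht ?_
    filter_upwards [Ioo_mem_nhdsLT hd] with e he
    refine (core2 x hx e he.1 (he.2.trans_le hdc)).trans ?_
    exact mul_le_mul_of_nonneg_left (measureReal_mono (closedBall_subset_ball he.2)) hp0
  obtain ⟨x0, hx0⟩ := S.hEne
  have hpp : 0 < p := by
    have h1 := core3 x0 hx0 ct S.hct S.ct_lt.le
    have h2 : (0 : ℝ) < (2 * ct) ^ s := Real.rpow_pos_of_pos (by linarith [S.hct]) s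
    rcases hp0.lt_or_eq with h | h
    · exact h
    · rw [← h] at h1; linarith
  refine ⟨p, hpp, hP, core3, fun ε hε => ?_⟩
  by_contra! hcon
  have h0 : 0 ≤ p - ε := by
    have h1 := hcon x0 hx0 ct le_rfl S.ct_lt
    have h2 : (0 : ℝ) < (2 * ct) ^ s := Real.rpow_pos_of_pos (by linarith [S.hct]) s
    by_contra! h3
    nlinarith [measureReal_nonneg (μ := μ) (s := closedBall x0 ct)]
  have h1 := S.up_scale hcon
  have h2 := S.pack_upper S.hct h0 (by
    intro x hx d hd hdc
    obtain ⟨k, hk⟩ := exists_pow_lt_of_lt_one (div_pos hd S.hct) S.ρ_lt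
    rw [lt_div_iff₀ S.hct] at hk
    exact h1 k x hx d hk.le (hdc.trans S.ct_lt))
  rw [hP, ENNReal.ofReal_le_ofReal_iff h0] at h2
  linarith

/-! Facts about the point sets. -/

theorem algA_fix (S : SelfSimSetup f rr E rmin c s ρ μ fix ct) (i : Fin N) (k : ℕ) :
    fix i ∈ algA f (k + 1) := by
  induction k with
  | zero => exact ⟨i, S.hfix i⟩
  | succ k ih => exact mem_iUnion.2 ⟨i, fix i, ih, S.hfix i⟩

theorem algA_f (i : Fin N) {k : ℕ} {x : EuclideanSpace ℝ (Fin n)}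
    (hx : x ∈ algA f k) : f i x ∈ algA f (k + 1) := by
  cases k with
  | zero => exact absurd hx (by simp [algA])
  | succ k => exact mem_iUnion.2 ⟨i, x, hx, rfl⟩

theorem algA_sub (S : SelfSimSetup f rr E rmin c s ρ μ fix ct) (k : ℕ) :
    ∀ x ∈ algA f k, x ∈ E := by
  induction k with
  | zero => intro x hx; exact absurd hx (by simp [algA])
  | succ k ih =>
    intro x hx
    cases k with
    | zero => obtain ⟨i, hi⟩ := hx; exact S.fixed_mem hi
    | succ k =>
      obtain ⟨i, y, hy, rfl⟩ := mem_iUnion.1 hx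
      exact S.f_mem i y (ih y hy)

theorem algA_succ (k : ℕ) : ∀ x ∈ algA f k, x ∈ algA f (k + 1) := by
  induction k with
  | zero => intro x hx; exact absurd hx (by simp [algA])
  | succ k ih =>
    intro x hx
    cases k with
    | zero =>
      obtain ⟨i, hi⟩ := hx
      exact mem_iUnion.2 ⟨i, x, ⟨i, hi⟩, hi⟩
    | succ k =>
      obtain ⟨i, y, hy, rfl⟩ := mem_iUnion.1 hx
      exact mem_iUnion.2 ⟨i, y, ih y hy, rfl⟩

theorem algA_mono {k l : ℕ} (h : k ≤ l) : ∀ x ∈ algA f k, x ∈ algA f l := by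
  induction h with
  | refl => exact fun x hx => hx
  | step _ ih => exact fun x hx => algA_succ _ x (ih x hx)

theorem algA_pre {k : ℕ} {x : EuclideanSpace ℝ (Fin n)} (hx : x ∈ algA f k) :
    ∃ i, ∃ y ∈ algA f k, f i y = x := by
  cases k with
  | zero => exact absurd hx (by simp [algA])
  | succ k =>
    obtain ⟨i, y, hy, h⟩ := mem_iUnion.1 (algA_succ _ x hx)
    exact ⟨i, y, hy, h⟩

theorem algA_finite (S : SelfSimSetup f rr E rmin c s ρ μ fix ct) (k : ℕ) :
    (algA f k).Finite := by
  induction k with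
  | zero => simp [algA]
  | succ k ih =>
    cases k with
    | zero =>
      refine (finite_range fix).subset ?_
      rintro x ⟨i, hi⟩
      refine ⟨i, ?_⟩
      have h := S.hsim i (fix i) x
      rw [S.hfix, hi] at h
      have h2 : dist (fix i) x = 0 := by nlinarith [S.r_lt i, dist_nonneg (x := fix i) (y := x)]
      exact dist_eq_zero.1 h2
    | succ k => exact finite_iUnion fun i => ih.image _

theorem algA_dense (S : SelfSimSetup f rr E rmin c s ρ μ fix ct) (k : ℕ) :
    ∀ x ∈ E, ∃ a ∈ algA f (k + 1), dist a x ≤ ρ ^ k := by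
  induction k with
  | zero =>
    intro x hx
    refine ⟨fix ⟨0, by have := S.hN; omega⟩, S.algA_fix _ 0, ?_⟩
    simpa using S.dist_le _ (S.fix_mem _) _ hx
  | succ k ih =>
    intro x hx
    obtain ⟨i, y, hy, rfl⟩ := S.ex_pre x hx
    obtain ⟨a, ha, had⟩ := ih y hy
    refine ⟨f i a, algA_f i ha, ?_⟩
    rw [S.hsim, pow_succ']
    exact mul_le_mul (S.le_ρ _) had dist_nonneg S.ρ_pos.le

theorem word_algA (S : SelfSimSetup f rr E rmin c s ρ μ fix ct) (k : ℕ) :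
    ∀ (w : Fin (k + 1) → Fin N), wordComp f (k+1) w (fix (w (Fin.last k))) ∈ algA f (k + 1) := by
  induction k with
  | zero =>
    intro w
    have : wordComp f (0+1) w (fix (w (Fin.last 0))) = fix (w 0) := S.hfix _
    rw [this]
    exact S.algA_fix _ 0
  | succ k ih =>
    intro w
    exact algA_f (w 0) (ih (w ∘ Fin.succ))

theorem algMu_mono_A (S : SelfSimSetup f rr E rmin c s ρ μ fix ct) {k : ℕ} (hk : 1 ≤ k)
    {A B : Set (EuclideanSpace ℝ (Fin n))} (hA : MeasurableSet A) (hB : MeasurableSet B)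
    (h : ∀ x ∈ algA f k, x ∈ A → x ∈ B) :
    (algMu f rr fix s k).real A ≤ (algMu f rr fix s k).real B := by
  classical
  obtain ⟨k, rfl⟩ : ∃ l, k = l + 1 := ⟨k - 1, by omega⟩
  rw [S.algMu_real k A hA, S.algMu_real k B hB]
  refine Finset.sum_le_sum fun w _ => mul_le_mul_of_nonneg_left ?_ (S.wt_pos w).le
  split_ifs with h1 h2
  · exact le_rfl
  · exact absurd (h _ (S.word_algA k w) h1) h2
  · exact zero_le_one
  · exact le_rfl


theorem upper_unif (S : SelfSimSetup f rr E rmin c s ρ μ fix ct) {p : ℝ} (hp : 0 < p)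
    (hU : ∀ x ∈ E, ∀ d, 0 < d → d ≤ ct / rmin → (2 * d) ^ s ≤ p * μ.real (ball x d))
    {ε : ℝ} (hε : 0 < ε) :
    ∀ᶠ k : ℕ in atTop, ∀ x ∈ E, ∀ d, ct ≤ d → d ≤ ct / rmin →
      (2 * d) ^ s ≤ (p + ε) * (algMu f rr fix s k).real (ball x d) := by
  have := S.prob
  have hρ := tendsto_pow_atTop_nhds_zero_of_lt_one S.ρ_pos.le S.ρ_lt
  have hlim : Tendsto (fun k : ℕ => (ct / (ct - ρ ^ k)) ^ s * p) atTop (𝓝 p) := by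
    have h1 : Tendsto (fun k : ℕ => ct / (ct - ρ ^ k)) atTop (𝓝 (ct / (ct - 0))) :=
      tendsto_const_nhds.div (tendsto_const_nhds.sub hρ) (by simpa using S.hct.ne')
    rw [sub_zero, div_self S.hct.ne'] at h1
    have h2 := (h1.rpow_const (p := s) (Or.inl one_ne_zero)).mul_const p
    simpa using h2
  filter_upwards [hlim.eventually (gt_mem_nhds (show p < p + ε by linarith)),
    hρ.eventually (gt_mem_nhds S.hct), eventually_ge_atTop 1] with k h1 h2 hk x hx d hd hd'
  have ht : 0 < ρ ^ k := pow_pos S.ρ_pos k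
  set t := ρ ^ k with htdef
  have hctt : 0 < ct - t := by linarith
  have hct := S.hct
  have h3 := hU x hx (d - t) (by linarith) (by linarith)
  have h4 : μ.real (ball x (d - t)) ≤ (algMu f rr fix s k).real (ball x d) := by
    apply S.mu_le_algMu hk isOpen_ball.measurableSet
    intro u _ v _ huv hu
    rw [mem_ball] at hu ⊢
    have := dist_triangle v u x
    rw [dist_comm v u] at this
    linarith
  have h5 : 2 * d ≤ ct / (ct - t) * (2 * (d - t)) := by
    rw [div_mul_eq_mul_div, le_div_iff₀ hctt]
    nlinarith
  calc (2 * d) ^ s ≤ (ct / (ct - t) * (2 * (d - t))) ^ s :=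
        Real.rpow_le_rpow (by linarith) h5 S.hs.le
    _ = (ct / (ct - t)) ^ s * (2 * (d - t)) ^ s :=
        Real.mul_rpow (by positivity) (by linarith)
    _ ≤ (ct / (ct - t)) ^ s * (p * (algMu f rr fix s k).real (ball x d)) := by
        gcongr
        exact h3.trans (by gcongr)
    _ = (ct / (ct - t)) ^ s * p * (algMu f rr fix s k).real (ball x d) := by ring
    _ ≤ _ := by gcongr

theorem next_point (S : SelfSimSetup f rr E rmin c s ρ μ fix ct) {k : ℕ} (hk : 1 ≤ k)
    (x : EuclideanSpace ℝ (Fin n)) (d : ℝ) (h : ∃ y ∈ algA f k, d < dist x y) :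
    ∃ y ∈ algA f k, d < dist x y ∧ (∀ z ∈ algA f k, d < dist x z → dist x y ≤ dist x z) ∧
      ∀ e ≤ dist x y, (algMu f rr fix s k).real (ball x e) ≤
        (algMu f rr fix s k).real (closedBall x d) := by
  obtain ⟨y0, hy0, hy0d⟩ := h
  obtain ⟨y, hy, hmin⟩ := Set.exists_min_image {y | y ∈ algA f k ∧ d < dist x y} (fun y => dist x y)
    ((S.algA_finite k).subset fun y hy => hy.1) ⟨y0, hy0, hy0d⟩
  refine ⟨y, hy.1, hy.2, fun z hz hzd => hmin z ⟨hz, hzd⟩, fun e he => ?_⟩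
  apply S.algMu_mono_A hk isOpen_ball.measurableSet isClosed_closedBall.measurableSet
  intro z hz hzb
  rw [mem_ball, dist_comm] at hzb
  rw [mem_closedBall, dist_comm]
  by_contra! hcon
  linarith [hmin z ⟨hz, hcon⟩]

theorem algMu_closed (S : SelfSimSetup f rr E rmin c s ρ μ fix ct) {k : ℕ} (hk : 1 ≤ k)
    (x : EuclideanSpace ℝ (Fin n)) (d t : ℝ) (ht : ρ ^ k ≤ t) :
    (algMu f rr fix s k).real (closedBall x d) ≤ μ.real (closedBall x (d + t)) := by
  apply S.algMu_le_mu hk isClosed_closedBall.measurableSet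
  intro u _ v _ huv hu
  rw [mem_closedBall] at hu ⊢
  have := dist_triangle v u x
  rw [dist_comm v u] at this
  linarith

theorem select (S : SelfSimSetup f rr E rmin c s ρ μ fix ct) {p : ℝ} (hp : 0 < p)
    (hU : ∀ x ∈ E, ∀ d, 0 < d → d ≤ ct / rmin → (2 * d) ^ s ≤ p * μ.real (ball x d))
    (hL : ∀ ε > 0, ∃ x ∈ E, ∃ d, ct ≤ d ∧ d < ct / rmin ∧
        (p - ε) * μ.real (closedBall x d) < (2 * d) ^ s)
    {ε : ℝ} (hε : 0 < ε) (hεp : 0 < p - ε) (hε2 : (p + ε) * rmin ^ s < p - ε) :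
    ∀ᶠ k : ℕ in atTop, ∃ x ∈ algA f k, ∃ y ∈ algA f k, ct ≤ dist x y ∧ dist x y ≤ ct / rmin ∧
      (p - ε) * (algMu f rr fix s k).real (ball x (dist x y)) < (2 * dist x y) ^ s := by
  have := S.prob
  have hct := S.hct
  have hrm := S.rmin_pos
  have hρ := tendsto_pow_atTop_nhds_zero_of_lt_one S.ρ_pos.le S.ρ_lt
  obtain ⟨x0, hx0, d0, hd0, hd0D, h0⟩ := hL ε hε
  obtain ⟨t0, ht0, ht0'⟩ := S.cont_above x0 d0 (p - ε) _ h0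
  obtain ⟨t, ht, htt0, htD⟩ : ∃ t > 0, t ≤ t0 ∧ d0 + t < ct / rmin :=
    ⟨min t0 ((ct / rmin - d0) / 2), lt_min ht0 (by linarith), min_le_left _ _, by
      linarith [min_le_right t0 ((ct / rmin - d0) / 2)]⟩
  have h1 := ht0' t htt0 ht.le
  obtain ⟨K, hK⟩ := exists_pow_lt_of_lt_one (half_pos ht) S.ρ_lt
  obtain ⟨x, hx, hxd⟩ := S.algA_dense K x0 hx0
  have hxE := S.algA_sub _ x hx
  have h2 : (p - ε) * μ.real (closedBall x (d0 + t / 2)) < (2 * d0) ^ s := by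
    refine lt_of_le_of_lt ?_ h1
    refine mul_le_mul_of_nonneg_left (measureReal_mono ?_) hεp.le
    apply closedBall_subset_closedBall'
    linarith
  by_cases hcase : ∃ L, ∃ y ∈ algA f L, d0 < dist x y ∧ dist x y ≤ ct / rmin
  · obtain ⟨L, y, hy, hyd, hyD⟩ := hcase
    filter_upwards [hρ.eventually (gt_mem_nhds (half_pos ht)), eventually_ge_atTop 1,
      eventually_ge_atTop (K + 1), eventually_ge_atTop L] with k hk hk1 hkK hkL
    obtain ⟨z, hz, hzd, hzmin, hzm⟩ := S.next_point hk1 x d0 ⟨y, algA_mono hkL y hy, hyd⟩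
    refine ⟨x, algA_mono hkK x hx, z, hz, by linarith,
      (hzmin y (algA_mono hkL y hy) hyd).trans hyD, ?_⟩
    calc (p - ε) * (algMu f rr fix s k).real (ball x (dist x z)) ≤
        (p - ε) * μ.real (closedBall x (d0 + t / 2)) := by
          refine mul_le_mul_of_nonneg_left ?_ hεp.le
          exact (hzm _ le_rfl).trans (S.algMu_closed hk1 x d0 _ hk.le)
      _ < (2 * d0) ^ s := h2
      _ ≤ _ := Real.rpow_le_rpow (by linarith) (by linarith) S.hs.le
  · push Not at hcase
    obtain ⟨i, hi⟩ := S.rmin_ex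
    have hd2 : rmin * d0 < ct := by rw [lt_div_iff₀ hrm] at hd0D; linarith
    have h3 : (p - ε) * μ.real (closedBall (f i x) (rmin * d0 + rmin * (t / 2))) <
        (2 * (rmin * d0)) ^ s := by
      rw [← mul_add, ← hi, S.scale i hxE, hi, show 2 * (rmin * d0) = rmin * (2 * d0) by ring,
        Real.mul_rpow hrm.le (by linarith), mul_left_comm]
      · exact mul_lt_mul_of_pos_left h2 (Real.rpow_pos_of_pos hrm s)
      · rw [lt_div_iff₀ hrm] at htD
        rw [hi]
        nlinarith [S.hct']
    have hfar : ∀ L, ∀ y ∈ algA f L, rmin * d0 < dist (f i x) y → ct ≤ dist (f i x) y := by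
      intro L y hy hyd
      obtain ⟨j, z, hz, rfl⟩ := algA_pre hy
      rcases eq_or_ne i j with rfl | hij
      · rw [S.hsim, hi] at hyd ⊢
        have := hcase L z hz (lt_of_mul_lt_mul_left hyd hrm.le)
        rw [div_lt_iff₀ hrm] at this
        linarith
      · exact S.hct'.trans (S.sep i j hij x hxE z (S.algA_sub _ z hz))
    obtain ⟨j, hij⟩ : ∃ j : Fin N, i ≠ j := by
      have : Nontrivial (Fin N) := Fin.nontrivial_iff_two_le.2 S.hN
      obtain ⟨j, hj⟩ := exists_ne i
      exact ⟨j, hj.symm⟩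
    have hfj : rmin * d0 < dist (f i x) (fix j) := by
      have := S.sep i j hij x hxE (fix j) (S.fix_mem j)
      rw [S.hfix] at this
      linarith [S.hct']
    filter_upwards [hρ.eventually (gt_mem_nhds (mul_pos hrm (half_pos ht))), eventually_ge_atTop 1,
      eventually_ge_atTop (K + 2), S.upper_unif hp hU hε] with k hk hk1 hkK hup
    have hfk : fix j ∈ algA f k := by
      obtain ⟨l, rfl⟩ : ∃ l, k = l + 1 := ⟨k - 1, by omega⟩
      exact S.algA_fix j l
    obtain ⟨z, hz, hzd, hzmin, hzm⟩ := S.next_point hk1 (f i x) (rmin * d0) ⟨fix j, hfk, hfj⟩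
    have hcb := S.algMu_closed hk1 (f i x) (rmin * d0) _ hk.le
    have hzct := hfar k z hz hzd
    have hfin : ∀ e ≤ dist (f i x) z, (p - ε) * (algMu f rr fix s k).real (ball (f i x) e) <
        (2 * (rmin * d0)) ^ s := by
      intro e he
      refine lt_of_le_of_lt (mul_le_mul_of_nonneg_left ?_ hεp.le) h3
      exact (hzm _ he).trans hcb
    refine ⟨f i x, algA_mono hkK _ (algA_f i hx), z, hz, hzct, ?_, ?_⟩
    · by_contra! hcon
      have h4 := hfin _ hcon.le
      have h5 := hup (f i x) (S.f_mem i x hxE) (ct / rmin) S.ct_lt.le le_rfl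
      have h6 : (2 * (rmin * d0)) ^ s ≤ (2 * ct) ^ s :=
        Real.rpow_le_rpow (by nlinarith) (by linarith) S.hs.le
      have h7 : (2 * ct) ^ s = rmin ^ s * (2 * (ct / rmin)) ^ s := by
        rw [← Real.mul_rpow hrm.le (by positivity)]
        congr 1
        field_simp
      have h8 : 0 < rmin ^ s := Real.rpow_pos_of_pos hrm s
      set a := (algMu f rr fix s k).real (ball (f i x) (ct / rmin)) with ha
      have ha0 : 0 ≤ a := measureReal_nonneg
      have h9 : rmin ^ s * (2 * (ct / rmin)) ^ s ≤ rmin ^ s * ((p + ε) * a) :=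
        mul_le_mul_of_nonneg_left h5 h8.le
      nlinarith
    · refine (hfin _ le_rfl).trans_le ?_
      exact Real.rpow_le_rpow (by nlinarith) (by linarith) S.hs.le

theorem final (S : SelfSimSetup f rr E rmin c s ρ μ fix ct) :
    ∃ k0 : ℕ, ∃ x y : ℕ → EuclideanSpace ℝ (Fin n),
      (∀ k, 1 ≤ k → x k ∈ algA f k ∧ y k ∈ algA f k) ∧
      (∀ k, k0 ≤ k → dist (x k) (y k) ∈ Set.Icc ct (ct / rmin)) ∧
      Filter.Tendsto (fun k => ENNReal.ofReal ((2 * dist (x k) (y k)) ^ s) /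
          algMu f rr fix s k (Metric.ball (x k) (dist (x k) (y k))))
        Filter.atTop (nhds (packM s E)) := by
  obtain ⟨p, hp, hP, hU, hL⟩ := S.exists_p
  have hct := S.hct
  have hrm := S.rmin_pos
  have hrs : rmin ^ s < 1 := Real.rpow_lt_one hrm.le S.rmin_lt S.hs
  have hrs0 : 0 < rmin ^ s := Real.rpow_pos_of_pos hrm s
  -- error of a pair at level k
  let g : ℕ → EuclideanSpace ℝ (Fin n) × EuclideanSpace ℝ (Fin n) → ℝ := fun k q =>
    |(2 * dist q.1 q.2) ^ s / (algMu f rr fix s k).real (ball q.1 (dist q.1 q.2)) - p|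
  let Q : ℕ → Set (EuclideanSpace ℝ (Fin n) × EuclideanSpace ℝ (Fin n)) := fun k =>
    {q | (q.1 ∈ algA f k ∧ q.2 ∈ algA f k) ∧ dist q.1 q.2 ∈ Set.Icc ct (ct / rmin)}
  have hQfin : ∀ k, (Q k).Finite := fun k =>
    ((S.algA_finite k).prod (S.algA_finite k)).subset fun q hq => hq.1
  have hbase : ∀ ε > 0, ∀ᶠ k : ℕ in atTop, ∀ q ∈ Q k, (2 * dist q.1 q.2) ^ s ≤
      (p + ε) * (algMu f rr fix s k).real (ball q.1 (dist q.1 q.2)) ∧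
      0 < (algMu f rr fix s k).real (ball q.1 (dist q.1 q.2)) := by
    intro ε hε
    filter_upwards [S.upper_unif hp hU hε] with k hk q hq
    have h1 := hk q.1 (S.algA_sub k _ hq.1.1) _ hq.2.1 hq.2.2
    refine ⟨h1, ?_⟩
    have h2 : 0 < (2 * dist q.1 q.2) ^ s := Real.rpow_pos_of_pos (by linarith [hq.2.1]) s
    exact pos_of_mul_pos_right (h2.trans_le h1) (by linarith)
  have hex : ∀ ε > 0, ∀ᶠ k : ℕ in atTop, ∃ q ∈ Q k, g k q ≤ ε := by
    intro ε hε
    obtain ⟨δ, hδ, hδε, h1, h2⟩ : ∃ δ > 0, δ ≤ ε ∧ 0 < p - δ ∧ (p + δ) * rmin ^ s < p - δ := by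
      refine ⟨min ε (p * (1 - rmin ^ s) / 4), lt_min hε ?_, min_le_left _ _, ?_, ?_⟩
      · have : 0 < 1 - rmin ^ s := by linarith
        positivity
      · have := min_le_right ε (p * (1 - rmin ^ s) / 4)
        nlinarith
      · have h3 := min_le_right ε (p * (1 - rmin ^ s) / 4)
        set δ := min ε (p * (1 - rmin ^ s) / 4)
        have h4 : δ * rmin ^ s ≤ (p * (1 - rmin ^ s) / 4) * 1 := by
          refine mul_le_mul h3 hrs.le hrs0.le ?_
          have : 0 < 1 - rmin ^ s := by linarith
          positivity
        have : 0 < p * (1 - rmin ^ s) := mul_pos hp (by linarith)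
        nlinarith
    filter_upwards [S.select hp hU hL hδ h1 h2, hbase δ hδ] with k hk hb
    obtain ⟨x, hx, y, hy, h3, h4, h5⟩ := hk
    have hq : (x, y) ∈ Q k := ⟨⟨hx, hy⟩, h3, h4⟩
    obtain ⟨h6, h7⟩ := hb _ hq
    refine ⟨(x, y), hq, ?_⟩
    simp only [g]
    rw [abs_le]
    simp only at h6 h7
    have h8 := (div_le_iff₀ h7).2 h6
    have h9 := (lt_div_iff₀ h7).2 h5
    constructor <;> linarith
  -- choose minimizers
  have hchoose : ∀ k, ∃ q : EuclideanSpace ℝ (Fin n) × EuclideanSpace ℝ (Fin n),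
      (1 ≤ k → q.1 ∈ algA f k ∧ q.2 ∈ algA f k) ∧
      ((Q k).Nonempty → q ∈ Q k ∧ ∀ q' ∈ Q k, g k q ≤ g k q') := by
    intro k
    by_cases hne : (Q k).Nonempty
    · obtain ⟨q, hq, hmin⟩ := Set.exists_min_image (Q k) (g k) (hQfin k) hne
      exact ⟨q, fun _ => hq.1, fun _ => ⟨hq, hmin⟩⟩
    · let i : Fin N := ⟨0, by have := S.hN; omega⟩
      refine ⟨(fix i, fix i), fun hk => ?_, fun h => absurd h hne⟩
      obtain ⟨l, rfl⟩ : ∃ l, k = l + 1 := ⟨k - 1, by omega⟩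
      exact ⟨S.algA_fix i l, S.algA_fix i l⟩
  choose q hq1 hq2 using hchoose
  have hqQ : ∀ᶠ k in atTop, q k ∈ Q k := by
    filter_upwards [hex 1 one_pos] with k ⟨q', hq', _⟩
    exact (hq2 k ⟨q', hq'⟩).1
  obtain ⟨k0, hk0⟩ := eventually_atTop.1 hqQ
  refine ⟨k0, fun k => (q k).1, fun k => (q k).2, hq1, fun k hk => (hk0 k hk).2, ?_⟩
  rw [hP]
  have hreal : Tendsto (fun k => (2 * dist (q k).1 (q k).2) ^ s /
      (algMu f rr fix s k).real (ball (q k).1 (dist (q k).1 (q k).2))) atTop (𝓝 p) := by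
    rw [Metric.tendsto_nhds]
    intro ε hε
    filter_upwards [hex (ε / 2) (half_pos hε)] with k ⟨q', hq', hle⟩
    have h1 := (hq2 k ⟨q', hq'⟩).2 q' hq'
    rw [Real.dist_eq]
    exact lt_of_le_of_lt (h1.trans hle) (half_lt_self hε)
  refine (ENNReal.tendsto_ofReal hreal).congr' ?_
  filter_upwards [hqQ, hbase 1 one_pos] with k hk hb
  rw [ENNReal.ofReal_div_of_pos (hb _ hk).2, ofReal_measureReal (S.algMu_fin k _)]

end SelfSimSetup


theorem exists_discrete_sequence_tendsto_packing_measure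
{n N : ℕ} (hN : 2 ≤ N)
    (f : Fin N → EuclideanSpace ℝ (Fin n) → EuclideanSpace ℝ (Fin n))
    (rr : Fin N → ℝ) (hr : ∀ i, 0 < rr i ∧ rr i < 1)
    (hsim : ∀ i x y, dist (f i x) (f i y) = rr i * dist x y)
    (E : Set (EuclideanSpace ℝ (Fin n))) (hEne : E.Nonempty) (hEcp : IsCompact E)
    (hEinv : E = ⋃ i, f i '' E)
    (hssc : ∀ i j, i ≠ j → Disjoint (f i '' E) (f j '' E))
(hEdiam : Metric.diam E = 1)
(rmin : ℝ) (hrmin : IsLeast (Set.range rr) rmin)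
(c : ℝ) (hc : 0 < c)
    (hcdef : c = sInf {d : ℝ | ∃ i j : Fin N, i ≠ j ∧
      ∃ u ∈ f i '' E, ∃ v ∈ f j '' E, d = dist u v})
(s : ℝ) (hs : 0 < s) (hsum : ∑ i, rr i ^ s = 1)
    (μ : MeasureTheory.Measure (EuclideanSpace ℝ (Fin n))) (hμ : IsProbabilityMeasure μ)
    (hμss : ∀ A : Set (EuclideanSpace ℝ (Fin n)), MeasurableSet A →
      μ A = ∑ i, ENNReal.ofReal (rr i ^ s) * μ (f i ⁻¹' A))
(fix : Fin N → EuclideanSpace ℝ (Fin n)) (hfix : ∀ i, f i (fix i) = fix i)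
    (ct : ℝ) (hct : 0 < ct) (hct' : ct ≤ c)
    :
    ∃ k0 : ℕ, ∃ x y : ℕ → EuclideanSpace ℝ (Fin n),
      (∀ k, 1 ≤ k → x k ∈ algA f k ∧ y k ∈ algA f k) ∧
      (∀ k, k0 ≤ k → dist (x k) (y k) ∈ Set.Icc ct (ct / rmin)) ∧
      Filter.Tendsto (fun k => ENNReal.ofReal ((2 * dist (x k) (y k)) ^ s) /
          algMu f rr fix s k (Metric.ball (x k) (dist (x k) (y k))))
        Filter.atTop (nhds (packM s E)) := by
  have hne : (Finset.univ : Finset (Fin N)).Nonempty := ⟨⟨0, by omega⟩, Finset.mem_univ _⟩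
  obtain ⟨i0, -, hi0⟩ := Finset.exists_max_image Finset.univ rr hne
  have hfm : ∀ i, ∀ x ∈ E, f i x ∈ E := fun i x hx =>
    hEinv.symm.subset (Set.mem_iUnion.2 ⟨i, x, hx, rfl⟩)
  have hex : ∀ x ∈ E, ∃ i, ∃ y ∈ E, f i y = x := by
    intro x hx
    obtain ⟨i, y, hy, h⟩ := Set.mem_iUnion.1 (hEinv.subset hx)
    exact ⟨i, y, hy, h⟩
  have hdl : ∀ x ∈ E, ∀ y ∈ E, dist x y ≤ 1 := fun x hx y hy =>
    (Metric.dist_le_diam_of_mem hEcp.isBounded hx hy).trans hEdiam.le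
  have hsep : ∀ i j, i ≠ j → ∀ x ∈ E, ∀ y ∈ E, c ≤ dist (f i x) (f j y) := by
    intro i j hij x hx y hy
    rw [hcdef]
    refine csInf_le ⟨0, ?_⟩ ⟨i, j, hij, _, ⟨x, hx, rfl⟩, _, ⟨y, hy, rfl⟩, rfl⟩
    rintro d ⟨_, _, _, u, _, v, _, rfl⟩
    exact dist_nonneg
  have hnt : Nontrivial (EuclideanSpace ℝ (Fin n)) := by
    by_contra h
    have := not_nontrivial_iff_subsingleton.1 h
    rw [Metric.diam_subsingleton (Set.subsingleton_of_subsingleton)] at hEdiam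
    exact zero_ne_one hEdiam
  exact SelfSimSetup.final (ρ := rr i0) (c := c) (μ := μ)
    ⟨hN, fun i => (hr i).1, fun i => (hr i).2, hsim, hEne, hEcp, hfm, hex, hdl, hrmin.1,
      fun i => hrmin.2 ⟨i, rfl⟩, hsep, hs, hsum, hμ, hμss, hfix, hct, hct', (hr i0).1, (hr i0).2,
      fun i => hi0 i (Finset.mem_univ _), hnt⟩
end

section
/- Let (x_k, d_k)_{k≥1} be any sequence with x_k ∈ A := ⋃_{j≥1} A_j and d_k ∈ [c̃, c̃/r_min] for all k. Then lim_{k→∞} | μ_k(B'(x_k, d_k)) − μ(B(x_k, d_k)) | = 0. -/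
open Metric Set MeasureTheory Filter Topology
open scoped ENNReal NNReal

lemma aux_small_level {K : Type*} [TopologicalSpace K] [MeasurableSpace K] [BorelSpace K]
    (ν : Measure K) [IsFiniteMeasure ν] (g : K → ℝ) (hg : Continuous g) (η : ℝ)
    (h : ν.real {y | g y = 0} < η) : ∃ ε > 0, ν.real {y | |g y| ≤ ε} < η := by
  have h1 : Tendsto (ν ∘ fun ε : ℝ => {y | |g y| ≤ ε}) (𝓝[>] 0)
      (𝓝 (ν (⋂ r > (0:ℝ), {y | |g y| ≤ r}))) := by
    apply tendsto_measure_biInter_gt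
    · intro r _
      exact (isClosed_le hg.abs continuous_const).measurableSet.nullMeasurableSet
    · intro i j _ hij y hy
      exact le_trans hy hij
    · exact ⟨1, one_pos, measure_ne_top _ _⟩
  have h2 : (⋂ r > (0:ℝ), {y | |g y| ≤ r}) = {y | g y = 0} := by
    ext y
    simp only [mem_iInter, mem_ofPred_eq]
    constructor
    · intro hy
      have : |g y| ≤ 0 := le_of_forall_gt_imp_ge_of_dense hy
      exact abs_nonpos_iff.1 this
    · intro hy r hr
      rw [hy, abs_zero]; exact hr.le
  rw [h2] at h1
  have h3 := (ENNReal.tendsto_toReal (measure_ne_top ν _)).comp h1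
  have h4 := (h3.eventually (gt_mem_nhds h)).and self_mem_nhdsWithin
  obtain ⟨ε, h5, h6⟩ := h4.exists
  exact ⟨ε, h6, h5⟩

lemma aux_null {K : Type*} [MetricSpace K] [CompactSpace K] [MeasurableSpace K]
    [BorelSpace K] {ι : Type*} [Fintype ι] (F : ι → C(K, K)) (p : ι → ℝ) (hp : ∀ i, 0 < p i)
    (hp1 : ∑ i, p i = 1) (ν : Measure K) [IsProbabilityMeasure ν]
    (hν : ∀ A, MeasurableSet A → ν.real A = ∑ i, p i * ν.real (F i ⁻¹' A))
    (ρ : ℝ) (hρ0 : 0 ≤ ρ) (hρ : ρ < 1) (hF : ∀ i x y, dist (F i x) (F i y) ≤ ρ * dist x y)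
    (hcov : ∀ y, ∃ i z, F i z = y) (W : Submodule ℝ C(K, ℝ)) [FiniteDimensional ℝ W]
    (hW : ∀ i, ∀ Q ∈ W, Q.comp (F i) ∈ W)
    (hinj : ∀ i, ∀ Q ∈ W, Q.comp (F i) = 0 → Q = 0)
    (Q : C(K, ℝ)) (hQ : Q ∈ W) (hQ0 : Q ≠ 0) : ν.real {y | Q y = 0} = 0 := by
  classical
  have : ProperSpace W := FiniteDimensional.proper ℝ W
  let m : C(K, ℝ) → ℝ := fun Q => ν.real {y | Q y = 0}
  have husc : UpperSemicontinuousOn (fun R : W => m R) (sphere (0 : W) 1) := by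
    intro R _ η hη
    obtain ⟨ε, hε, h⟩ := aux_small_level ν R.1 R.1.continuous η hη
    apply mem_nhdsWithin_of_mem_nhds
    filter_upwards [Metric.ball_mem_nhds R hε] with R' hR'
    refine lt_of_le_of_lt (measureReal_mono ?_) h
    intro y hy
    have h1 : dist (R'.1 y) (R.1 y) ≤ dist R'.1 R.1 := ContinuousMap.dist_apply_le_dist y
    have h2 : dist R'.1 R.1 < ε := hR'
    have h3 : R'.1 y = 0 := hy
    rw [h3, dist_comm, Real.dist_eq, sub_zero] at h1
    exact (h1.trans h2.le)
  have hscale : ∀ (t : ℝ) (R : C(K, ℝ)), t ≠ 0 → m (t • R) = m R := by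
    intro t R ht
    simp [m, ht]
  have hnormed : ∀ R ∈ W, R ≠ 0 → ∃ R' : W, R' ∈ sphere (0 : W) 1 ∧ m R' = m R := by
    intro R hR hR0
    refine ⟨‖R‖⁻¹ • ⟨R, hR⟩, ?_, ?_⟩
    · have : ‖R‖ ≠ 0 := norm_ne_zero_iff.2 hR0
      rw [mem_sphere_zero_iff_norm]
      change ‖(‖R‖⁻¹ • R : C(K, ℝ))‖ = 1
      rw [norm_smul, norm_inv, norm_norm, inv_mul_cancel₀ this]
    · exact hscale _ _ (inv_ne_zero (norm_ne_zero_iff.2 hR0))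
  obtain ⟨Q', hQ', hQm⟩ := hnormed Q hQ hQ0
  obtain ⟨S, hS, hSmax⟩ := husc.exists_isMaxOn ⟨Q', hQ'⟩ (isCompact_sphere (0 : W) 1)
  have hmax : ∀ R ∈ W, R ≠ 0 → m R ≤ m S := by
    intro R hR hR0
    obtain ⟨R', hR', h⟩ := hnormed R hR hR0
    rw [← h]
    exact hSmax hR'
  have hS0 : (S : C(K, ℝ)) ≠ 0 := by
    intro h
    have h1 : S = 0 := Subtype.ext h
    rw [h1] at hS
    simp at hS
  -- maximal elements
  let P : C(K, ℝ) → Prop := fun R => R ∈ W ∧ R ≠ 0 ∧ m R = m S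
  have hstep : ∀ R, P R → ∀ i, P (R.comp (F i)) := by
    rintro R ⟨hR, hR0, hRm⟩ i
    have hi0 : ∀ j, R.comp (F j) ≠ 0 := fun j h => hR0 (hinj j R hR h)
    refine ⟨hW i R hR, hi0 i, ?_⟩
    have h1 : m R = ∑ j, p j * m (R.comp (F j)) :=
      hν _ (isClosed_eq R.continuous continuous_const).measurableSet
    have h2 : ∑ j, p j * m (R.comp (F j)) = ∑ j, p j * m S := by
      rw [← h1, ← Finset.sum_mul, hp1, one_mul, hRm]
    have h3 := (Finset.sum_eq_sum_iff_of_le (fun j _ =>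
      mul_le_mul_of_nonneg_left (hmax _ (hW j R hR) (hi0 j)) (hp j).le)).1 h2 i
        (Finset.mem_univ i)
    exact mul_left_cancel₀ (hp i).ne' h3
  have hword : ∀ k : ℕ, ∀ y : K, ∃ G : C(K, K), (∃ z, G z = y) ∧
      (∀ u v, dist (G u) (G v) ≤ ρ ^ k * dist u v) ∧ ∀ R, P R → P (R.comp G) := by
    intro k
    induction k with
    | zero =>
      intro y
      exact ⟨ContinuousMap.id K, ⟨y, rfl⟩, fun u v => by simp, fun R hR => hR⟩
    | succ k ih =>
      intro y
      obtain ⟨i, z, hz⟩ := hcov y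
      obtain ⟨G, ⟨u, hu⟩, hG, hGP⟩ := ih z
      refine ⟨(F i).comp G, ⟨u, by simp [hu, hz]⟩, ?_, ?_⟩
      · intro a b
        calc dist (F i (G a)) (F i (G b)) ≤ ρ * dist (G a) (G b) := hF _ _ _
          _ ≤ ρ * (ρ ^ k * dist a b) := mul_le_mul_of_nonneg_left (hG a b) hρ0
          _ = ρ ^ (k+1) * dist a b := by ring
      · intro R hR
        exact hGP _ (hstep R hR i)
  obtain ⟨y, hy⟩ : ∃ y, (S : C(K, ℝ)) y ≠ 0 := by
    by_contra! h
    exact hS0 (ContinuousMap.ext h)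
  have hopen : IsOpen {z | (S : C(K, ℝ)) z ≠ 0} := isOpen_ne_fun S.1.continuous continuous_const
  obtain ⟨ε, hε, hball⟩ := Metric.isOpen_iff.1 hopen y hy
  have hdiam : ∃ D : ℝ, ∀ u v : K, dist u v ≤ D :=
    ⟨diam (univ : Set K), fun u v =>
      dist_le_diam_of_mem isCompact_univ.isBounded (mem_univ u) (mem_univ v)⟩
  obtain ⟨D, hD⟩ := hdiam
  have hlim : Tendsto (fun k : ℕ => ρ ^ k * D) atTop (𝓝 0) := by
    simpa using (tendsto_pow_atTop_nhds_zero_of_lt_one hρ0 hρ).mul_const D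
  obtain ⟨k, hk⟩ := (hlim.eventually (gt_mem_nhds hε)).exists
  obtain ⟨G, ⟨z, hz⟩, hG, hGP⟩ := hword k y
  have h1 := (hGP S ⟨S.2, hS0, rfl⟩).2.2
  have h2 : m ((S : C(K, ℝ)).comp G) = 0 := by
    have : {u | ((S : C(K, ℝ)).comp G) u = 0} = ∅ := by
      ext u
      simp only [mem_ofPred_eq, mem_empty_iff_false, iff_false]
      apply hball
      rw [mem_ball, ← hz]
      exact lt_of_le_of_lt ((hG u z).trans
        (mul_le_mul_of_nonneg_left (hD _ _) (pow_nonneg hρ0 k))) hk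
    simp only [m]
    rw [this]
    simp
  have h3 : m Q ≤ 0 := by
    rw [← h2, h1]
    exact hmax Q hQ hQ0
  exact le_antisymm h3 measureReal_nonneg

lemma aux_surj {n : ℕ} (f : EuclideanSpace ℝ (Fin n) → EuclideanSpace ℝ (Fin n)) (r : ℝ)
    (hr : 0 < r) (hf : ∀ x y, dist (f x) (f y) = r * dist x y) : Function.Surjective f := by
  have hiso : Isometry (fun x => r⁻¹ • f x) := by
    apply Isometry.of_dist_eq
    intro x y
    rw [dist_smul₀, hf, norm_inv, Real.norm_of_nonneg hr.le, inv_mul_cancel_left₀ hr.ne']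
  let g := hiso.affineIsometryOfStrictConvexSpace
  have hg : Function.Surjective g := by
    have h1 : Function.Injective g.toAffineMap.linear :=
      (AffineMap.linear_injective_iff _).2 g.injective
    have h2 := LinearMap.injective_iff_surjective.1 h1
    exact (AffineMap.linear_surjective_iff _).1 h2
  intro y
  obtain ⟨x, hx⟩ := hg (r⁻¹ • y)
  refine ⟨x, ?_⟩
  have : r⁻¹ • f x = r⁻¹ • y := hx
  exact smul_right_injective _ (inv_ne_zero hr.ne') this

/-- squared distance functions on `E` -/
def auxG {X : Type*} [MetricSpace X] (E : Set X) (p : X) : C(E, ℝ) :=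
  ⟨fun y => dist (y : X) p ^ 2, by fun_prop⟩

def auxW {X : Type*} [MetricSpace X] (E : Set X) : Submodule ℝ C(E, ℝ) :=
  Submodule.span ℝ (insert 1 (range (auxG E)))

lemma auxW_fin {n : ℕ} (E : Set (EuclideanSpace ℝ (Fin n))) :
    FiniteDimensional ℝ (auxW E) := by
  let L : EuclideanSpace ℝ (Fin n) →ₗ[ℝ] C(E, ℝ) :=
    { toFun := fun b => ⟨fun y => inner ℝ b (y : EuclideanSpace ℝ (Fin n)), by fun_prop⟩
      map_add' := by
        intro a b; ext y; simp [inner_add_left]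
      map_smul' := by
        intro a b; ext y; simp [inner_smul_left] }
  let Nn : C(E, ℝ) := ⟨fun y => ‖(y : EuclideanSpace ℝ (Fin n))‖ ^ 2, by fun_prop⟩
  let V : Submodule ℝ C(E, ℝ) := Submodule.span ℝ {1, Nn} ⊔ LinearMap.range L
  have hV : FiniteDimensional ℝ V := by
    have : FiniteDimensional ℝ (Submodule.span ℝ ({1, Nn} : Set C(E, ℝ))) :=
      FiniteDimensional.span_of_finite ℝ (by simp)
    infer_instance
  have h1 : (1 : C(E, ℝ)) ∈ V :=
    Submodule.mem_sup_left (Submodule.subset_span (by simp))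
  have h2 : Nn ∈ V :=
    Submodule.mem_sup_left (Submodule.subset_span (by simp))
  have hle : auxW E ≤ V := by
    apply Submodule.span_le.2
    rintro g (rfl | ⟨p, rfl⟩)
    · exact h1
    · have : auxG E p = Nn + (-2 : ℝ) • L p + (‖p‖ ^ 2) • (1 : C(E, ℝ)) := by
        ext y
        simp only [auxG, ContinuousMap.coe_mk, Nn, L, ContinuousMap.add_apply,
          ContinuousMap.smul_apply, ContinuousMap.one_apply, LinearMap.coe_mk, AddHom.coe_mk,
          smul_eq_mul, mul_one]
        rw [dist_eq_norm, norm_sub_sq_real, real_inner_comm]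
        ring
      rw [this]
      exact V.add_mem (V.add_mem h2 (V.smul_mem _ (Submodule.mem_sup_right ⟨p, rfl⟩)))
        (V.smul_mem _ h1)
  exact Submodule.finiteDimensional_of_le hle

lemma auxW_map {n : ℕ} (E : Set (EuclideanSpace ℝ (Fin n)))
    (f : EuclideanSpace ℝ (Fin n) → EuclideanSpace ℝ (Fin n)) (r : ℝ)
    (hr : 0 < r) (hf : ∀ x y, dist (f x) (f y) = r * dist x y)
    (F : C(E, E)) (hF : ∀ y : E, (F y : EuclideanSpace ℝ (Fin n)) = f y) :
    (∀ Q ∈ auxW E, Q.comp F ∈ auxW E) ∧ (∀ Q ∈ auxW E, Q.comp F = 0 → Q = 0) := by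
  have := auxW_fin E
  let T : C(E, ℝ) →ₗ[ℝ] C(E, ℝ) := (ContinuousMap.compRightAlgHom ℝ ℝ F).toLinearMap
  have hT : ∀ Q, T Q = Q.comp F := fun Q => rfl
  have hTG : ∀ q, T (auxG E (f q)) = (r ^ 2) • auxG E q := by
    intro q
    ext y
    simp [hT, auxG, hF, hf, mul_pow]
  have hT1 : T 1 = 1 := rfl
  have h1 : (1 : C(E, ℝ)) ∈ auxW E := Submodule.subset_span (by simp)
  have hG : ∀ q, auxG E q ∈ auxW E := fun q =>
    Submodule.subset_span (mem_insert_of_mem _ ⟨q, rfl⟩)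
  have hA : ∀ Q ∈ auxW E, T Q ∈ auxW E := by
    have : auxW E ≤ (auxW E).comap T := by
      apply Submodule.span_le.2
      rintro g (rfl | ⟨p, rfl⟩)
      · exact h1
      · obtain ⟨q, rfl⟩ := aux_surj f r hr hf p
        change T _ ∈ auxW E
        rw [hTG]
        exact Submodule.smul_mem _ _ (hG q)
    exact this
  have hB : auxW E ≤ (auxW E).map T := by
    apply Submodule.span_le.2
    rintro g (rfl | ⟨q, rfl⟩)
    · exact ⟨1, h1, hT1⟩
    · refine ⟨(r ^ 2)⁻¹ • auxG E (f q), Submodule.smul_mem _ _ (hG _), ?_⟩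
      rw [map_smul, hTG, smul_smul, inv_mul_cancel₀ (by positivity), one_smul]
  refine ⟨hA, ?_⟩
  let T' := T.restrict hA
  have hsurj : Function.Surjective T' := by
    rintro ⟨g, hg⟩
    obtain ⟨Q, hQ, hQg⟩ := hB hg
    exact ⟨⟨Q, hQ⟩, Subtype.ext hQg⟩
  have hinj := LinearMap.injective_iff_surjective.2 hsurj
  intro Q hQ h0
  have h2 : T' ⟨Q, hQ⟩ = T' 0 := by
    rw [map_zero]
    exact Subtype.ext h0
  exact congrArg Subtype.val (hinj h2)

lemma aux_infDist {X : Type*} [MetricSpace X] {E : Set X} (hEcp : IsCompact E)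
    (hEne : E.Nonempty) (g : X → X) (r : ℝ) 
    (hg : ∀ x y, dist (g x) (g y) = r * dist x y) (hgE : ∀ y ∈ E, g y ∈ E) (x : X) :
    infDist (g x) E ≤ r * infDist x E := by
  obtain ⟨y, hy, h⟩ := hEcp.exists_infDist_eq_dist hEne x
  rw [h, ← hg]
  exact infDist_le_dist_of_mem (hgE y hy)

lemma aux_fix_mem {X : Type*} [MetricSpace X] {E : Set X} (hEcp : IsCompact E)
    (hEne : E.Nonempty) (g : X → X) (r : ℝ) (hr1 : r < 1)
    (hg : ∀ x y, dist (g x) (g y) = r * dist x y) (hgE : ∀ y ∈ E, g y ∈ E) (x : X)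
    (hx : g x = x) : x ∈ E := by
  have h := aux_infDist hEcp hEne g r hg hgE x
  rw [hx] at h
  have h0 : 0 ≤ infDist x E := infDist_nonneg
  have : infDist x E = 0 := by nlinarith
  exact (hEcp.isClosed.mem_iff_infDist_zero hEne).2 this

lemma aux_supp {X : Type*} [MetricSpace X] [MeasurableSpace X] [BorelSpace X] {N : ℕ}
    (f : Fin N → X → X) (rr : Fin N → ℝ) (hr : ∀ i, 0 < rr i)
    (ρ : ℝ) (hρ0 : 0 < ρ) (hρ : ρ < 1) (hrρ : ∀ i, rr i ≤ ρ)
    (hsim : ∀ i x y, dist (f i x) (f i y) = rr i * dist x y)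
    (E : Set X) (hEne : E.Nonempty) (hEcp : IsCompact E)
    (hfE : ∀ i, ∀ y ∈ E, f i y ∈ E) (s : ℝ) (hsum : ∑ i, rr i ^ s = 1)
    (μ : Measure X) [IsProbabilityMeasure μ]
    (hμss : ∀ A : Set X, MeasurableSet A →
      μ.real A = ∑ i, rr i ^ s * μ.real (f i ⁻¹' A)) : μ Eᶜ = 0 := by
  have hmeas : ∀ ε, MeasurableSet {y | infDist y E ≤ ε} := fun ε =>
    (isClosed_le (continuous_infDist_pt E) continuous_const).measurableSet
  have hstep : ∀ ε ≥ 0, μ.real {y | infDist y E ≤ ε / ρ} ≤ μ.real {y | infDist y E ≤ ε} := by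
    intro ε hε
    rw [hμss _ (hmeas ε)]
    calc μ.real {y | infDist y E ≤ ε / ρ}
        = ∑ i, rr i ^ s * μ.real {y | infDist y E ≤ ε / ρ} := by
          rw [← Finset.sum_mul, hsum, one_mul]
      _ ≤ _ := by
          refine Finset.sum_le_sum fun i _ =>
            mul_le_mul_of_nonneg_left (measureReal_mono ?_) (Real.rpow_nonneg (hr i).le _)
          intro y hy
          have hy' : infDist y E ≤ ε / ρ := hy
          have h1 := aux_infDist hEcp hEne (f i) (rr i) (hsim i) (hfE i) y
          have h0 : 0 ≤ infDist y E := infDist_nonneg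
          have h2 : infDist y E * ρ ≤ ε := (le_div_iff₀ hρ0).1 hy'
          have h3 := mul_le_mul_of_nonneg_right (hrρ i) h0
          change infDist (f i y) E ≤ ε
          linarith
  have hiter : ∀ ε ≥ 0, ∀ k : ℕ,
      μ.real {y | infDist y E ≤ ε / ρ ^ k} ≤ μ.real {y | infDist y E ≤ ε} := by
    intro ε hε k
    induction k with
    | zero => simp
    | succ k ih =>
      refine le_trans ?_ ih
      have := hstep (ε / ρ ^ k) (by positivity)
      rwa [div_div, ← pow_succ] at this
  have hone : ∀ ε > 0, μ.real {y | infDist y E ≤ ε} = 1 := by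
    intro ε hε
    apply le_antisymm measureReal_le_one
    have hmono : Monotone (fun k : ℕ => {y | infDist y E ≤ ε / ρ ^ k}) := by
      intro a b hab y hy
      have hy' : infDist y E ≤ ε / ρ ^ a := hy
      refine hy'.trans ?_
      exact div_le_div_of_nonneg_left hε.le (by positivity)
        (pow_le_pow_of_le_one hρ0.le hρ.le hab)
    have hun : (⋃ k : ℕ, {y | infDist y E ≤ ε / ρ ^ k}) = univ := by
      apply eq_univ_of_forall
      intro y
      have h1 : Tendsto (fun k : ℕ => ρ ^ k * infDist y E) atTop (𝓝 0) := by
        simpa using (tendsto_pow_atTop_nhds_zero_of_lt_one hρ0.le hρ).mul_const (infDist y E)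
      obtain ⟨k, hk⟩ := (h1.eventually (gt_mem_nhds hε)).exists
      refine mem_iUnion.2 ⟨k, ?_⟩
      change infDist y E ≤ ε / ρ ^ k
      rw [le_div_iff₀ (by positivity), mul_comm]
      exact hk.le
    have h2 := tendsto_measure_iUnion_atTop (μ := μ) hmono
    rw [hun] at h2
    have h3 := (ENNReal.tendsto_toReal (measure_ne_top μ _)).comp h2
    rw [measure_univ, ENNReal.toReal_one] at h3
    exact le_of_tendsto' h3 (hiter ε hε.le)
  have hE : μ.real E = 1 := by
    by_contra hne
    have hlt : μ.real E < 1 := lt_of_le_of_ne measureReal_le_one hne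
    have hset : {y | infDist y E = 0} = E := by
      ext y
      exact (hEcp.isClosed.mem_iff_infDist_zero hEne).symm
    obtain ⟨ε, hε, h⟩ := aux_small_level μ (fun y => infDist y E) (continuous_infDist_pt E) 1
      (by rw [hset]; exact hlt)
    have h' : {y | |infDist y E| ≤ ε} = {y | infDist y E ≤ ε} := by
      ext y
      change |infDist y E| ≤ ε ↔ infDist y E ≤ ε
      rw [abs_of_nonneg infDist_nonneg]
    rw [h', hone ε hε] at h
    exact lt_irrefl _ h
  have h4 := probReal_compl_eq_one_sub (μ := μ) hEcp.isClosed.measurableSet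
  rw [hE, sub_self] at h4
  exact (measureReal_eq_zero_iff).1 h4

lemma aux_sphere {n N : ℕ}
    (f : Fin N → EuclideanSpace ℝ (Fin n) → EuclideanSpace ℝ (Fin n))
    (rr : Fin N → ℝ) (hr : ∀ i, 0 < rr i)
    (ρ : ℝ) (hρ0 : 0 < ρ) (hρ : ρ < 1) (hrρ : ∀ i, rr i ≤ ρ)
    (hsim : ∀ i x y, dist (f i x) (f i y) = rr i * dist x y)
    (E : Set (EuclideanSpace ℝ (Fin n))) (hEcp : IsCompact E)
    (hEinv : E = ⋃ i, f i '' E)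
    (hfE : ∀ i, ∀ y ∈ E, f i y ∈ E) (s : ℝ) (hsum : ∑ i, rr i ^ s = 1)
    (μ : Measure (EuclideanSpace ℝ (Fin n))) [IsProbabilityMeasure μ]
    (hμss : ∀ A : Set (EuclideanSpace ℝ (Fin n)), MeasurableSet A →
      μ.real A = ∑ i, rr i ^ s * μ.real (f i ⁻¹' A)) (hsupp : μ Eᶜ = 0)
    (x : EuclideanSpace ℝ (Fin n)) (hx : x ∈ E) (d : ℝ) (hd : 0 < d) :
    μ.real {y | dist y x - d = 0} = 0 := by
  have : CompactSpace E := isCompact_iff_compactSpace.1 hEcp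
  have hEm : MeasurableSet E := hEcp.isClosed.measurableSet
  let ν : Measure E := μ.comap Subtype.val
  have hν : ∀ A : Set E, ν A = μ (Subtype.val '' A) := fun A => comap_subtype_coe_apply hEm μ A
  have hνr : ∀ A : Set E, ν.real A = μ.real (Subtype.val '' A) := fun A => by
    simp only [Measure.real, hν]
  have hνp : IsProbabilityMeasure ν := by
    constructor
    rw [hν, image_univ, Subtype.range_coe]
    exact (prob_compl_eq_zero_iff hEm).1 hsupp
  have hcont : ∀ i, Continuous (f i) := fun i =>
    (LipschitzWith.of_dist_le_mul (K := ⟨rr i, (hr i).le⟩) fun a b => (hsim i a b).le).continuous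
  let F : Fin N → C(E, E) := fun i => ⟨fun y => ⟨f i y, hfE i y y.2⟩, by
    have := hcont i
    fun_prop⟩
  have hmap := fun i => auxW_map E (f i) (rr i) (hr i) (hsim i) (F i) (fun y => rfl)
  have hfin := auxW_fin E
  have key := aux_null F (fun i => rr i ^ s) (fun i => Real.rpow_pos_of_pos (hr i) s) hsum ν
    (by
      intro A hA
      have hAm : MeasurableSet (Subtype.val '' A : Set (EuclideanSpace ℝ (Fin n))) :=
        hEm.subtype_image hA
      rw [hνr, hμss _ hAm]
      refine Finset.sum_congr rfl fun i _ => ?_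
      rw [hνr]
      congr 1
      have h1 : μ (f i ⁻¹' (Subtype.val '' A) ∩ E) = μ (f i ⁻¹' (Subtype.val '' A)) :=
        measure_inter_conull hsupp
      have h2 : f i ⁻¹' (Subtype.val '' A) ∩ E = Subtype.val '' (F i ⁻¹' A) := by
        ext y
        constructor
        · rintro ⟨⟨z, hz, hzy⟩, hyE⟩
          refine ⟨⟨y, hyE⟩, ?_, rfl⟩
          change F i ⟨y, hyE⟩ ∈ A
          have : F i ⟨y, hyE⟩ = z := Subtype.ext hzy.symm
          rwa [this]
        · rintro ⟨z, hz, rfl⟩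
          exact ⟨⟨F i z, hz, rfl⟩, z.2⟩
      simp only [Measure.real]
      rw [← h1, h2])
    ρ hρ0.le hρ
    (by
      intro i a b
      change dist (f i a) (f i b) ≤ ρ * dist (a : EuclideanSpace ℝ (Fin n)) b
      rw [hsim]
      exact mul_le_mul_of_nonneg_right (hrρ i) dist_nonneg)
    (by
      rintro ⟨y, hy⟩
      have hy' := hy
      rw [hEinv] at hy'
      obtain ⟨i, z, hz, hzy⟩ := mem_iUnion.1 hy'
      exact ⟨i, ⟨z, hz⟩, Subtype.ext hzy⟩)
    (auxW E) (fun i => (hmap i).1) (fun i => (hmap i).2)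
    (auxG E x - (d ^ 2) • 1)
    (Submodule.sub_mem _ (Submodule.subset_span (mem_insert_of_mem _ ⟨x, rfl⟩))
      (Submodule.smul_mem _ _ (Submodule.subset_span (mem_insert _ _))))
    (by
      intro h
      have h1 := congrArg (fun g : C(E, ℝ) => g ⟨x, hx⟩) h
      simp [auxG] at h1
      exact hd.ne' h1)
  rw [hνr] at key
  have h3 : {y | dist y x - d = 0} ∩ E =
      Subtype.val '' {y : E | (auxG E x - (d ^ 2) • 1) y = 0} := by
    ext y
    constructor
    · rintro ⟨h, hyE⟩
      refine ⟨⟨y, hyE⟩, ?_, rfl⟩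
      have h' : dist y x = d := sub_eq_zero.1 h
      simp [auxG, h']
    · rintro ⟨z, hz, rfl⟩
      refine ⟨?_, z.2⟩
      have hz' : dist (z : EuclideanSpace ℝ (Fin n)) x ^ 2 - d ^ 2 * 1 = 0 := hz
      have : dist (z : EuclideanSpace ℝ (Fin n)) x = d := by
        have h0 : 0 ≤ dist (z : EuclideanSpace ℝ (Fin n)) x := dist_nonneg
        nlinarith
      exact sub_eq_zero.2 this
  have h4 : μ ({y | dist y x - d = 0} ∩ E) = μ {y | dist y x - d = 0} :=
    measure_inter_conull hsupp
  simp only [Measure.real] at key ⊢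
  rw [← h4, h3]
  exact key

lemma aux_word_formula {X : Type*} [MetricSpace X] [MeasurableSpace X] [BorelSpace X] {N : ℕ}
    (f : Fin N → X → X) (rr : Fin N → ℝ) (hr : ∀ i, 0 < rr i) (hf : ∀ i, Continuous (f i))
    (s : ℝ) (μ : Measure X)
    (hμss : ∀ A : Set X, MeasurableSet A →
      μ.real A = ∑ i, rr i ^ s * μ.real (f i ⁻¹' A)) (k : ℕ) :
    ∀ A : Set X, MeasurableSet A →
      μ.real A = ∑ w : Fin k → Fin N, (∏ j, rr (w j)) ^ s * μ.real (wordComp f k w ⁻¹' A) := by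
  induction k with
  | zero =>
    intro A _
    simp [wordComp]
  | succ k ih =>
    intro A hA
    rw [← (Fin.consEquiv (fun _ => Fin N)).sum_comp, Fintype.sum_prod_type, hμss A hA]
    refine Finset.sum_congr rfl fun i _ => ?_
    rw [ih (f i ⁻¹' A) ((hf i).measurable hA), Finset.mul_sum]
    refine Finset.sum_congr rfl fun w _ => ?_
    have h1 : wordComp f (k+1) (Fin.consEquiv (fun _ => Fin N) (i, w)) =
        f i ∘ wordComp f k w := rfl
    rw [h1, Fin.prod_univ_succ, preimage_comp, ← mul_assoc]
    congr 1
    simp only [Fin.consEquiv_apply, Fin.cons_zero, Fin.cons_succ]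
    rw [Real.mul_rpow (hr i).le (Finset.prod_nonneg fun j _ => (hr _).le)]

lemma aux_word_contr {X : Type*} [MetricSpace X] {N : ℕ}
    (f : Fin N → X → X) (rr : Fin N → ℝ) 
    (ρ : ℝ) (hρ0 : 0 < ρ) (hrρ : ∀ i, rr i ≤ ρ)
    (hsim : ∀ i x y, dist (f i x) (f i y) = rr i * dist x y) (k : ℕ) :
    ∀ (w : Fin k → Fin N) (x y : X),
      dist (wordComp f k w x) (wordComp f k w y) ≤ ρ ^ k * dist x y := by
  induction k with
  | zero => intro w x y; simp [wordComp]
  | succ k ih =>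
    intro w x y
    change dist (f _ (wordComp f k _ x)) (f _ (wordComp f k _ y)) ≤ _
    rw [hsim]
    calc _ ≤ ρ * dist (wordComp f k (w ∘ Fin.succ) x) (wordComp f k (w ∘ Fin.succ) y) :=
          mul_le_mul_of_nonneg_right (hrρ _) dist_nonneg
      _ ≤ ρ * (ρ ^ k * dist x y) := mul_le_mul_of_nonneg_left (ih _ _ _) hρ0.le
      _ = _ := by ring

lemma aux_algMu_real {X : Type*} [MetricSpace X] [MeasurableSpace X] [BorelSpace X] {N : ℕ}
    (f : Fin N → X → X) (rr : Fin N → ℝ) (hr : ∀ i, 0 < rr i) (fix : Fin N → X) (s : ℝ)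
    (k : ℕ) (A : Set X) (hA : MeasurableSet A) :
    (algMu f rr fix s (k+1) A).toReal = ∑ w : Fin (k+1) → Fin N, (∏ j, rr (w j)) ^ s *
      A.indicator (fun _ => (1:ℝ)) (wordComp f (k+1) w (fix (w (Fin.last k)))) := by
  classical
  simp only [algMu, Measure.coe_finsetSum, Finset.sum_apply, Measure.smul_apply, smul_eq_mul,
    Measure.dirac_apply' _ hA]
  rw [ENNReal.toReal_sum]
  · refine Finset.sum_congr rfl fun w _ => ?_
    rw [ENNReal.toReal_mul, ENNReal.toReal_ofReal
      (Real.rpow_nonneg (Finset.prod_nonneg fun j _ => (hr _).le) _)]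
    congr 1
    by_cases h : wordComp f (k+1) w (fix (w (Fin.last k))) ∈ A <;> simp [h]
  · intro w _
    refine ENNReal.mul_ne_top ENNReal.ofReal_ne_top ?_
    by_cases h : wordComp f (k+1) w (fix (w (Fin.last k))) ∈ A <;> simp [h]

lemma aux_bounds {X : Type*} [MetricSpace X] [MeasurableSpace X] [BorelSpace X] {N : ℕ}
    (f : Fin N → X → X) (rr : Fin N → ℝ) (hr : ∀ i, 0 < rr i) (hf : ∀ i, Continuous (f i))
    (ρ : ℝ) (hρ0 : 0 < ρ) (hrρ : ∀ i, rr i ≤ ρ)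
    (hsim : ∀ i x y, dist (f i x) (f i y) = rr i * dist x y)
    (E : Set X) (hEcp : IsCompact E) (hEdiam : diam E = 1)
    (s : ℝ) (μ : Measure X) [IsProbabilityMeasure μ]
    (hμss : ∀ A : Set X, MeasurableSet A →
      μ.real A = ∑ i, rr i ^ s * μ.real (f i ⁻¹' A)) (hsupp : μ Eᶜ = 0)
    (fix : Fin N → X) (hfix : ∀ i, fix i ∈ E) (k : ℕ) (x : X) (d : ℝ) :
    |(algMu f rr fix s (k+1) (ball x d)).toReal - (μ (closedBall x d)).toReal| ≤
      μ.real {y | |dist y x - d| ≤ 2 * ρ ^ (k+1)} := by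
  have hρk : 0 < ρ ^ (k+1) := by positivity
  have hdist : ∀ (w : Fin (k+1) → Fin N), ∀ y ∈ E, 
      dist (wordComp f (k+1) w y) (wordComp f (k+1) w (fix (w (Fin.last k)))) ≤ ρ ^ (k+1) := by
    intro w y hy
    refine (aux_word_contr f rr ρ hρ0 hrρ hsim (k+1) w _ _).trans ?_
    have : dist y (fix (w (Fin.last k))) ≤ 1 := by
      rw [← hEdiam]; exact dist_le_diam_of_mem hEcp.isBounded hy (hfix _)
    nlinarith
  have hnn : ∀ w : Fin (k+1) → Fin N, 0 ≤ (∏ j, rr (w j)) ^ s := fun w =>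
    Real.rpow_nonneg (Finset.prod_nonneg fun j _ => (hr _).le) _
  have hE1 : μ E = 1 := (prob_compl_eq_zero_iff hEcp.isClosed.measurableSet).1 hsupp
  have hup : (algMu f rr fix s (k+1) (ball x d)).toReal ≤
      μ.real (closedBall x (d + 2 * ρ ^ (k+1))) := by
    rw [aux_algMu_real f rr hr fix s k _ measurableSet_ball,
      aux_word_formula f rr hr hf s μ hμss (k+1) _ measurableSet_closedBall]
    refine Finset.sum_le_sum fun w _ => mul_le_mul_of_nonneg_left ?_ (hnn w)
    by_cases h : wordComp f (k+1) w (fix (w (Fin.last k))) ∈ ball x d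
    · rw [indicator_of_mem h]
      have h1 : μ.real E ≤ μ.real (wordComp f (k+1) w ⁻¹' closedBall x (d + 2 * ρ ^ (k+1))) := by
        refine measureReal_mono ?_
        intro y hy
        have h2 := hdist w y hy
        have h3 : dist _ x < d := h
        have h4 := dist_triangle (wordComp f (k+1) w y)
          (wordComp f (k+1) w (fix (w (Fin.last k)))) x
        change dist _ x ≤ _
        linarith
      simpa [Measure.real, hE1] using h1
    · rw [indicator_of_notMem h]
      exact measureReal_nonneg
  have hlo : μ.real {y | dist y x < d - 2 * ρ ^ (k+1)} ≤
      (algMu f rr fix s (k+1) (ball x d)).toReal := by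
    change μ.real (ball x (d - 2 * ρ ^ (k+1))) ≤ _
    rw [aux_algMu_real f rr hr fix s k _ measurableSet_ball,
      aux_word_formula f rr hr hf s μ hμss (k+1) _ measurableSet_ball]
    refine Finset.sum_le_sum fun w _ => mul_le_mul_of_nonneg_left ?_ (hnn w)
    by_cases h : wordComp f (k+1) w (fix (w (Fin.last k))) ∈ ball x d
    · rw [indicator_of_mem h]
      exact measureReal_le_one
    · rw [indicator_of_notMem h]
      have h1 : wordComp f (k+1) w ⁻¹' ball x (d - 2 * ρ ^ (k+1)) ⊆ Eᶜ := by
        intro y hy hyE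
        have h2 := hdist w y hyE
        have h3 : dist (wordComp f (k+1) w y) x < d - 2 * ρ ^ (k+1) := hy
        have h4 := dist_triangle_left (wordComp f (k+1) w (fix (w (Fin.last k)))) x
          (wordComp f (k+1) w y)
        apply h
        rw [mem_ball]
        linarith
      have := measure_mono_null h1 hsupp
      simp [Measure.real, this]
  have hup2 : μ.real (closedBall x d) ≤ μ.real (closedBall x (d + 2 * ρ ^ (k+1))) :=
    measureReal_mono (closedBall_subset_closedBall (by linarith))
  have hlo2 : μ.real {y | dist y x < d - 2 * ρ ^ (k+1)} ≤ μ.real (closedBall x d) := by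
    refine measureReal_mono ?_
    intro y hy
    have h3 : dist y x < d - 2 * ρ ^ (k+1) := hy
    change dist y x ≤ d
    linarith
  have hdiff : μ.real (closedBall x (d + 2 * ρ ^ (k+1))) ≤
      μ.real {y | dist y x < d - 2 * ρ ^ (k+1)} + μ.real {y | |dist y x - d| ≤ 2 * ρ ^ (k+1)} := by
    refine le_trans (measureReal_mono ?_) (measureReal_union_le _ _)
    intro y hy
    have h3 : dist y x ≤ d + 2 * ρ ^ (k+1) := hy
    by_cases h : dist y x < d - 2 * ρ ^ (k+1)
    · exact Or.inl h
    · refine Or.inr ?_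
      change |dist y x - d| ≤ _
      rw [abs_le]
      constructor <;> linarith
  change |_ - μ.real (closedBall x d)| ≤ _
  rw [abs_le]
  constructor <;> linarith

lemma algA_subset {X : Type*} {N : ℕ} (f : Fin N → X → X) (E : Set X)
    (hfE : ∀ i, ∀ y ∈ E, f i y ∈ E) (hfixE : ∀ i x, f i x = x → x ∈ E) :
    ∀ k, algA f k ⊆ E
  | 0 => by simp [algA]
  | 1 => by
    rintro x ⟨i, hi⟩
    exact hfixE i x hi
  | (k+2) => by
    intro x hx
    obtain ⟨i, y, hy, rfl⟩ := mem_iUnion.1 hx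
    exact hfE i y (algA_subset f E hfE hfixE (k+1) hy)

theorem discrete_measure_of_balls_converges
{n N : ℕ} (hN : 2 ≤ N)
    (f : Fin N → EuclideanSpace ℝ (Fin n) → EuclideanSpace ℝ (Fin n))
    (rr : Fin N → ℝ) (hr : ∀ i, 0 < rr i ∧ rr i < 1)
    (hsim : ∀ i x y, dist (f i x) (f i y) = rr i * dist x y)
    (E : Set (EuclideanSpace ℝ (Fin n))) (hEne : E.Nonempty) (hEcp : IsCompact E)
    (hEinv : E = ⋃ i, f i '' E)
    (hssc : ∀ i j, i ≠ j → Disjoint (f i '' E) (f j '' E))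
(hEdiam : Metric.diam E = 1)
(rmin : ℝ) (hrmin : IsLeast (Set.range rr) rmin)
(c : ℝ) (hc : 0 < c)
    (hcdef : c = sInf {d : ℝ | ∃ i j : Fin N, i ≠ j ∧
      ∃ u ∈ f i '' E, ∃ v ∈ f j '' E, d = dist u v})
(s : ℝ) (hs : 0 < s) (hsum : ∑ i, rr i ^ s = 1)
    (μ : MeasureTheory.Measure (EuclideanSpace ℝ (Fin n))) (hμ : IsProbabilityMeasure μ)
    (hμss : ∀ A : Set (EuclideanSpace ℝ (Fin n)), MeasurableSet A →
      μ A = ∑ i, ENNReal.ofReal (rr i ^ s) * μ (f i ⁻¹' A))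
(fix : Fin N → EuclideanSpace ℝ (Fin n)) (hfix : ∀ i, f i (fix i) = fix i)
    (ct : ℝ) (hct : 0 < ct) (hct' : ct ≤ c)
    (x : ℕ → EuclideanSpace ℝ (Fin n)) (d : ℕ → ℝ)
    (hx : ∀ k, x k ∈ ⋃ j, algA f j)
    (hd : ∀ k, d k ∈ Set.Icc ct (ct / rmin)) :
    Filter.Tendsto (fun k =>
        |(algMu f rr fix s k (Metric.ball (x k) (d k))).toReal -
          (μ (Metric.closedBall (x k) (d k))).toReal|)
      Filter.atTop (nhds 0) := by
  have hr0 : ∀ i, 0 < rr i := fun i => (hr i).1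
  have hne : Nonempty (Fin N) := ⟨⟨0, by omega⟩⟩
  obtain ⟨i0, hi0⟩ := Finite.exists_max rr
  obtain ⟨ρ, hρ0, hρ1, hrρ⟩ : ∃ ρ : ℝ, 0 < ρ ∧ ρ < 1 ∧ ∀ i, rr i ≤ ρ :=
    ⟨rr i0, hr0 i0, (hr i0).2, hi0⟩
  have hfE : ∀ i, ∀ y ∈ E, f i y ∈ E := by
    intro i y hy
    rw [hEinv]
    exact mem_iUnion.2 ⟨i, y, hy, rfl⟩
  have hfixE : ∀ i x, f i x = x → x ∈ E := fun i x h =>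
    aux_fix_mem hEcp hEne (f i) (rr i) (hr i).2 (hsim i) (hfE i) x h
  have hxE : ∀ k, x k ∈ E := by
    intro k
    obtain ⟨j, hj⟩ := mem_iUnion.1 (hx k)
    exact algA_subset f E hfE hfixE j hj
  have hcont : ∀ i, Continuous (f i) := fun i =>
    (LipschitzWith.of_dist_le_mul (K := ⟨rr i, (hr0 i).le⟩) fun a b => (hsim i a b).le).continuous
  have hμr : ∀ A : Set (EuclideanSpace ℝ (Fin n)), MeasurableSet A →
      μ.real A = ∑ i, rr i ^ s * μ.real (f i ⁻¹' A) := by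
    intro A hA
    simp only [Measure.real]
    rw [hμss A hA, ENNReal.toReal_sum]
    · refine Finset.sum_congr rfl fun i _ => ?_
      rw [ENNReal.toReal_mul, ENNReal.toReal_ofReal (Real.rpow_nonneg (hr0 i).le _)]
    · intro i _
      exact ENNReal.mul_ne_top ENNReal.ofReal_ne_top (measure_ne_top _ _)
  have hsupp : μ Eᶜ = 0 :=
    aux_supp f rr hr0 ρ hρ0 hρ1 hrρ hsim E hEne hEcp hfE s hsum μ hμr
  apply tendsto_of_subseq_tendsto
  intro ns hns
  obtain ⟨⟨x0, d0⟩, ⟨hx0, hd0⟩, φ, hφ, hlim⟩ :=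
    (hEcp.prod (isCompact_Icc (a := ct) (b := ct / rmin))).tendsto_subseq
      (x := fun k => (x (ns k), d (ns k))) (fun k => ⟨hxE _, hd _⟩)
  refine ⟨φ, ?_⟩
  have hlimx : Tendsto (fun k => x (ns (φ k))) atTop (𝓝 x0) :=
    (continuous_fst.tendsto _).comp hlim
  have hlimd : Tendsto (fun k => d (ns (φ k))) atTop (𝓝 d0) :=
    (continuous_snd.tendsto _).comp hlim
  have hnφ : Tendsto (fun k => ns (φ k)) atTop atTop := hns.comp hφ.tendsto_atTop
  have hd0pos : 0 < d0 := lt_of_lt_of_le hct hd0.1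
  have hsph := aux_sphere f rr hr0 ρ hρ0 hρ1 hrρ hsim E hEcp hEinv hfE s hsum μ hμr hsupp
    x0 hx0 d0 hd0pos
  have herr : Tendsto (fun k => 2 * ρ ^ (ns (φ k)) + dist (x (ns (φ k))) x0 +
      dist (d (ns (φ k))) d0) atTop (𝓝 0) := by
    have h1 := ((tendsto_pow_atTop_nhds_zero_of_lt_one hρ0.le hρ1).comp hnφ).const_mul 2
    have h2 := tendsto_iff_dist_tendsto_zero.1 hlimx
    have h3 := tendsto_iff_dist_tendsto_zero.1 hlimd
    simpa using (h1.add h2).add h3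
  rw [Metric.tendsto_nhds]
  intro η hη
  obtain ⟨ε, hε, hsmall⟩ := aux_small_level μ (fun y => dist y x0 - d0) (by fun_prop) η
    (by rw [hsph]; exact hη)
  filter_upwards [herr.eventually (gt_mem_nhds hε), hnφ.eventually (eventually_ge_atTop 1)]
    with k hk hk1
  obtain ⟨m, hm⟩ : ∃ m, ns (φ k) = m + 1 := ⟨ns (φ k) - 1, by omega⟩
  have hb := aux_bounds f rr hr0 hcont ρ hρ0 hrρ hsim E hEcp hEdiam s μ hμr hsupp fix
    (fun i => hfixE i _ (hfix i)) m (x (ns (φ k))) (d (ns (φ k)))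
  rw [← hm] at hb
  rw [Real.dist_eq, sub_zero, abs_abs]
  refine lt_of_le_of_lt (hb.trans (measureReal_mono ?_)) hsmall
  intro y hy
  have hy' : |dist y (x (ns (φ k))) - d (ns (φ k))| ≤ 2 * ρ ^ (ns (φ k)) := hy
  change |dist y x0 - d0| ≤ ε
  have h1 := dist_triangle y (x (ns (φ k))) x0
  have h2 := dist_triangle_right y (x (ns (φ k))) x0
  rw [Real.dist_eq] at hk
  obtain ⟨h3, h4⟩ := abs_le.1 hy'
  have h5 := neg_abs_le (d (ns (φ k)) - d0)
  have h6 := le_abs_self (d (ns (φ k)) - d0)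
  rw [abs_le]
  constructor <;> linarith
end
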